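/- Let l ≥ 2. Let Φ⁺ ⊂ ℕ^l be the set consisting of: α_i + ⋯ + α_j for 1 ≤ i ≤ j ≤ l−1; α_i + ⋯ + α_l for 1 ≤ i ≤ l; and α_i + ⋯ + α_{j−1} + 2(α_j + ⋯ + α_l) for 1 ≤ i < j ≤ l, where α_s denotes the s-th standard basis vector of ℕ^l (this is the set of the l² positive roots of type B_l in simple-root coordinates, with α_l the short simple root). Then in ℤ[[q, y_1, …, y_l]]: ∏_{c ∈ Φ⁺} ∏_{n≥1} (1 − q^n y_1^{c_1} ⋯ y_l^{c_l})^{−1} = ∑ over all l-tuples (r_1, …, r_l) of descending sequences of q^{E} · ( ∏_{i=1}^{l} y_i^{|r_i|} ) · ∏_{i=1}^{l} ∏_{j≥1} (q;q)_{r_i^{(j)} − r_i^{(j+1)}}^{−1}, where E = ∑_{i=1}^{l} ∑_{t≥1} (r_i^{(t)})² − ∑_{i=2}^{l−1} ∑_{t≥1} r_{i−1}^{(t)} r_i^{(t)} − ∑_{t≥1} r_{l−1}^{(t)} ( r_l^{(2t−1)} + r_l^{(2t)} ); here E is a nonnegative integer. -/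

import Mathlib

open MvPowerSeries

/-- The product topology (coefficientwise convergence) on multivariate formal power series. -/
noncomputable instance (σ R : Type*) [TopologicalSpace R] :
    TopologicalSpace (MvPowerSeries σ R) :=
  inferInstanceAs (TopologicalSpace ((σ →₀ ℕ) → R))

/-- `r : ℕ → ℕ` is a descending sequence (indexed so that `r t = r^{(t+1)}`):
nonincreasing and eventually zero. -/
def IsDescending (r : ℕ → ℕ) : Prop :=
  Antitone r ∧ ∃ N, ∀ t ≥ N, r t = 0

/-- The variable `q` in `ℤ[[q, y₁, …, y_l]]`, realized as `MvPowerSeries (Fin (l+1)) ℤ`. -/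
noncomputable def Q (l : ℕ) : MvPowerSeries (Fin (l + 1)) ℤ := X 0

/-- The variable `yᵢ` (`1 ≤ i ≤ l`) in `ℤ[[q, y₁, …, y_l]]`. -/
noncomputable def Y (l : ℕ) (i : ℕ) : MvPowerSeries (Fin (l + 1)) ℤ :=
  if h : i < l + 1 then X ⟨i, h⟩ else 1

/-- `(q;q)_m = ∏_{u=1}^m (1 - qᵘ)`. -/
noncomputable def qPoch (l : ℕ) (m : ℕ) : MvPowerSeries (Fin (l + 1)) ℤ :=
  ∏ u ∈ Finset.range m, (1 - Q l ^ (u + 1))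

open Finset

section Strips

variable {R : Type*} [CommRing R]

/-- Weight of a strip `ε` looking at the predecessor of each column. -/
def upWeight (z ρ : ℕ → R) (ε : Finset ℕ) : R :=
  ∏ t ∈ ε, z t * (if t - 1 ∈ ε then 1 else 1 - ρ (t - 1))

/-- Weight of a strip `ε` looking at the successor of each column. -/
def dnWeight (z ς : ℕ → R) (ε : Finset ℕ) : R :=
  ∏ t ∈ ε, z t * (if t + 1 ∈ ε then 1 else 1 - ς t)

/-- The weight `dnWeight` of a strip in `range M`, with the factor closing column `M - 1`
left out. -/
def dnOpen (z ς : ℕ → R) (M : ℕ) (ε : Finset ℕ) : R :=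
  ∏ t ∈ ε, z t * (if t + 1 ∈ ε ∨ t + 1 = M then 1 else 1 - ς t)

/-- The weight `upWeight` of a strip in `range M`, with the factor opening column `M`. -/
def upNext (z ρ : ℕ → R) (M : ℕ) (ε : Finset ℕ) : R :=
  upWeight z ρ ε * (if M = 0 ∨ M - 1 ∈ ε then 1 else 1 - ρ (M - 1))

variable (z ρ ς : ℕ → R) {M : ℕ} {ε : Finset ℕ}

theorem notMem_of_subset_range (h : ε ⊆ range M) : M ∉ ε := fun h' => by
  simpa using h h'

theorem upWeight_insert (h : ε ⊆ range M) :
    upWeight z ρ (insert M ε) = z M * upNext z ρ M ε := by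
  have hM := notMem_of_subset_range h
  rw [upNext, upWeight, prod_insert hM, upWeight]
  have h1 : ∏ t ∈ ε, z t * (if t - 1 ∈ insert M ε then 1 else 1 - ρ (t - 1)) =
      ∏ t ∈ ε, z t * (if t - 1 ∈ ε then 1 else 1 - ρ (t - 1)) := by
    refine prod_congr rfl fun t ht => ?_
    have : t < M := by simpa using h ht
    have : t - 1 ≠ M := by omega
    simp [this]
  rw [h1]
  have h2 : (M - 1 ∈ insert M ε) ↔ (M = 0 ∨ M - 1 ∈ ε) := by
    rw [mem_insert]
    refine or_congr_left ?_
    omega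
  simp only [h2]
  ring

theorem upNext_succ (h : ε ⊆ range M) :
    upNext z ρ (M + 1) ε = (1 - ρ M) * upWeight z ρ ε := by
  have hM := notMem_of_subset_range h
  simp [upNext, hM, mul_comm]

theorem upNext_succ_insert (h : ε ⊆ range M) :
    upNext z ρ (M + 1) (insert M ε) = z M * upNext z ρ M ε := by
  rw [upNext, upWeight_insert z ρ h]
  simp

theorem dnOpen_succ (h : ε ⊆ range M) : dnOpen z ς (M + 1) ε = dnWeight z ς ε := by
  refine prod_congr rfl fun t ht => ?_
  have : t < M := by simpa using h ht
  have : t ≠ M := by omega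
  simp [this]

theorem dnOpen_succ_insert (h : ε ⊆ range M) :
    dnOpen z ς (M + 1) (insert M ε) = z M * dnOpen z ς M ε := by
  have hM := notMem_of_subset_range h
  rw [dnOpen, prod_insert hM, dnOpen]
  congr 1
  · simp
  · refine prod_congr rfl fun t ht => ?_
    have : t < M := by simpa using h ht
    have h3 : t ≠ M := by omega
    simp [h3, or_comm]

theorem dnWeight_insert (h : ε ⊆ range M) :
    dnWeight z ς (insert M ε) = z M * (1 - ς M) * dnOpen z ς M ε := by
  have hM := notMem_of_subset_range h
  have hM' : M + 1 ∉ ε := fun h' => by simpa using h h'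
  rw [dnWeight, prod_insert hM, dnOpen]
  congr 1
  · simp [hM']
  · refine prod_congr rfl fun t ht => ?_
    simp [or_comm]

theorem sum_powerset_range_succ {V : Type*} [AddCommMonoid V] (f : Finset ℕ → V) (M : ℕ) :
    ∑ ε ∈ (range (M + 1)).powerset, f ε =
      ∑ ε ∈ (range M).powerset, f ε + ∑ ε ∈ (range M).powerset, f (insert M ε) := by
  rw [range_add_one, sum_powerset_insert (by simp)]

/-- Comparison of the two kinds of strip weights. -/
theorem sum_upWeight_eq_sum_dnWeight (h : ∀ t, z t * ς t = z (t + 1) * ρ t) (M : ℕ) :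
    ∑ ε ∈ (range M).powerset, upWeight z ρ ε = ∑ ε ∈ (range M).powerset, dnOpen z ς M ε ∧
    ∑ ε ∈ (range M).powerset, dnWeight z ς ε = ∑ ε ∈ (range M).powerset, upWeight z ρ ε +
      z M * (∑ ε ∈ (range M).powerset, upNext z ρ M ε
        - ∑ ε ∈ (range M).powerset, upWeight z ρ ε) := by
  induction M with
  | zero => simp [upWeight, dnOpen, dnWeight, upNext]
  | succ M ih =>
    obtain ⟨h1, h2⟩ := ih
    have e1 : ∑ ε ∈ (range M).powerset, upWeight z ρ (insert M ε) =
        z M * ∑ ε ∈ (range M).powerset, upNext z ρ M ε := by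
      rw [mul_sum]
      exact sum_congr rfl fun ε hε => upWeight_insert z ρ (mem_powerset.1 hε)
    have e2 : ∑ ε ∈ (range M).powerset, upNext z ρ (M + 1) (insert M ε) =
        z M * ∑ ε ∈ (range M).powerset, upNext z ρ M ε := by
      rw [mul_sum]
      exact sum_congr rfl fun ε hε => upNext_succ_insert z ρ (mem_powerset.1 hε)
    have e3 : ∑ ε ∈ (range M).powerset, upNext z ρ (M + 1) ε =
        (1 - ρ M) * ∑ ε ∈ (range M).powerset, upWeight z ρ ε := by
      rw [mul_sum]
      exact sum_congr rfl fun ε hε => upNext_succ z ρ (mem_powerset.1 hε)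
    have e4 : ∑ ε ∈ (range M).powerset, dnOpen z ς (M + 1) ε =
        ∑ ε ∈ (range M).powerset, dnWeight z ς ε :=
      sum_congr rfl fun ε hε => dnOpen_succ z ς (mem_powerset.1 hε)
    have e5 : ∑ ε ∈ (range M).powerset, dnOpen z ς (M + 1) (insert M ε) =
        z M * ∑ ε ∈ (range M).powerset, dnOpen z ς M ε := by
      rw [mul_sum]
      exact sum_congr rfl fun ε hε => dnOpen_succ_insert z ς (mem_powerset.1 hε)
    have e6 : ∑ ε ∈ (range M).powerset, dnWeight z ς (insert M ε) =
        z M * (1 - ς M) * ∑ ε ∈ (range M).powerset, dnOpen z ς M ε := by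
      rw [mul_sum]
      exact sum_congr rfl fun ε hε => dnWeight_insert z ς (mem_powerset.1 hε)
    simp only [sum_powerset_range_succ, e1, e2, e3, e4, e5, e6, h2, ← h1]
    refine ⟨by ring, ?_⟩
    linear_combination (-∑ ε ∈ (range M).powerset, upWeight z ρ ε) * h M

theorem sum_upNext_eq_prod (M : ℕ) :
    ∑ ε ∈ (range M).powerset, upNext z (fun _ => 1) M ε = ∏ t ∈ range M, z t := by
  induction M with
  | zero => simp [upNext, upWeight]
  | succ M ih =>
    rw [sum_powerset_range_succ, prod_range_succ, ← ih, sum_mul]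
    have e3 : ∑ ε ∈ (range M).powerset, upNext z (fun _ => 1) (M + 1) ε = 0 :=
      sum_eq_zero fun ε hε => by rw [upNext_succ z _ (mem_powerset.1 hε)]; simp
    rw [e3, zero_add]
    exact sum_congr rfl fun ε hε => by rw [upNext_succ_insert z _ (mem_powerset.1 hε), mul_comm]

/-- Strips of a decreasing sequence that is trivial at the end have total `dnWeight` the product
of all the `z t`. -/
theorem sum_dnWeight_eq_prod (h : ∀ t, z t * ς t = z (t + 1)) (hM : z M = 1) :
    ∑ ε ∈ (range M).powerset, dnWeight z ς ε = ∏ t ∈ range M, z t := by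
  rw [(sum_upWeight_eq_sum_dnWeight z (fun _ => 1) ς (by simpa using h) M).2,
    sum_upNext_eq_prod, hM]
  ring

open Polynomial in
theorem coeff_sum_powerset (c : Finset ℕ → R) (s : Finset ℕ) (k : ℕ) :
    (∑ ε ∈ s.powerset, Polynomial.C (c ε) * Polynomial.X ^ #ε : R[X]).coeff k =
      ∑ ε ∈ powersetCard k s, c ε := by
  rw [finsetSum_coeff, ← sum_filter_add_sum_filter_not _ (fun ε => #ε = k),
    powersetCard_eq_filter, add_eq_left.2]
  · exact sum_congr rfl fun ε hε => by simp [(mem_filter.1 hε).2]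
  · refine sum_eq_zero fun ε hε => ?_
    have := (mem_filter.1 hε).2
    rw [coeff_C_mul_X_pow, if_neg (Ne.symm this)]

open Polynomial in
/-- Comparison of the two kinds of strip weights, for strips of a given size. -/
theorem sum_powersetCard_upWeight (h : ∀ t, z t * ς t = z (t + 1) * ρ t) (M k : ℕ) :
    ∑ ε ∈ powersetCard (k + 1) (range (M + 1)), upWeight z ρ ε
        - z M * ∑ ε ∈ powersetCard k (range M), upWeight z ρ ε =
      ∑ ε ∈ powersetCard (k + 1) (range M), dnWeight z ς ε := by
  have hu : ∀ ε,
      upWeight (fun t => Polynomial.C (z t) * Polynomial.X) (fun t => Polynomial.C (ρ t)) ε =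
      Polynomial.C (upWeight z ρ ε) * Polynomial.X ^ #ε := by
    intro ε
    rw [upWeight, upWeight, map_prod, ← prod_const, ← prod_mul_distrib]
    refine prod_congr rfl fun t _ => ?_
    split_ifs <;> simp
    ring
  have hd : ∀ ε,
      dnWeight (fun t => Polynomial.C (z t) * Polynomial.X) (fun t => Polynomial.C (ς t)) ε =
      Polynomial.C (dnWeight z ς ε) * Polynomial.X ^ #ε := by
    intro ε
    rw [dnWeight, dnWeight, map_prod, ← prod_const, ← prod_mul_distrib]
    refine prod_congr rfl fun t _ => ?_
    split_ifs <;> simp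
    ring
  have hz : ∀ t, Polynomial.C (z t) * Polynomial.X * Polynomial.C (ς t) =
      Polynomial.C (z (t + 1)) * Polynomial.X * Polynomial.C (ρ t) := by
    intro t
    have := congrArg (Polynomial.C : R → R[X]) (h t)
    simp only [map_mul] at this
    linear_combination (Polynomial.X : R[X]) * this
  have key := sum_upWeight_eq_sum_dnWeight (fun t => Polynomial.C (z t) * Polynomial.X)
    (fun t => Polynomial.C (ρ t)) (fun t => Polynomial.C (ς t)) hz
  have k2 := (key M).2
  have e1 : ∑ ε ∈ (range M).powerset,
        upWeight (fun t => Polynomial.C (z t) * Polynomial.X) (fun t => Polynomial.C (ρ t)) (insert M ε) =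
        Polynomial.C (z M) * Polynomial.X * ∑ ε ∈ (range M).powerset,
          upNext (fun t => Polynomial.C (z t) * Polynomial.X) (fun t => Polynomial.C (ρ t)) M ε := by
    rw [mul_sum]
    exact sum_congr rfl fun ε hε => upWeight_insert _ _ (mem_powerset.1 hε)
  have e0 := sum_powerset_range_succ
    (upWeight (fun t => Polynomial.C (z t) * Polynomial.X) (fun t => Polynomial.C (ρ t))) M
  rw [e1] at e0
  have k3 : ∑ ε ∈ (range (M + 1)).powerset,
        upWeight (fun t => Polynomial.C (z t) * Polynomial.X) (fun t => Polynomial.C (ρ t)) ε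
      - Polynomial.C (z M) * (∑ ε ∈ (range M).powerset,
        upWeight (fun t => Polynomial.C (z t) * Polynomial.X) (fun t => Polynomial.C (ρ t)) ε) *
          Polynomial.X =
      ∑ ε ∈ (range M).powerset,
        dnWeight (fun t => Polynomial.C (z t) * Polynomial.X) (fun t => Polynomial.C (ς t)) ε := by
    rw [k2, e0]; ring
  simp only [hu, hd] at k3
  have k4 := congrArg (fun p : R[X] => p.coeff (k + 1)) k3
  simpa only [coeff_sub, Polynomial.coeff_mul_X, Polynomial.coeff_C_mul,
    coeff_sum_powerset] using k4

end Strips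

section Alternation

/-- The number of elements of `η` below `i`. -/
def below (η : Finset ℕ) (i : ℕ) : ℕ := #(η.filter (· < i))

/-- Halves of the elements of `η` in odd position (first, third, …). -/
def altFst (η : Finset ℕ) : Finset ℕ := (η.filter fun i => Even (below η i)).image (· / 2)

/-- Halves of the elements of `η` in even position (second, fourth, …). -/
def altSnd (η : Finset ℕ) : Finset ℕ := (η.filter fun i => ¬ Even (below η i)).image (· / 2)

theorem below_succ (η : Finset ℕ) (i : ℕ) :
    below η (i + 1) = below η i + if i ∈ η then 1 else 0 := by
  unfold below
  split_ifs with h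
  · have : η.filter (· < i + 1) = insert i (η.filter (· < i)) := by
      ext j; simp only [mem_filter, mem_insert]
      constructor
      · rintro ⟨h1, h2⟩
        rcases Nat.lt_succ_iff_lt_or_eq.1 h2 with h3 | h3
        · exact Or.inr ⟨h1, h3⟩
        · exact Or.inl h3
      · rintro (rfl | ⟨h1, h2⟩)
        · exact ⟨h, by omega⟩
        · exact ⟨h1, by omega⟩
    rw [this, card_insert_of_notMem (by simp)]
  · rw [add_zero]
    congr 1
    refine filter_congr fun j hj => ?_
    have : j ≠ i := fun e => h (e ▸ hj)
    omega

theorem below_insert_self {η : Finset ℕ} {M : ℕ} (h : η ⊆ range M) :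
    below (insert M η) M = #η := by
  unfold below
  congr 1
  ext j
  simp only [mem_filter, mem_insert]
  constructor
  · rintro ⟨h1 | h1, h2⟩
    · omega
    · exact h1
  · intro h1
    exact ⟨Or.inr h1, by simpa using h h1⟩

theorem below_insert_of_lt {η : Finset ℕ} {M i : ℕ} (h : i < M) :
    below (insert M η) i = below η i := by
  unfold below
  rw [filter_insert, if_neg (by omega)]

theorem filter_below_insert {η : Finset ℕ} {M : ℕ} (h : η ⊆ range M) (P : ℕ → Prop)
    [DecidablePred P] :
    (insert M η).filter (fun i => P (below (insert M η) i)) =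
      if P #η then insert M (η.filter fun i => P (below η i))
      else η.filter fun i => P (below η i) := by
  rw [filter_insert, below_insert_self h]
  have : η.filter (fun i => P (below (insert M η) i)) = η.filter (fun i => P (below η i)) :=
    filter_congr fun i hi => by rw [below_insert_of_lt (by simpa using h hi)]
  rw [this]

theorem altFst_insert {η : Finset ℕ} {M : ℕ} (h : η ⊆ range M) :
    altFst (insert M η) = if Even #η then insert (M / 2) (altFst η) else altFst η := by
  unfold altFst
  rw [filter_below_insert h Even]
  split_ifs <;> simp [image_insert]

theorem altSnd_insert {η : Finset ℕ} {M : ℕ} (h : η ⊆ range M) :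
    altSnd (insert M η) = if Even #η then altSnd η else insert (M / 2) (altSnd η) := by
  unfold altSnd
  rw [filter_below_insert h fun n => ¬ Even n]
  split_ifs <;> simp_all [image_insert]

theorem card_filter_below (η : Finset ℕ) :
    #(η.filter fun i => Even (below η i)) = (#η + 1) / 2 ∧
      #(η.filter fun i => ¬ Even (below η i)) = #η / 2 := by
  induction η using Finset.induction_on_max with
  | empty => simp
  | insert M η hM ih =>
    have h : η ⊆ range M := fun i hi => by simpa using hM i hi
    have hn : M ∉ η := notMem_of_subset_range h
    rw [filter_below_insert h Even, filter_below_insert h fun n => ¬ Even n,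
      card_insert_of_notMem hn]
    by_cases he : Even #η
    · simp only [he, if_true, not_true_eq_false, if_false]
      rw [card_insert_of_notMem (by simp [hn]), ih.1, ih.2]
      obtain ⟨c, hc⟩ := he
      omega
    · simp only [he, if_false, not_false_eq_true, if_true]
      rw [card_insert_of_notMem (by simp [hn]), ih.1, ih.2]
      obtain ⟨c, hc⟩ := Nat.not_even_iff_odd.1 he
      omega

theorem eq_two_mul_of_div_two {i t : ℕ} (h : i / 2 = t) : i = 2 * t ∨ i = 2 * t + 1 := by omega

theorem injOn_half (η : Finset ℕ) (b : Prop) :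
    Set.InjOn (· / 2) {i | i ∈ η ∧ (Even (below η i) ↔ b)} := by
  have key : ∀ t, 2 * t ∈ η → (Even (below η (2 * t)) ↔ b) →
      (Even (below η (2 * t + 1)) ↔ b) → False := by
    intro t h1 h2 h3
    rw [below_succ, if_pos h1, Nat.even_add_one, h2] at h3
    tauto
  intro i hi j hj hij
  rcases eq_two_mul_of_div_two (show i / 2 = j / 2 from hij) with h | h <;>
    rcases eq_two_mul_of_div_two (rfl : j / 2 = j / 2) with h' | h'
  · omega
  · exact (key (j / 2) (h ▸ hi.1) (h ▸ hi.2) (h' ▸ hj.2)).elim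
  · exact (key (j / 2) (h' ▸ hj.1) (h' ▸ hj.2) (h ▸ hi.2)).elim
  · omega

theorem card_altFst (η : Finset ℕ) : #(altFst η) = (#η + 1) / 2 := by
  rw [altFst, card_image_of_injOn, (card_filter_below η).1]
  refine (injOn_half η True).mono fun i hi => ?_
  simpa using hi

theorem card_altSnd (η : Finset ℕ) : #(altSnd η) = #η / 2 := by
  rw [altSnd, card_image_of_injOn, (card_filter_below η).2]
  refine (injOn_half η False).mono fun i hi => ?_
  simpa using hi

theorem mem_image_half {η : Finset ℕ} {P : ℕ → Prop} [DecidablePred P] {t : ℕ} :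
    t ∈ (η.filter P).image (· / 2) ↔
      (2 * t ∈ η ∧ P (2 * t)) ∨ (2 * t + 1 ∈ η ∧ P (2 * t + 1)) := by
  simp only [mem_image, mem_filter]
  constructor
  · rintro ⟨i, hi, h⟩
    rcases eq_two_mul_of_div_two h with h | h
    · exact Or.inl (h ▸ hi)
    · exact Or.inr (h ▸ hi)
  · rintro (h | h)
    · exact ⟨_, h, by omega⟩
    · exact ⟨_, h, by omega⟩

theorem mem_altFst {η : Finset ℕ} {t : ℕ} : t ∈ altFst η ↔
    (2 * t ∈ η ∧ Even (below η (2 * t))) ∨ (2 * t + 1 ∈ η ∧ Even (below η (2 * t + 1))) :=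
  mem_image_half

theorem mem_altSnd {η : Finset ℕ} {t : ℕ} : t ∈ altSnd η ↔
    (2 * t ∈ η ∧ ¬ Even (below η (2 * t))) ∨
      (2 * t + 1 ∈ η ∧ ¬ Even (below η (2 * t + 1))) :=
  mem_image_half

theorem alt_count (η : Finset ℕ) (t : ℕ) :
    ((if 2 * t ∈ η then 1 else 0) + if 2 * t + 1 ∈ η then 1 else 0) =
      (if t ∈ altFst η then 1 else 0) + if t ∈ altSnd η then 1 else 0 := by
  simp only [mem_altFst, mem_altSnd, below_succ]
  by_cases h1 : 2 * t ∈ η <;> by_cases h2 : 2 * t + 1 ∈ η <;>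
    by_cases h3 : Even (below η (2 * t)) <;> simp [h1, h2, h3, Nat.even_add_one]

theorem sum_smul_eq_of_forall {ι κ α k V : Type*} [Field k] [AddCommGroup V] [Module k V]
    (S : Finset ι) (P : Finset κ) (c : ι → k) (d : κ → k) (b : ι → α) (e : κ → α)
    (h : ∀ g : α → k, ∑ i ∈ S, c i * g (b i) = ∑ j ∈ P, d j * g (e j)) (v : α → V) :
    ∑ i ∈ S, c i • v (b i) = ∑ j ∈ P, d j • v (e j) := by
  classical
  have key : ∑ i ∈ S, Finsupp.single (b i) (c i) = ∑ j ∈ P, Finsupp.single (e j) (d j) := by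
    ext a
    simpa [Finsupp.finsetSum_apply, Finsupp.single_apply] using h fun x => if x = a then 1 else 0
  have := congrArg (Finsupp.linearCombination k v) key
  simpa using this

variable {k : Type*} [Field k]

/-- The `dnWeight` of a strip of columns removed from `s`. -/
noncomputable def dn (q : k) (s : ℕ → ℕ) (ε : Finset ℕ) : k :=
  dnWeight (fun t => q ^ (-(s t : ℤ))) (fun t => q ^ ((s t : ℤ) - s (t + 1))) ε

/-- The `upWeight` of a strip of columns added to `s`. -/
noncomputable def up (q : k) (s : ℕ → ℕ) (ε : Finset ℕ) : k :=
  upWeight (fun t => q ^ (s t : ℤ)) (fun t => q ^ ((s t : ℤ) - s (t + 1))) ε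

/-- Sums of adjacent pairs of entries. -/
def pairSum (u : ℕ → ℕ) (t : ℕ) : ℕ := u (2 * t) + u (2 * t + 1)

/-- The part of a sum over strips in `range M` given by strips of even size. -/
def evenSum (w : Finset ℕ → k) (b : Finset ℕ → Finset ℕ) (M : ℕ) (g : Finset ℕ → k) : k :=
  ∑ η ∈ (range M).powerset, if Even #η then w η * g (b η) else 0

/-- The part of a sum over strips in `range M` given by strips of odd size. -/
def oddSum (w : Finset ℕ → k) (b : Finset ℕ → Finset ℕ) (M : ℕ) (g : Finset ℕ → k) : k :=
  ∑ η ∈ (range M).powerset, if Even #η then 0 else w η * g (b η)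

theorem evenSum_add_oddSum (w : Finset ℕ → k) (b : Finset ℕ → Finset ℕ) (M : ℕ)
    (g : Finset ℕ → k) :
    evenSum w b M g + oddSum w b M g = ∑ η ∈ (range M).powerset, w η * g (b η) := by
  rw [evenSum, oddSum, ← sum_add_distrib]
  exact sum_congr rfl fun η _ => by split_ifs <;> simp

section Step

variable {w w' w'' : Finset ℕ → k} {c : k} {M : ℕ}
  (h1 : ∀ η ⊆ range M, w η = w' η) (h2 : ∀ η ⊆ range M, w (insert M η) = c * w'' η)
  (g : Finset ℕ → k)

include h1 h2

theorem evenSum_altFst_succ : evenSum w altFst (M + 1) g =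
    evenSum w' altFst M g + c * oddSum w'' altFst M g := by
  rw [evenSum, sum_powerset_range_succ, oddSum, evenSum, mul_sum]
  congr 1
  · exact sum_congr rfl fun η hη => by rw [h1 η (mem_powerset.1 hη)]
  · refine sum_congr rfl fun η hη => ?_
    have h := mem_powerset.1 hη
    rw [card_insert_of_notMem (notMem_of_subset_range h), h2 η h, altFst_insert h]
    simp only [Nat.even_add_one]
    split_ifs <;> ring

theorem oddSum_altFst_succ : oddSum w altFst (M + 1) g =
    oddSum w' altFst M g + c * evenSum w'' altFst M (fun ε => g (insert (M / 2) ε)) := by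
  rw [oddSum, sum_powerset_range_succ, oddSum, evenSum, mul_sum]
  congr 1
  · exact sum_congr rfl fun η hη => by rw [h1 η (mem_powerset.1 hη)]
  · refine sum_congr rfl fun η hη => ?_
    have h := mem_powerset.1 hη
    rw [card_insert_of_notMem (notMem_of_subset_range h), h2 η h, altFst_insert h]
    simp only [Nat.even_add_one]
    split_ifs <;> ring

theorem evenSum_altSnd_succ : evenSum w altSnd (M + 1) g =
    evenSum w' altSnd M g + c * oddSum w'' altSnd M (fun ε => g (insert (M / 2) ε)) := by
  rw [evenSum, sum_powerset_range_succ, oddSum, evenSum, mul_sum]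
  congr 1
  · exact sum_congr rfl fun η hη => by rw [h1 η (mem_powerset.1 hη)]
  · refine sum_congr rfl fun η hη => ?_
    have h := mem_powerset.1 hη
    rw [card_insert_of_notMem (notMem_of_subset_range h), h2 η h, altSnd_insert h]
    simp only [Nat.even_add_one]
    split_ifs <;> ring

theorem oddSum_altSnd_succ : oddSum w altSnd (M + 1) g =
    oddSum w' altSnd M g + c * evenSum w'' altSnd M g := by
  rw [oddSum, sum_powerset_range_succ, oddSum, evenSum, mul_sum]
  congr 1
  · exact sum_congr rfl fun η hη => by rw [h1 η (mem_powerset.1 hη)]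
  · refine sum_congr rfl fun η hη => ?_
    have h := mem_powerset.1 hη
    rw [card_insert_of_notMem (notMem_of_subset_range h), h2 η h, altSnd_insert h]
    simp only [Nat.even_add_one]
    split_ifs <;> ring

theorem sum_strips_succ : ∑ ε ∈ (range (M + 1)).powerset, w ε * g ε =
    ∑ ε ∈ (range M).powerset, w' ε * g ε +
      c * ∑ ε ∈ (range M).powerset, w'' ε * g (insert M ε) := by
  rw [sum_powerset_range_succ, mul_sum]
  congr 1
  · exact sum_congr rfl fun η hη => by rw [h1 η (mem_powerset.1 hη)]
  · refine sum_congr rfl fun η hη => ?_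
    rw [h2 η (mem_powerset.1 hη)]
    ring

end Step

variable {q : k} (hq : q ≠ 0) (u : ℕ → ℕ)

include hq

theorem dn_alt_invariants (M : ℕ) :
    let z : ℕ → k := fun t => q ^ (-(u t : ℤ))
    let ς : ℕ → k := fun t => q ^ ((u t : ℤ) - u (t + 1))
    let z₂ : ℕ → k := fun t => q ^ (-(pairSum u t : ℤ))
    let ς₂ : ℕ → k := fun t => q ^ ((pairSum u t : ℤ) - pairSum u (t + 1))
    ∀ g : Finset ℕ → k,
      evenSum (dnOpen z ς (2 * M)) altFst (2 * M) g =
        ∑ ε ∈ (range M).powerset, dnOpen z₂ ς₂ M ε * g ε ∧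
      evenSum (dnWeight z ς) altFst (2 * M) g =
        ∑ ε ∈ (range M).powerset, dnOpen z₂ ς₂ M ε * g ε
          - z (2 * M) * oddSum (dnOpen z ς (2 * M)) altFst (2 * M) g ∧
      oddSum (dnWeight z ς) altFst (2 * M) g =
        oddSum (dnOpen z ς (2 * M)) altFst (2 * M) g
          - q ^ (u (2 * M + 1) : ℤ) * (∑ ε ∈ (range M).powerset, dnOpen z₂ ς₂ M ε * g ε
            - ∑ ε ∈ (range M).powerset, dnWeight z₂ ς₂ ε * g ε) := by
  intro z ς z₂ ς₂
  induction M with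
  | zero => intro g; simp [evenSum, oddSum, dnOpen, dnWeight, altFst]
  | succ M ih =>
    intro g
    have hd1 : 2 * M / 2 = M := by omega
    have hd2 : (2 * M + 1) / 2 = M := by omega
    have T : ∀ i, (∀ η ⊆ range i, dnOpen z ς (i + 1) η = dnWeight z ς η) ∧
        (∀ η ⊆ range i, dnOpen z ς (i + 1) (insert i η) = z i * dnOpen z ς i η) ∧
        (∀ η ⊆ range i, dnWeight z ς (insert i η) = z i * (1 - ς i) * dnOpen z ς i η) :=
      fun i => ⟨fun η h => dnOpen_succ z ς h, fun η h => dnOpen_succ_insert z ς h,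
        fun η h => dnWeight_insert z ς h⟩
    have eT0 := fun i => evenSum_altFst_succ (T i).1 (T i).2.1
    have eT1 := fun i => oddSum_altFst_succ (T i).1 (T i).2.1
    have eB0 := fun i => evenSum_altFst_succ (w := dnWeight z ς) (fun η _ => rfl) (T i).2.2
    have eB1 := fun i => oddSum_altFst_succ (w := dnWeight z ς) (fun η _ => rfl) (T i).2.2
    have eH := sum_strips_succ (M := M) (fun η h => dnOpen_succ z₂ ς₂ h)
      (fun η h => dnOpen_succ_insert z₂ ς₂ h) g
    have eB := sum_strips_succ (M := M) (w := dnWeight z₂ ς₂) (fun η _ => rfl)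
      (fun η h => dnWeight_insert z₂ ς₂ h) g
    have i1 := fun g => (ih g).1
    have i2 := fun g => (ih g).2.1
    have i3 := fun g => (ih g).2.2
    have r0 : z (2 * M) * ς (2 * M) = z (2 * M + 1) := by
      simp only [z, ς]; rw [← zpow_add₀ hq]; congr 1; ring
    have r1 : z (2 * M + 1) * ς (2 * M + 1) = z (2 * M + 1 + 1) := by
      simp only [z, ς]; rw [← zpow_add₀ hq]; congr 1; ring
    have r2 : z₂ M = z (2 * M) * z (2 * M + 1) := by
      simp only [z, z₂, pairSum]; rw [← zpow_add₀ hq]; congr 1; push_cast; ring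
    have r3 : z₂ M * ς₂ M * q ^ (u (2 * M + 1 + 1 + 1) : ℤ) = z (2 * M + 1 + 1) := by
      simp only [z, z₂, ς₂, pairSum]; rw [← zpow_add₀ hq, ← zpow_add₀ hq]; congr 1
      rw [show 2 * (M + 1) = 2 * M + 1 + 1 by ring]; push_cast; ring
    have r4 : z (2 * M + 1) * q ^ (u (2 * M + 1) : ℤ) = 1 := by
      simp only [z]; rw [← zpow_add₀ hq]; simp
    rw [show 2 * (M + 1) = 2 * M + 1 + 1 by ring]
    simp only [eT0, eT1, eB0, eB1, eH, eB, i1, i2, i3, hd1, hd2, r2]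
    rw [r2] at r3
    generalize z (2 * M) = a at *
    generalize z (2 * M + 1) = b at *
    generalize z (2 * M + 1 + 1) = a' at *
    generalize q ^ (u (2 * M + 1) : ℤ) = b₁ at *
    generalize q ^ (u (2 * M + 1 + 1 + 1) : ℤ) = b₂ at *
    generalize ς (2 * M) = ς₀ at *
    generalize ς (2 * M + 1) = ς₁ at *
    generalize ς₂ M = ς₃ at *
    generalize ∑ ε ∈ (range M).powerset, dnOpen z₂ ς₂ M ε * g ε = H
    generalize ∑ ε ∈ (range M).powerset, dnWeight z₂ ς₂ ε * g ε = B
    generalize ∑ ε ∈ (range M).powerset, dnOpen z₂ ς₂ M ε * g (insert M ε) = H'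
    generalize oddSum (dnOpen z ς (2 * M)) altFst (2 * M) g = T1
    refine ⟨?_, ?_, ?_⟩
    · linear_combination (B - H) * r4 - T1 * r0
    · clear * - r0 r1 r3 r4
      grind
    · clear * - r0 r1 r3 r4
      grind

/-- Grouping the strips of `u` by the pairs they meet in odd position. -/
theorem sum_dn_altFst {M : ℕ} (h0 : u (2 * M) = 0) (h1 : u (2 * M + 1) = 0)
    (g : Finset ℕ → k) :
    ∑ η ∈ (range (2 * M)).powerset, dn q u η * g (altFst η) =
      ∑ ε ∈ (range M).powerset, dn q (pairSum u) ε * g ε := by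
  obtain ⟨-, h2, h3⟩ := dn_alt_invariants hq u M g
  simp only [h0] at h2
  rw [h1] at h3
  rw [← evenSum_add_oddSum (dn q u) altFst]
  change evenSum (dnWeight _ _) _ _ _ + oddSum (dnWeight _ _) _ _ _ = _
  rw [h2, h3]
  simp [dn]

theorem up_alt_invariants (M : ℕ) :
    let z : ℕ → k := fun t => q ^ (u t : ℤ)
    let ρ : ℕ → k := fun t => q ^ ((u t : ℤ) - u (t + 1))
    let z₂ : ℕ → k := fun t => q ^ (pairSum u t : ℤ)
    let ρ₂ : ℕ → k := fun t => q ^ ((pairSum u t : ℤ) - pairSum u (t + 1))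
    ∀ g : Finset ℕ → k,
      evenSum (upWeight z ρ) altSnd (2 * M) g =
        ∑ ε ∈ (range M).powerset, upWeight z₂ ρ₂ ε * g ε ∧
      evenSum (upNext z ρ (2 * M)) altSnd (2 * M) g =
        ∑ ε ∈ (range M).powerset, upWeight z₂ ρ₂ ε * g ε
          - q ^ (-(u (2 * M) : ℤ)) * oddSum (upWeight z ρ) altSnd (2 * M) g ∧
      oddSum (upNext z ρ (2 * M)) altSnd (2 * M) g =
        oddSum (upWeight z ρ) altSnd (2 * M) g
          - z (2 * M + 1) * (∑ ε ∈ (range M).powerset, upWeight z₂ ρ₂ ε * g ε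
            - ∑ ε ∈ (range M).powerset, upNext z₂ ρ₂ M ε * g ε) := by
  intro z ρ z₂ ρ₂
  induction M with
  | zero => intro g; simp [evenSum, oddSum, upWeight, upNext, altSnd]
  | succ M ih =>
    intro g
    have hd1 : 2 * M / 2 = M := by omega
    have hd2 : (2 * M + 1) / 2 = M := by omega
    have T : ∀ i, (∀ η ⊆ range i, upWeight z ρ (insert i η) = z i * upNext z ρ i η) ∧
        (∀ η ⊆ range i, upNext z ρ (i + 1) η = (1 - ρ i) * upWeight z ρ η) ∧
        (∀ η ⊆ range i, upNext z ρ (i + 1) (insert i η) = z i * upNext z ρ i η) :=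
      fun i => ⟨fun η h => upWeight_insert z ρ h, fun η h => upNext_succ z ρ h,
        fun η h => upNext_succ_insert z ρ h⟩
    have eT0 := fun i => evenSum_altSnd_succ (w := upWeight z ρ) (fun η _ => rfl) (T i).1
    have eT1 := fun i => oddSum_altSnd_succ (w := upWeight z ρ) (fun η _ => rfl) (T i).1
    have eA0 := fun i => evenSum_altSnd_succ (T i).2.1 (T i).2.2
    have eA1 := fun i => oddSum_altSnd_succ (T i).2.1 (T i).2.2
    have eH := sum_strips_succ (M := M) (w := upWeight z₂ ρ₂) (fun η _ => rfl)
      (fun η h => upWeight_insert z₂ ρ₂ h) g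
    have eA := sum_strips_succ (M := M) (fun η h => upNext_succ z₂ ρ₂ h)
      (fun η h => upNext_succ_insert z₂ ρ₂ h) g
    have hs0 : ∀ (c : k) (w : Finset ℕ → k) (M : ℕ) (g : Finset ℕ → k),
        evenSum (fun η => c * w η) altSnd M g = c * evenSum w altSnd M g := by
      intro c w M g
      rw [evenSum, evenSum, mul_sum]
      exact sum_congr rfl fun η _ => by split_ifs <;> ring
    have hs1 : ∀ (c : k) (w : Finset ℕ → k) (M : ℕ) (g : Finset ℕ → k),
        oddSum (fun η => c * w η) altSnd M g = c * oddSum w altSnd M g := by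
      intro c w M g
      rw [oddSum, oddSum, mul_sum]
      exact sum_congr rfl fun η _ => by split_ifs <;> ring
    have i1 := fun g => (ih g).1
    have i2 := fun g => (ih g).2.1
    have i3 := fun g => (ih g).2.2
    have r0 : z (2 * M) = z (2 * M + 1) * ρ (2 * M) := by
      simp only [z, ρ]; rw [← zpow_add₀ hq]; congr 1; ring
    have r1 : q ^ (-(u (2 * M + 1 + 1) : ℤ)) * z (2 * M + 1) = ρ (2 * M + 1) := by
      simp only [z, ρ]; rw [← zpow_add₀ hq]; congr 1; ring
    have r2 : z₂ M = z (2 * M) * z (2 * M + 1) := by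
      simp only [z, z₂, pairSum]; rw [← zpow_add₀ hq]; congr 1
    have r3 : z (2 * M) * ρ (2 * M + 1) = z (2 * M + 1 + 1 + 1) * ρ₂ M := by
      simp only [z, ρ, ρ₂, pairSum]; rw [← zpow_add₀ hq, ← zpow_add₀ hq]; congr 1
      rw [show 2 * (M + 1) = 2 * M + 1 + 1 by ring]; push_cast; ring
    have r4 : z (2 * M) * q ^ (-(u (2 * M) : ℤ)) = 1 := by
      simp only [z]; rw [← zpow_add₀ hq]; simp
    rw [show 2 * (M + 1) = 2 * M + 1 + 1 by ring]
    simp only [eT0, eT1, eA0, eA1, eH, eA, hs0, hs1, i1, i2, i3, hd1, hd2, r2, mul_assoc,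
      ← mul_sum]
    generalize z (2 * M) = a at *
    generalize z (2 * M + 1) = b at *
    generalize z (2 * M + 1 + 1 + 1) = b' at *
    generalize q ^ (-(u (2 * M) : ℤ)) = a₁ at *
    generalize q ^ (-(u (2 * M + 1 + 1) : ℤ)) = a₂ at *
    generalize ρ (2 * M) = ρ₀ at *
    generalize ρ (2 * M + 1) = ρ₁ at *
    generalize ρ₂ M = ρ₃ at *
    generalize ∑ ε ∈ (range M).powerset, upWeight z₂ ρ₂ ε * g ε = H
    generalize ∑ ε ∈ (range M).powerset, upNext z₂ ρ₂ M ε * g ε = A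
    generalize ∑ ε ∈ (range M).powerset, upWeight z₂ ρ₂ ε * g (insert M ε) = H'
    generalize ∑ ε ∈ (range M).powerset, upNext z₂ ρ₂ M ε * g (insert M ε) = A'
    generalize oddSum (upWeight z ρ) altSnd (2 * M) g = T1
    generalize oddSum (upWeight z ρ) altSnd (2 * M) (fun ε => g (insert M ε)) = T1'
    clear * - r0 r1 r3 r4
    refine ⟨?_, ?_, ?_⟩ <;> grind

/-- Grouping the even strips of `u` by the pairs they meet in even position. -/
theorem evenSum_up_altSnd (M : ℕ) (g : Finset ℕ → k) :
    evenSum (up q u) altSnd (2 * M) g =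
      ∑ ε ∈ (range M).powerset, up q (pairSum u) ε * g ε :=
  (up_alt_invariants hq u M g).1

/-- Grouping the odd strips of `u` by the pairs they meet in even position. -/
theorem oddSum_up_altSnd {M : ℕ} (h0 : u (2 * M) = 0) (g : Finset ℕ → k) :
    oddSum (up q u) altSnd (2 * M + 1) g =
      ∑ ε ∈ (range M).powerset, up q (pairSum u) ε * g ε := by
  obtain ⟨-, h2, -⟩ := up_alt_invariants hq u M g
  have := oddSum_altSnd_succ (w := up q u) (M := 2 * M) (fun η _ => rfl)
    (fun η h => upWeight_insert _ _ h) g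
  rw [this, h2, h0]
  change oddSum (upWeight _ _) _ _ _ + _ = _
  simp [up]

end Alternation

section Descending

theorem eq_zero_of_antitone_of_sum {r : ℕ → ℕ} (hr : Antitone r) {N n : ℕ}
    (hN : ∀ t ≥ N, r t = 0) (hs : ∑ t ∈ range N, r t = n) {t : ℕ} (ht : n ≤ t) : r t = 0 := by
  by_contra h
  have htN : t < N := by
    by_contra h'
    exact h (hN t (by omega))
  have h1 : ∑ i ∈ range (t + 1), 1 ≤ ∑ i ∈ range (t + 1), r i :=
    sum_le_sum fun i hi => by
      have : r t ≤ r i := hr (by have := mem_range.1 hi; omega)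
      omega
  have h2 : ∑ i ∈ range (t + 1), r i ≤ ∑ i ∈ range N, r i :=
    sum_le_sum_of_subset (range_subset_range.2 (by omega))
  simp at h1
  omega

theorem sum_range_eq_of_zero {r : ℕ → ℕ} {N N' : ℕ}
    (hN : ∀ t ≥ N, r t = 0) (hN' : ∀ t ≥ N', r t = 0) :
    ∑ t ∈ range N, r t = ∑ t ∈ range N', r t := by
  have key : ∀ N N', N ≤ N' → (∀ t ≥ N, r t = 0) →
      ∑ t ∈ range N, r t = ∑ t ∈ range N', r t := fun N N' h hN =>
    sum_subset (range_subset_range.2 h) fun t _ ht => hN t (by simpa using ht)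
  rcases le_total N N' with h | h
  · exact key N N' h hN
  · exact (key N' N h hN').symm

theorem finite_descending (n : ℕ) :
    {r : ℕ → ℕ | Antitone r ∧ ∃ N, (∀ t ≥ N, r t = 0) ∧ ∑ t ∈ range N, r t = n}.Finite := by
  refine Set.Finite.of_finite_image (f := fun r (i : Fin n) => r i)
    ((Set.Finite.pi fun _ : Fin n => Set.finite_Iic n).subset ?_) ?_
  · rintro _ ⟨r, ⟨hr, N, hN, hs⟩, rfl⟩
    simp only [Set.mem_pi, Set.mem_univ, true_imp_iff, Set.mem_Iic]
    intro i
    by_cases hi : (i : ℕ) < N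
    · exact (single_le_sum (f := r) (fun _ _ => Nat.zero_le _) (mem_range.2 hi)).trans hs.le
    · rw [hN _ (by omega)]; omega
  · rintro r ⟨hr, N, hN, hs⟩ r' ⟨hr', N', hN', hs'⟩ h
    ext t
    by_cases ht : t < n
    · exact congrFun h ⟨t, ht⟩
    · rw [eq_zero_of_antitone_of_sum hr hN hs (by omega),
        eq_zero_of_antitone_of_sum hr' hN' hs' (by omega)]

/-- The descending sequences with sum `n`. -/
noncomputable def desc (n : ℕ) : Finset (ℕ → ℕ) := (finite_descending n).toFinset

theorem mem_desc {n : ℕ} {r : ℕ → ℕ} : r ∈ desc n ↔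
    Antitone r ∧ ∃ N, (∀ t ≥ N, r t = 0) ∧ ∑ t ∈ range N, r t = n := by
  simp [desc]

theorem antitone_of_mem_desc {n : ℕ} {r : ℕ → ℕ} (h : r ∈ desc n) : Antitone r :=
  (mem_desc.1 h).1

theorem eq_zero_of_mem_desc {n : ℕ} {r : ℕ → ℕ} (h : r ∈ desc n) {t : ℕ} (ht : n ≤ t) :
    r t = 0 := by
  obtain ⟨hr, N, hN, hs⟩ := mem_desc.1 h
  exact eq_zero_of_antitone_of_sum hr hN hs ht

theorem sum_of_mem_desc {n N : ℕ} {r : ℕ → ℕ} (h : r ∈ desc n) (hN : ∀ t ≥ N, r t = 0) :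
    ∑ t ∈ range N, r t = n := by
  obtain ⟨hr, N', hN', hs⟩ := mem_desc.1 h
  rw [sum_range_eq_of_zero hN hN', hs]

theorem desc_zero : desc 0 = {0} := by
  ext r
  rw [mem_singleton]
  constructor
  · intro h
    ext t
    exact eq_zero_of_mem_desc h (Nat.zero_le t)
  · rintro rfl
    exact mem_desc.2 ⟨fun _ _ _ => le_rfl, 0, by simp, by simp⟩

/-- Adding one box to each column in `ε`. -/
def addStrip (r : ℕ → ℕ) (ε : Finset ℕ) (t : ℕ) : ℕ := r t + if t ∈ ε then 1 else 0

/-- Removing one box from each column in `ε`. -/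
def subStrip (r : ℕ → ℕ) (ε : Finset ℕ) (t : ℕ) : ℕ := r t - if t ∈ ε then 1 else 0

theorem subStrip_addStrip (r : ℕ → ℕ) (ε : Finset ℕ) : subStrip (addStrip r ε) ε = r := by
  ext t; simp [subStrip, addStrip]

theorem addStrip_subStrip {r : ℕ → ℕ} {ε : Finset ℕ} (h : ∀ t ∈ ε, 1 ≤ r t) :
    addStrip (subStrip r ε) ε = r := by
  ext t
  simp only [subStrip, addStrip]
  split_ifs with ht
  · have := h t ht; omega
  · omega

theorem addStrip_eq_zero {r : ℕ → ℕ} {ε : Finset ℕ} {N : ℕ} (hN : ∀ t ≥ N, r t = 0)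
    (hε : ε ⊆ range N) : ∀ t ≥ N, addStrip r ε t = 0 := by
  intro t ht
  have : t ∉ ε := fun h => by have := mem_range.1 (hε h); omega
  simp [addStrip, hN t ht, this]

theorem subStrip_eq_zero {r : ℕ → ℕ} {ε : Finset ℕ} {N : ℕ} (hN : ∀ t ≥ N, r t = 0) :
    ∀ t ≥ N, subStrip r ε t = 0 := by
  intro t ht
  simp [subStrip, hN t ht]

theorem sum_addStrip {r : ℕ → ℕ} {ε : Finset ℕ} {N : ℕ} (hε : ε ⊆ range N) :
    ∑ t ∈ range N, addStrip r ε t = ∑ t ∈ range N, r t + #ε := by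
  simp only [addStrip, sum_add_distrib]
  congr 1
  rw [sum_ite_mem, inter_eq_right.2 hε]
  simp

theorem exists_bound {r : ℕ → ℕ} {N : ℕ} (hN : ∀ t ≥ N, r t = 0) (ε : Finset ℕ) :
    ∃ N', N ≤ N' ∧ (∀ t ≥ N', r t = 0) ∧ ε ⊆ range N' := by
  obtain ⟨n, hn⟩ := exists_nat_subset_range ε
  exact ⟨max N n, le_max_left _ _, fun t ht => hN t ((le_max_left _ _).trans ht),
    hn.trans (range_subset_range.2 (le_max_right _ _))⟩

theorem addStrip_mem_desc {r : ℕ → ℕ} {ε : Finset ℕ} {n : ℕ} (h : r ∈ desc n)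
    (ha : Antitone (addStrip r ε)) : addStrip r ε ∈ desc (n + #ε) := by
  obtain ⟨N, -, hN, hε⟩ := exists_bound (fun t => eq_zero_of_mem_desc h) ε
  exact mem_desc.2 ⟨ha, N, addStrip_eq_zero hN hε, by
    rw [sum_addStrip hε, sum_of_mem_desc h hN]⟩

theorem subStrip_mem_desc {r : ℕ → ℕ} {ε : Finset ℕ} {n : ℕ} (h : r ∈ desc n)
    (h1 : ∀ t ∈ ε, 1 ≤ r t) (ha : Antitone (subStrip r ε)) :
    #ε ≤ n ∧ subStrip r ε ∈ desc (n - #ε) := by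
  obtain ⟨N, -, hN, hε⟩ := exists_bound (fun t => eq_zero_of_mem_desc h) ε
  have hs := sum_addStrip (r := subStrip r ε) hε
  rw [addStrip_subStrip h1, sum_of_mem_desc h hN] at hs
  exact ⟨by omega, mem_desc.2 ⟨ha, N, subStrip_eq_zero hN, by omega⟩⟩

/-- Reindexing of sums over pairs (sequence, strip) by adding the strip. -/
theorem sum_desc_strip {V : Type*} [AddCommMonoid V] {n k : ℕ} {S : Finset (Finset ℕ)}
    (hS : ∀ ε ∈ S, #ε = k)
    (F F' : (ℕ → ℕ) → Finset ℕ → V)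
    (h1 : ∀ r ∈ desc n, ∀ ε ∈ S, F r ε ≠ 0 → (∀ t ∈ ε, 1 ≤ r t) ∧ Antitone (subStrip r ε))
    (h2 : ∀ r ∈ desc (n - k), ∀ ε ∈ S, F' r ε ≠ 0 → Antitone (addStrip r ε))
    (h3 : ∀ r ∈ desc (n - k), ∀ ε ∈ S, Antitone (addStrip r ε) →
      F (addStrip r ε) ε = F' r ε) :
    ∑ r ∈ desc n, ∑ ε ∈ S, F r ε =
      if k ≤ n then ∑ r ∈ desc (n - k), ∑ ε ∈ S, F' r ε else 0 := by
  split_ifs with hkn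
  · rw [← sum_product', ← sum_product']
    refine sum_bij_ne_zero (fun x _ _ => (subStrip x.1 x.2, x.2)) ?_ ?_ ?_ ?_
    · rintro ⟨r, ε⟩ hx hne
      obtain ⟨hr, hε⟩ := mem_product.1 hx
      obtain ⟨h4, h5⟩ := h1 r hr ε hε hne
      exact mem_product.2 ⟨hS ε hε ▸ (subStrip_mem_desc hr h4 h5).2, hε⟩
    · rintro ⟨r, ε⟩ hx hne ⟨r', ε'⟩ hx' hne' he
      obtain ⟨hr, hε⟩ := mem_product.1 hx
      obtain ⟨hr', hε'⟩ := mem_product.1 hx'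
      obtain ⟨h4, h5⟩ := h1 r hr ε hε hne
      obtain ⟨h4', h5'⟩ := h1 r' hr' ε' hε' hne'
      simp only [Prod.mk.injEq] at he ⊢
      obtain ⟨he1, rfl⟩ := he
      refine ⟨?_, rfl⟩
      rw [← addStrip_subStrip h4, ← addStrip_subStrip h4', he1]
    · rintro ⟨r, ε⟩ hx hne
      obtain ⟨hr, hε⟩ := mem_product.1 hx
      have ha := h2 r hr ε hε hne
      have hm := addStrip_mem_desc hr ha
      rw [hS ε hε, Nat.sub_add_cancel hkn] at hm
      refine ⟨(addStrip r ε, ε), mem_product.2 ⟨hm, hε⟩, ?_, ?_⟩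
      · rw [h3 r hr ε hε ha]; exact hne
      · simp [subStrip_addStrip]
    · rintro ⟨r, ε⟩ hx hne
      obtain ⟨hr, hε⟩ := mem_product.1 hx
      obtain ⟨h4, h5⟩ := h1 r hr ε hε hne
      have hm := (subStrip_mem_desc hr h4 h5).2
      rw [hS ε hε] at hm
      have := h3 _ hm ε hε (by rw [addStrip_subStrip h4]; exact antitone_of_mem_desc hr)
      rw [addStrip_subStrip h4] at this
      exact this
  · refine sum_eq_zero fun r hr => sum_eq_zero fun ε hε => ?_
    by_contra hne
    obtain ⟨h4, h5⟩ := h1 r hr ε hε hne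
    have := (subStrip_mem_desc hr h4 h5).1
    rw [hS ε hε] at this
    exact hkn this

end Descending

section Kernel

variable {k : Type*} [Field k] (q : k)

/-- The `q`-Pochhammer symbol `(q;q)_n`. -/
def poch (n : ℕ) : k := ∏ i ∈ range n, (1 - q ^ (i + 1))

/-- The factors of `kern`. -/
noncomputable def kernFactor (s r : ℕ → ℕ) (t : ℕ) : k :=
  q ^ ((r t : ℤ) * ((r t : ℤ) - s t)) / poch q (r t - r (t + 1))

/-- The kernel linking the sequences at two adjacent vertices. -/
noncomputable def kern (s r : ℕ → ℕ) : k := ∏ᶠ t, kernFactor q s r t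

variable {q}

theorem kern_eq_prod {s r : ℕ → ℕ} {N : ℕ} (hN : ∀ t ≥ N, r t = 0) :
    kern q s r = ∏ t ∈ range N, kernFactor q s r t := by
  refine finprod_eq_prod_of_mulSupport_subset _ fun t ht => ?_
  by_contra h
  have h' : N ≤ t := by simpa using h
  refine ht ?_
  simp [kernFactor, hN t h', poch]

theorem kern_zero_right (s : ℕ → ℕ) : kern q s 0 = 1 := by
  rw [kern_eq_prod (N := 0) (by simp)]
  simp

theorem prod_strip_eq_prod_range {ε : Finset ℕ} {N : ℕ} (h : ε ⊆ range N) (f : ℕ → k) :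
    ∏ t ∈ ε, f t = ∏ t ∈ range N, if t ∈ ε then f t else 1 := by
  rw [prod_ite_mem, inter_eq_right.2 h]

theorem prod_up_edges {ε : Finset ℕ} {N : ℕ} (h : ε ⊆ range N) (ρ : ℕ → k) :
    ∏ t ∈ ε, (if t - 1 ∈ ε then 1 else 1 - ρ (t - 1)) =
      ∏ t ∈ range N, if t ∉ ε ∧ t + 1 ∈ ε then 1 - ρ t else 1 := by
  have e1 : ∏ t ∈ ε, (if t - 1 ∈ ε then 1 else 1 - ρ (t - 1)) =
      ∏ t ∈ ε with t - 1 ∉ ε, (1 - ρ (t - 1)) := by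
    rw [prod_filter]
    exact prod_congr rfl fun t _ => by split_ifs <;> simp_all
  rw [e1, ← prod_filter]
  refine prod_nbij' (· - 1) (· + 1) ?_ ?_ ?_ ?_ ?_
  · intro t ht
    obtain ⟨h1, h2⟩ := mem_filter.1 ht
    have h3 : t ≠ 0 := by rintro rfl; exact h2 h1
    have h4 := mem_range.1 (h h1)
    have h5 : t - 1 + 1 = t := by omega
    simp only [mem_filter, mem_range, h5]
    exact ⟨by omega, h2, h1⟩
  · intro t ht
    obtain ⟨h1, h2, h3⟩ := mem_filter.1 ht
    simp [h2, h3]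
  · intro t ht
    obtain ⟨h1, h2⟩ := mem_filter.1 ht
    have h3 : t ≠ 0 := by rintro rfl; exact h2 h1
    omega
  · intro t _; simp
  · intro t _; rfl

variable (hq : q ≠ 0) (hq1 : ∀ n, q ^ (n + 1) ≠ 1)

include hq1 in
theorem poch_ne_zero (n : ℕ) : poch q n ≠ 0 :=
  prod_ne_zero_iff.2 fun i _ => sub_ne_zero.2 (hq1 i).symm

include hq in
theorem kern_subStrip_left {s r : ℕ → ℕ} {ε : Finset ℕ} {N : ℕ} (hN : ∀ t ≥ N, r t = 0)
    (h : ∀ t ∈ ε, 1 ≤ s t) :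
    kern q (subStrip s ε) r = kern q s r * ∏ t ∈ ε, q ^ (r t : ℤ) := by
  obtain ⟨N, -, hN, hε⟩ := exists_bound hN ε
  rw [kern_eq_prod hN, kern_eq_prod hN, prod_strip_eq_prod_range hε, ← prod_mul_distrib]
  refine prod_congr rfl fun t _ => ?_
  simp only [kernFactor, subStrip]
  split_ifs with ht
  · have := h t ht
    rw [div_mul_eq_mul_div, ← zpow_add₀ hq]
    congr 2
    push_cast [this]
    ring
  · simp

include hq in
theorem kern_addStrip_left {s r : ℕ → ℕ} {ε : Finset ℕ} {N : ℕ} (hN : ∀ t ≥ N, r t = 0) :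
    kern q (addStrip s ε) r = kern q s r * ∏ t ∈ ε, q ^ (-(r t : ℤ)) := by
  obtain ⟨N, -, hN, hε⟩ := exists_bound hN ε
  rw [kern_eq_prod hN, kern_eq_prod hN, prod_strip_eq_prod_range hε, ← prod_mul_distrib]
  refine prod_congr rfl fun t _ => ?_
  simp only [kernFactor, addStrip]
  split_ifs with ht
  · rw [div_mul_eq_mul_div, ← zpow_add₀ hq]
    congr 2
    push_cast
    ring
  · simp

include hq hq1 in
theorem kern_addStrip_right {s r : ℕ → ℕ} {ε : Finset ℕ} {N : ℕ} (hN : ∀ t ≥ N, r t = 0)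
    (hr : Antitone r) (ha : Antitone (addStrip r ε)) :
    kern q s (addStrip r ε) * dn q (addStrip r ε) ε =
      kern q s r * (∏ t ∈ ε, q ^ (-(s t : ℤ))) * up q r ε := by
  obtain ⟨N, -, hN, hε⟩ := exists_bound hN ε
  rw [kern_eq_prod (addStrip_eq_zero hN hε), kern_eq_prod hN, up, upWeight, prod_mul_distrib,
    prod_up_edges hε (fun t => q ^ ((r t : ℤ) - r (t + 1))), dn, dnWeight,
    prod_strip_eq_prod_range hε, prod_strip_eq_prod_range hε,
    prod_strip_eq_prod_range hε, ← prod_mul_distrib, ← prod_mul_distrib, ← prod_mul_distrib,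
    ← prod_mul_distrib]
  refine prod_congr rfl fun t _ => ?_
  have h1 : r (t + 1) ≤ r t := hr (Nat.le_succ t)
  have h2 : addStrip r ε (t + 1) ≤ addStrip r ε t := ha (Nat.le_succ t)
  simp only [kernFactor, addStrip] at h2 ⊢
  by_cases ht : t ∈ ε
  · have hz : ∀ c : k, q ^ (((r t + 1 : ℕ) : ℤ) * (((r t + 1 : ℕ) : ℤ) - s t)) / c *
        q ^ (-((r t + 1 : ℕ) : ℤ)) =
        q ^ ((r t : ℤ) * ((r t : ℤ) - s t)) / c * q ^ (-(s t : ℤ)) * q ^ (r t : ℤ) := by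
      intro c
      rw [div_mul_eq_mul_div, ← zpow_add₀ hq, mul_assoc, ← zpow_add₀ hq, div_mul_eq_mul_div,
        ← zpow_add₀ hq]
      congr 2
      push_cast
      ring
    by_cases ht' : t + 1 ∈ ε
    · simp only [ht, ht', if_true, not_true_eq_false, false_and, if_false, mul_one]
      rw [hz, Nat.add_sub_add_right]
    · simp only [ht, ht', if_true, not_true_eq_false, false_and, if_false, mul_one, add_zero]
      rw [← mul_assoc, hz]
      have e : r t + 1 - r (t + 1) = (r t - r (t + 1)) + 1 := by omega
      have e' : q ^ (((r t + 1 : ℕ) : ℤ) - (r (t + 1) : ℤ)) = q ^ (r t - r (t + 1) + 1) := by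
        rw [← zpow_natCast, ← e]
        congr 1
        omega
      have hp : poch q (r t - r (t + 1) + 1) =
          poch q (r t - r (t + 1)) * (1 - q ^ (r t - r (t + 1) + 1)) := by
        rw [poch, prod_range_succ, poch]
      have h3 : (1 - q ^ (r t - r (t + 1) + 1)) ≠ 0 := sub_ne_zero.2 (hq1 _).symm
      have h4 := poch_ne_zero hq1 (r t - r (t + 1))
      rw [e, e', hp]
      field_simp
  · by_cases ht' : t + 1 ∈ ε
    · simp only [ht, ht', if_true, not_false_eq_true, true_and, if_false, mul_one, add_zero]
      simp only [ht, ht', if_true, if_false, add_zero] at h2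
      have e : r t - r (t + 1) = (r t - (r (t + 1) + 1)) + 1 := by omega
      have e' : q ^ ((r t : ℤ) - (r (t + 1) : ℤ)) = q ^ (r t - (r (t + 1) + 1) + 1) := by
        rw [← zpow_natCast, ← e]
        congr 1
        omega
      have hp : poch q (r t - (r (t + 1) + 1) + 1) =
          poch q (r t - (r (t + 1) + 1)) * (1 - q ^ (r t - (r (t + 1) + 1) + 1)) := by
        rw [poch, prod_range_succ, poch]
      have h3 : (1 - q ^ (r t - (r (t + 1) + 1) + 1)) ≠ 0 := sub_ne_zero.2 (hq1 _).symm
      have h4 := poch_ne_zero hq1 (r t - (r (t + 1) + 1))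
      rw [e, e', hp]
      field_simp
    · simp [ht, ht']

theorem dn_eq_zero_of_not_subset {s : ℕ → ℕ} {ε : Finset ℕ} {N : ℕ} (hN : ∀ t ≥ N, s t = 0)
    (h : ¬ ε ⊆ range N) : dn q s ε = 0 := by
  obtain ⟨t, ht, htN⟩ := not_subset.1 h
  have hne : ε.Nonempty := ⟨t, ht⟩
  have hm := ε.max'_mem hne
  have htm := ε.le_max' t ht
  have htN' : N ≤ t := by simpa using htN
  refine prod_eq_zero hm ?_
  have : ε.max' hne + 1 ∉ ε := fun h' => by
    have := ε.le_max' _ h'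
    omega
  rw [if_neg this]
  beta_reduce
  rw [hN _ (by omega), hN _ (by omega)]
  simp

theorem of_dn_ne_zero {s : ℕ → ℕ} {ε : Finset ℕ} (hs : Antitone s) (h : dn q s ε ≠ 0) :
    (∀ t ∈ ε, 1 ≤ s t) ∧ Antitone (subStrip s ε) := by
  have h1 : ∀ t ∈ ε, 1 ≤ s t := by
    intro t ht
    by_contra h'
    refine h (dn_eq_zero_of_not_subset (N := t) (fun i hi => ?_) fun h'' => ?_)
    · have := hs hi; omega
    · simpa using h'' ht
  refine ⟨h1, antitone_nat_of_succ_le fun t => ?_⟩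
  have h2 : s (t + 1) ≤ s t := hs (Nat.le_succ t)
  simp only [subStrip]
  by_cases ht : t ∈ ε
  · by_cases ht' : t + 1 ∈ ε
    · simp only [ht, ht', if_true]; omega
    · simp only [ht, ht', if_true, if_false]
      have h3 := prod_ne_zero_iff.1 h t ht
      rw [if_neg ht'] at h3
      have h4 : s t ≠ s (t + 1) := fun e => h3 (by simp [e])
      omega
  · simp only [ht, if_false]; omega

theorem of_up_ne_zero {r : ℕ → ℕ} {ε : Finset ℕ} (hr : Antitone r) (h : up q r ε ≠ 0) :
    Antitone (addStrip r ε) := by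
  refine antitone_nat_of_succ_le fun t => ?_
  have h2 : r (t + 1) ≤ r t := hr (Nat.le_succ t)
  simp only [addStrip]
  by_cases ht : t ∈ ε
  · simp only [ht, if_true]; split_ifs <;> omega
  · by_cases ht' : t + 1 ∈ ε
    · simp only [ht, ht', if_true, if_false]
      have h3 := prod_ne_zero_iff.1 h _ ht'
      rw [Nat.add_sub_cancel, if_neg ht] at h3
      have h4 : r t ≠ r (t + 1) := fun e => h3 (by simp [e])
      omega
    · simp only [ht, ht', if_false]; omega

theorem subset_of_up_ne_zero {r : ℕ → ℕ} {ε : Finset ℕ} {N : ℕ} (hN : ∀ t ≥ N, r t = 0)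
    (h : up q r ε ≠ 0) : ε ⊆ range (N + #ε) := by
  by_contra hn
  obtain ⟨t, ht, htN⟩ := not_subset.1 hn
  have htN' : N + #ε ≤ t := by simpa using htN
  have key : ∀ i, i ≤ #ε → t - i ∈ ε := by
    intro i
    induction i with
    | zero => intro _; simpa using ht
    | succ i ih =>
      intro hi
      have h1 := ih (by omega)
      by_contra h2
      refine h (prod_eq_zero h1 ?_)
      have h3 : t - i - 1 = t - (i + 1) := by omega
      have h4 : t - (i + 1) + 1 = t - i := by omega
      rw [h3, if_neg h2]
      beta_reduce
      rw [h4, hN (t - (i + 1)) (by omega), hN (t - i) (by omega)]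
      simp
  have h5 : (range (#ε + 1)).image (fun i => t - i) ⊆ ε := by
    intro j hj
    obtain ⟨i, hi, rfl⟩ := mem_image.1 hj
    exact key i (by have := mem_range.1 hi; omega)
  have h6 := card_le_card h5
  rw [card_image_of_injOn] at h6
  · simp at h6
  · intro i hi j hj hij
    simp only [coe_range, Set.mem_Iio] at hi hj
    have : t - i = t - j := hij
    omega

end Kernel

section Operators

variable {k : Type*} [Field k] {q : k} (hq : q ≠ 0) (hq1 : ∀ n, q ^ (n + 1) ≠ 1)

theorem upWeight_mul {R : Type*} [CommRing R] (c z ρ : ℕ → R) (ε : Finset ℕ) :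
    upWeight (fun t => c t * z t) ρ ε = (∏ t ∈ ε, c t) * upWeight z ρ ε := by
  rw [upWeight, upWeight, ← prod_mul_distrib]
  exact prod_congr rfl fun t _ => by ring

theorem dnWeight_mul {R : Type*} [CommRing R] (c z ς : ℕ → R) (ε : Finset ℕ) :
    dnWeight (fun t => c t * z t) ς ε = (∏ t ∈ ε, c t) * dnWeight z ς ε := by
  rw [dnWeight, dnWeight, ← prod_mul_distrib]
  exact prod_congr rfl fun t _ => by ring

include hq in
theorem sum_up_sub_sum_up {a b : ℕ → ℕ} {N : ℕ} (ha : a N = 0) (hb : b N = 0) (j : ℕ) :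
    ∑ ε ∈ powersetCard (j + 1) (range (N + 1)), (∏ t ∈ ε, q ^ (-(b t : ℤ))) * up q a ε
      - ∑ ε ∈ powersetCard j (range N), (∏ t ∈ ε, q ^ (-(b t : ℤ))) * up q a ε =
    ∑ ε ∈ powersetCard (j + 1) (range N), (∏ t ∈ ε, q ^ (a t : ℤ)) * dn q b ε := by
  have h := sum_powersetCard_upWeight (fun t => q ^ (-(b t : ℤ)) * q ^ (a t : ℤ))
    (fun t => q ^ ((a t : ℤ) - a (t + 1))) (fun t => q ^ ((b t : ℤ) - b (t + 1))) (by
      intro t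
      simp only [← zpow_add₀ hq]
      congr 1
      ring) N j
  simp only [ha, hb] at h
  simp only [upWeight_mul] at h
  have h2 : (fun t => q ^ (-(b t : ℤ)) * q ^ (a t : ℤ)) =
      fun t => q ^ (a t : ℤ) * q ^ (-(b t : ℤ)) := by
    ext t; ring
  rw [h2] at h
  simp only [dnWeight_mul] at h
  simpa [up, dn] using h

/-- Sum over the strips removed from `s`. -/
noncomputable def dnSum {A : Type*} [CommRing A] [Algebra k A] (q : k) (M : ℕ) (x : A)
    (f : (ℕ → ℕ) → A) (s : ℕ → ℕ) : A :=
  ∑ ε ∈ (range M).powerset, x ^ #ε * (dn q s ε • f (subStrip s ε))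

/-- Sum over the strips of size `j` added to `s`. -/
noncomputable def upSum {V : Type*} [AddCommGroup V] [Module k V] (q : k) (N j : ℕ)
    (f : (ℕ → ℕ) → V) (s : ℕ → ℕ) : V :=
  ∑ ε ∈ powersetCard j (range N), up q s ε • f (addStrip s ε)

theorem sum_dn_stable {V : Type*} [AddCommMonoid V] {s : ℕ → ℕ} {M M' : ℕ}
    (hM : ∀ t ≥ M, s t = 0) (h : M ≤ M') (F : Finset ℕ → V)
    (hF : ∀ ε, dn q s ε = 0 → F ε = 0) :
    ∑ ε ∈ (range M).powerset, F ε = ∑ ε ∈ (range M').powerset, F ε := by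
  refine sum_subset (powerset_mono.2 (range_subset_range.2 h)) fun ε _ hε => hF ε ?_
  exact dn_eq_zero_of_not_subset hM (by simpa using hε)

theorem sum_up_stable {V : Type*} [AddCommGroup V] [Module k V] {s : ℕ → ℕ} {L N N' j : ℕ}
    (hL : ∀ t ≥ L, s t = 0) (h : L + j ≤ N) (h' : L + j ≤ N') (v : Finset ℕ → V) :
    ∑ ε ∈ powersetCard j (range N), up q s ε • v ε =
      ∑ ε ∈ powersetCard j (range N'), up q s ε • v ε := by
  have key : ∀ N, L + j ≤ N → ∑ ε ∈ powersetCard j (range (L + j)), up q s ε • v ε =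
      ∑ ε ∈ powersetCard j (range N), up q s ε • v ε := by
    intro N h
    refine sum_subset (powersetCard_mono (range_subset_range.2 h)) fun ε h1 h2 => ?_
    by_contra h3
    have h4 := (mem_powersetCard.1 h1).2
    have := subset_of_up_ne_zero hL (left_ne_zero_of_smul h3)
    rw [h4] at this
    exact h2 (mem_powersetCard.2 ⟨this, h4⟩)
  rw [← key N h, key N' h']

variable {A : Type*} [CommRing A] [Algebra k A]

/-- Generating series of `kern q s r • f r` over the sequences `r`, by size. -/
noncomputable def kernSeries (q : k) (f : (ℕ → ℕ) → A) (s : ℕ → ℕ) : PowerSeries A :=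
  PowerSeries.mk fun n => ∑ r ∈ desc n, kern q s r • f r

include hq hq1 in
theorem sum_kern_dn {s : ℕ → ℕ} (f : (ℕ → ℕ) → A) (n j N : ℕ) :
    ∑ r ∈ desc n, ∑ ε ∈ powersetCard j (range N), (kern q s r * dn q r ε) • f (subStrip r ε) =
      if j ≤ n then ∑ r ∈ desc (n - j), (kern q s r *
        ∑ ε ∈ powersetCard j (range N), (∏ t ∈ ε, q ^ (-(s t : ℤ))) * up q r ε) • f r else 0 := by
  rw [sum_desc_strip (fun ε h => (mem_powersetCard.1 h).2) _
    (fun r ε => (kern q s r * ((∏ t ∈ ε, q ^ (-(s t : ℤ))) * up q r ε)) • f r)]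
  · congr 1
    refine sum_congr rfl fun r _ => ?_
    rw [mul_sum, sum_smul]
  · intro r hr ε _ h
    exact of_dn_ne_zero (antitone_of_mem_desc hr)
      (right_ne_zero_of_mul (left_ne_zero_of_smul h))
  · intro r hr ε _ h
    exact of_up_ne_zero (antitone_of_mem_desc hr)
      (right_ne_zero_of_mul (right_ne_zero_of_mul (left_ne_zero_of_smul h)))
  · intro r hr ε _ ha
    rw [kern_addStrip_right hq hq1 (fun t => eq_zero_of_mem_desc hr) (antitone_of_mem_desc hr) ha,
      subStrip_addStrip, mul_assoc]

include hq hq1 in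
/-- Removing strips commutes with the kernel up to a linear factor. -/
theorem kernSeries_dn {F G : (ℕ → ℕ) → A} {P x : A}
    (hF : ∀ r, Antitone r → ∀ N, (∀ t ≥ N, r t = 0) → P * F r = dnSum q N x G r)
    {s : ℕ → ℕ} (hs : Antitone s) {M : ℕ} (hM : ∀ t ≥ M, s t = 0) :
    (1 - PowerSeries.C x * PowerSeries.X) * (PowerSeries.C P * kernSeries q F s) =
      ∑ ε ∈ (range M).powerset, (PowerSeries.C x * PowerSeries.X) ^ #ε *
        (PowerSeries.C (algebraMap k A (dn q s ε)) * kernSeries q G (subStrip s ε)) := by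
  let α : ℕ → ℕ → ℕ → A := fun N j m => ∑ r ∈ desc m, (kern q s r *
    ∑ ε ∈ powersetCard j (range N), (∏ t ∈ ε, q ^ (-(s t : ℤ))) * up q r ε) • G r
  let β : ℕ → ℕ → ℕ → A := fun N j m => ∑ r ∈ desc m, (kern q s r *
    ∑ ε ∈ powersetCard j (range N), (∏ t ∈ ε, q ^ (r t : ℤ)) * dn q s ε) • G r
  have hαβ : ∀ N j m, m ≤ N → M ≤ N → α (N + 1) (j + 1) m - α N j m = β N (j + 1) m := by
    intro N j m hm hMN
    simp only [α, β]
    rw [← sum_sub_distrib]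
    refine sum_congr rfl fun r hr => ?_
    rw [← sub_smul, ← mul_sub, sum_up_sub_sum_up hq (eq_zero_of_mem_desc hr hm) (hM N hMN)]
  have h0 : ∀ N N' m, α N 0 m = β N' 0 m := by
    intro N N' m
    simp [α, β, up, dn, upWeight, dnWeight]
  have hL : ∀ N n, n ≤ N → PowerSeries.coeff n (PowerSeries.C P * kernSeries q F s) =
      ∑ j ∈ range (N + 1), if j ≤ n then x ^ j * α N j (n - j) else 0 := by
    intro N n hn
    rw [PowerSeries.coeff_C_mul, kernSeries, PowerSeries.coeff_mk, mul_sum]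
    have e1 : ∀ r ∈ desc n, P * kern q s r • F r = ∑ j ∈ range (N + 1),
        ∑ ε ∈ powersetCard j (range N), x ^ j *
          ((kern q s r * dn q r ε) • G (subStrip r ε)) := by
      intro r hr
      rw [mul_smul_comm, hF r (antitone_of_mem_desc hr) N
        (fun t ht => eq_zero_of_mem_desc hr (hn.trans ht)), dnSum, sum_powerset, card_range,
        smul_sum]
      refine sum_congr rfl fun j _ => ?_
      rw [smul_sum]
      refine sum_congr rfl fun ε hε => ?_
      rw [(mem_powersetCard.1 hε).2, ← mul_smul_comm, smul_smul]
    rw [sum_congr rfl e1, sum_comm]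
    refine sum_congr rfl fun j _ => ?_
    simp only [← mul_sum]
    rw [sum_kern_dn hq hq1]
    split_ifs <;> simp [α]
  ext n
  have hR : ∀ N, n ≤ N → M ≤ N → PowerSeries.coeff n
      (∑ ε ∈ (range M).powerset, (PowerSeries.C x * PowerSeries.X) ^ #ε *
        (PowerSeries.C (algebraMap k A (dn q s ε)) * kernSeries q G (subStrip s ε))) =
      ∑ j ∈ range (N + 1), if j ≤ n then x ^ j * β N j (n - j) else 0 := by
    intro N hn hMN
    rw [sum_dn_stable (q := q) hM hMN _ (fun ε h => by simp [h]), map_sum, sum_powerset,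
      card_range]
    refine sum_congr rfl fun j _ => ?_
    have e1 : ∀ ε ∈ powersetCard j (range N), PowerSeries.coeff n
        ((PowerSeries.C x * PowerSeries.X) ^ #ε *
        (PowerSeries.C (algebraMap k A (dn q s ε)) * kernSeries q G (subStrip s ε))) =
        if j ≤ n then x ^ j * ∑ r ∈ desc (n - j),
          (kern q s r * ((∏ t ∈ ε, q ^ (r t : ℤ)) * dn q s ε)) • G r else 0 := by
      intro ε hε
      rw [(mem_powersetCard.1 hε).2, mul_pow, ← map_pow, mul_assoc, PowerSeries.coeff_C_mul,
        PowerSeries.coeff_X_pow_mul', mul_ite, mul_zero]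
      congr 2
      rw [PowerSeries.coeff_C_mul, kernSeries, PowerSeries.coeff_mk, ← Algebra.smul_def, smul_sum]
      refine sum_congr rfl fun r hr => ?_
      by_cases hd : dn q s ε = 0
      · simp [hd]
      · rw [kern_subStrip_left hq (fun t => eq_zero_of_mem_desc hr) (of_dn_ne_zero hs hd).1,
          smul_smul]
        congr 1
        ring
    rw [sum_congr rfl e1]
    split_ifs
    · rw [← mul_sum, sum_comm]
      simp only [β, mul_sum, sum_smul]
    · simp
  set N := max n M with hN
  have hnN : n ≤ N := le_max_left _ _
  have hMN : M ≤ N := le_max_right _ _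
  rw [hR N hnN hMN, sub_mul, one_mul, map_sub, hL (N + 1) n (by omega), mul_assoc,
    PowerSeries.coeff_C_mul]
  have hx : PowerSeries.coeff n (PowerSeries.X * (PowerSeries.C P * kernSeries q F s)) =
      if 1 ≤ n then ∑ j ∈ range (N + 1),
        (if j ≤ n - 1 then x ^ j * α N j (n - 1 - j) else 0) else 0 := by
    have := PowerSeries.coeff_X_pow_mul' (PowerSeries.C P * kernSeries q F s) 1 n
    rw [pow_one] at this
    rw [this]
    split_ifs with h
    · exact hL N (n - 1) (by omega)
    · rfl
  rw [hx, sum_range_succ' _ (N + 1)]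
  have e2 : ∑ j ∈ range (N + 1), (if j ≤ n then x ^ j * β N j (n - j) else 0) =
      ∑ j ∈ range (N + 1), (if j + 1 ≤ n then x ^ (j + 1) * β N (j + 1) (n - (j + 1)) else 0)
        + β N 0 n := by
    have := sum_range_succ' (fun j => if j ≤ n then x ^ j * β N j (n - j) else 0) (N + 1)
    rw [sum_range_succ, if_neg (show ¬ N + 1 ≤ n by omega), add_zero] at this
    simpa using this
  rw [e2]
  have e3 : ∀ j, (if j + 1 ≤ n then x ^ (j + 1) * β N (j + 1) (n - (j + 1)) else 0) =
      (if j + 1 ≤ n then x ^ (j + 1) * α (N + 1) (j + 1) (n - (j + 1)) else 0) -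
        x * (if 1 ≤ n then (if j ≤ n - 1 then x ^ j * α N j (n - 1 - j) else 0) else 0) := by
    intro j
    by_cases hj : j + 1 ≤ n
    · rw [if_pos hj, if_pos hj, if_pos (by omega), if_pos (by omega),
        ← hαβ N j (n - (j + 1)) (by omega) hMN, show n - 1 - j = n - (j + 1) by omega]
      ring
    · rw [if_neg hj, if_neg hj]
      by_cases h1 : 1 ≤ n
      · rw [if_pos h1, if_neg (by omega)]; simp
      · rw [if_neg h1]; simp
  simp only [e3]
  rw [sum_sub_distrib, ← mul_sum, h0 (N + 1) N]
  by_cases h1 : 1 ≤ n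
  · simp [h1]; ring
  · simp [h1]

end Operators

section UpOperators

variable {k : Type*} [Field k] {q : k} (hq : q ≠ 0) (hq1 : ∀ n, q ^ (n + 1) ≠ 1)
variable {A : Type*} [CommRing A] [Algebra k A]

/-- `f` is a simultaneous eigenfunction of the operators adding strips of a given size. -/
def UpEigen (q : k) (p : ℕ → A) (f : (ℕ → ℕ) → A) : Prop :=
  ∀ r, Antitone r → ∀ L j N, (∀ t ≥ L, r t = 0) → L + j ≤ N → upSum q N j f r = p j * f r

include hq hq1 in
theorem sum_kern_dn' {s : ℕ → ℕ} (f : (ℕ → ℕ) → A) (n j N : ℕ) :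
    ∑ r ∈ desc n, (kern q s r * ∑ ε ∈ powersetCard j (range N),
        (∏ t ∈ ε, q ^ (s t : ℤ)) * dn q r ε) • f r =
      if j ≤ n then ∑ r ∈ desc (n - j), kern q s r • upSum q N j f r else 0 := by
  simp only [mul_sum, sum_smul]
  rw [sum_desc_strip (fun ε h => (mem_powersetCard.1 h).2) _
    (fun r ε => (kern q s r * up q r ε) • f (addStrip r ε))]
  · congr 1
    refine sum_congr rfl fun r _ => ?_
    rw [upSum, smul_sum]
    simp only [smul_smul]
  · intro r hr ε _ h
    exact of_dn_ne_zero (antitone_of_mem_desc hr)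
      (right_ne_zero_of_mul (right_ne_zero_of_mul (left_ne_zero_of_smul h)))
  · intro r hr ε _ h
    exact of_up_ne_zero (antitone_of_mem_desc hr)
      (right_ne_zero_of_mul (left_ne_zero_of_smul h))
  · intro r hr ε _ ha
    have h1 := kern_addStrip_right (s := s) hq hq1 (fun t => eq_zero_of_mem_desc hr)
      (antitone_of_mem_desc hr) ha
    have h2 : (∏ t ∈ ε, q ^ (s t : ℤ)) * ∏ t ∈ ε, q ^ (-(s t : ℤ)) = 1 := by
      rw [← prod_mul_distrib]
      exact prod_eq_one fun t _ => by rw [← zpow_add₀ hq]; simp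
    congr 1
    calc _ = (∏ t ∈ ε, q ^ (s t : ℤ)) * (kern q s (addStrip r ε) * dn q (addStrip r ε) ε) := by
          ring
      _ = ((∏ t ∈ ε, q ^ (s t : ℤ)) * ∏ t ∈ ε, q ^ (-(s t : ℤ))) * (kern q s r * up q r ε) := by
          rw [h1]; ring
      _ = _ := by rw [h2, one_mul]

include hq hq1 in
/-- Adding strips commutes with the kernel up to a geometric factor. -/
theorem kernSeries_up {G : (ℕ → ℕ) → A} {p : ℕ → A} (hp : p 0 = 1) (hG : UpEigen q p G)
    {s : ℕ → ℕ} {L : ℕ} (hL : ∀ t ≥ L, s t = 0) (j N : ℕ) (hN : L + j ≤ N) :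
    ∑ ε ∈ powersetCard j (range N),
        PowerSeries.C (algebraMap k A (up q s ε)) * kernSeries q G (addStrip s ε) =
      (∑ i ∈ range (j + 1), PowerSeries.C (p i) * PowerSeries.X ^ i) * kernSeries q G s := by
  ext n
  let α : ℕ → ℕ → A := fun N j => ∑ r ∈ desc n, (kern q s r *
    ∑ ε ∈ powersetCard j (range N), (∏ t ∈ ε, q ^ (-(r t : ℤ))) * up q s ε) • G r
  have hα : ∀ N j, PowerSeries.coeff n (∑ ε ∈ powersetCard j (range N),
      PowerSeries.C (algebraMap k A (up q s ε)) * kernSeries q G (addStrip s ε)) = α N j := by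
    intro N j
    rw [map_sum]
    simp only [α, mul_sum, sum_smul]
    rw [sum_comm]
    refine sum_congr rfl fun ε _ => ?_
    rw [PowerSeries.coeff_C_mul, kernSeries, PowerSeries.coeff_mk, ← Algebra.smul_def, smul_sum]
    refine sum_congr rfl fun r hr => ?_
    rw [kern_addStrip_left hq (fun t => eq_zero_of_mem_desc hr), smul_smul]
    congr 1
    ring
  have hst : ∀ N N' j, L + j ≤ N → L + j ≤ N' → α N j = α N' j := by
    intro N N' j h h'
    refine sum_congr rfl fun r _ => ?_
    congr 2
    have := sum_up_stable (q := q) hL h h' fun ε => ∏ t ∈ ε, q ^ (-(r t : ℤ))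
    simpa only [smul_eq_mul, mul_comm] using this
  have hd : ∀ N j, n ≤ N → L ≤ N → α (N + 1) (j + 1) - α N j =
      if j + 1 ≤ n then p (j + 1) * PowerSeries.coeff (n - (j + 1)) (kernSeries q G s) else 0 := by
    intro N j hn hLN
    simp only [α]
    rw [← sum_sub_distrib]
    have e1 : ∀ r ∈ desc n, (kern q s r * ∑ ε ∈ powersetCard (j + 1) (range (N + 1)),
          (∏ t ∈ ε, q ^ (-(r t : ℤ))) * up q s ε) • G r -
        (kern q s r * ∑ ε ∈ powersetCard j (range N),
          (∏ t ∈ ε, q ^ (-(r t : ℤ))) * up q s ε) • G r =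
        (kern q s r * ∑ ε ∈ powersetCard (j + 1) (range N),
          (∏ t ∈ ε, q ^ (s t : ℤ)) * dn q r ε) • G r := by
      intro r hr
      rw [← sub_smul, ← mul_sub,
        sum_up_sub_sum_up hq (hL N hLN) (eq_zero_of_mem_desc hr hn)]
    rw [sum_congr rfl e1, sum_kern_dn' hq hq1]
    split_ifs with hj
    · rw [kernSeries, PowerSeries.coeff_mk, mul_sum]
      refine sum_congr rfl fun r hr => ?_
      rw [hG r (antitone_of_mem_desc hr) (n - (j + 1)) (j + 1) N
        (fun t => eq_zero_of_mem_desc hr) (by omega), mul_smul_comm]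
    · rfl
  rw [hα]
  have hR : ∀ i, PowerSeries.coeff n (PowerSeries.C (p i) * PowerSeries.X ^ i * kernSeries q G s)
      = if i ≤ n then p i * PowerSeries.coeff (n - i) (kernSeries q G s) else 0 := by
    intro i
    rw [mul_assoc, PowerSeries.coeff_C_mul, PowerSeries.coeff_X_pow_mul', mul_ite, mul_zero]
  rw [sum_mul, map_sum]
  simp only [hR]
  induction j generalizing N with
  | zero => simp [α, up, upWeight, hp, kernSeries]
  | succ j ih =>
    rw [sum_range_succ, ← ih (max N n) (by omega), hst N (max N n + 1) _ hN (by omega),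
      ← hd (max N n) j (by omega) (by omega)]
    ring

include hq in
/-- The weights of strips of each size added to a sequence sum to one. -/
theorem sum_up_eq_one {s : ℕ → ℕ} {L : ℕ} (hL : ∀ t ≥ L, s t = 0) (j N : ℕ) (hN : L + j ≤ N) :
    ∑ ε ∈ powersetCard j (range N), up q s ε = 1 := by
  induction j generalizing N with
  | zero => simp [up, upWeight]
  | succ j ih =>
    have h := sum_up_sub_sum_up (q := q) hq (a := s) (b := 0) (N := N) (hL N (by omega)) rfl j
    have h1 : ∑ ε ∈ powersetCard (j + 1) (range N), (∏ t ∈ ε, q ^ (s t : ℤ)) * dn q 0 ε = 0 := by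
      refine sum_eq_zero fun ε hε => ?_
      rw [dn_eq_zero_of_not_subset (s := 0) (N := 0) (fun _ _ => rfl), mul_zero]
      intro h2
      have h3 := (mem_powersetCard.1 hε).2
      rw [range_zero, subset_empty] at h2
      simp [h2] at h3
    rw [h1] at h
    have h4 := sum_up_stable (q := q) (V := k) hL hN (show L + (j + 1) ≤ N + 1 by omega)
      fun _ => 1
    simp only [smul_eq_mul, mul_one] at h4
    rw [h4]
    simp only [Pi.zero_apply, Nat.cast_zero, neg_zero, zpow_zero, prod_const_one, one_mul] at h
    rw [sub_eq_zero.1 h, ih N (by omega)]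

end UpOperators

section PairSeries

variable {k : Type*} [Field k] {q : k} (hq : q ≠ 0) (hq1 : ∀ n, q ^ (n + 1) ≠ 1)
variable {A : Type*} [CommRing A] [Algebra k A]

/-- Generating series of `kern q 0 r • f (pairSum r)` over the sequences `r`, by size. -/
noncomputable def pairSeries (q : k) (f : (ℕ → ℕ) → A) : PowerSeries A :=
  PowerSeries.mk fun n => ∑ r ∈ desc n, kern q 0 r • f (pairSum r)

theorem antitone_pairSum {r : ℕ → ℕ} (hr : Antitone r) : Antitone (pairSum r) :=
  fun a b h => Nat.add_le_add (hr (by omega)) (hr (by omega))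

theorem pairSum_eq_zero {r : ℕ → ℕ} {N : ℕ} (hN : ∀ t ≥ N, r t = 0) :
    ∀ t ≥ N, pairSum r t = 0 := by
  intro t ht
  simp [pairSum, hN (2 * t) (by omega), hN (2 * t + 1) (by omega)]

theorem subStrip_pairSum_addStrip (r : ℕ → ℕ) (η : Finset ℕ) :
    subStrip (pairSum (addStrip r η)) (altFst η) = addStrip (pairSum r) (altSnd η) := by
  ext t
  have := alt_count η t
  simp only [subStrip, pairSum, addStrip]
  omega

include hq in
theorem sum_up_altSnd {r : ℕ → ℕ} {L n j : ℕ} (hL : ∀ t ≥ L, r t = 0) (hn : L + j ≤ n)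
    (G : (ℕ → ℕ) → A) :
    ∑ η ∈ powersetCard j (range (2 * n)), up q r η • G (addStrip (pairSum r) (altSnd η)) =
      upSum q n (j / 2) G (pairSum r) := by
  rw [upSum]
  have hpos : ∀ (m i : ℕ) (F : Finset ℕ → k), ∑ η ∈ powersetCard i (range m), F η =
      ∑ η ∈ (range m).powerset, if #η = i then F η else 0 := by
    intro m i F
    rw [← sum_filter, powersetCard_eq_filter]
  rcases Nat.even_or_odd' j with ⟨i, rfl | rfl⟩
  · refine sum_smul_eq_of_forall _ _ (up q r) (up q (pairSum r)) altSnd id (fun g => ?_)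
      fun ε => G (addStrip (pairSum r) ε)
    have h := evenSum_up_altSnd hq r n fun ε => if #ε = i then g ε else 0
    rw [hpos, hpos]
    simp only [evenSum, card_altSnd] at h
    rw [show 2 * i / 2 = i by omega]
    convert h using 2 with η _ ε _
    · by_cases h1 : #η = 2 * i
      · simp [h1]
      · rw [if_neg h1]
        split_ifs with h2 h3
        · exact absurd (by obtain ⟨a, ha⟩ := h2; omega) h1
        · simp
        · rfl
    · simp
  · rw [sum_up_stable hL (N' := 2 * n + 1) (by omega) (by omega)]
    refine sum_smul_eq_of_forall _ _ (up q r) (up q (pairSum r)) altSnd id (fun g => ?_)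
      fun ε => G (addStrip (pairSum r) ε)
    have h := oddSum_up_altSnd hq r (M := n) (hL _ (by omega)) fun ε => if #ε = i then g ε else 0
    rw [hpos, hpos]
    simp only [oddSum, card_altSnd] at h
    rw [show (2 * i + 1) / 2 = i by omega]
    convert h using 2 with η _ ε _
    · by_cases h1 : #η = 2 * i + 1
      · rw [if_pos h1, if_neg (by rw [h1]; simp), if_pos (by omega)]
      · rw [if_neg h1]
        split_ifs with h2 h3
        · rfl
        · exact absurd (by rw [Nat.not_even_iff_odd] at h2; obtain ⟨a, ha⟩ := h2; omega) h1
        · simp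
    · simp

include hq hq1 in
theorem pairSeries_dn {F G : (ℕ → ℕ) → A} {P x : A} {p : ℕ → A}
    (hF : ∀ r, Antitone r → ∀ N, (∀ t ≥ N, r t = 0) → P * F r = dnSum q N x G r)
    (hG : UpEigen q p G) :
    PowerSeries.C P * pairSeries q F =
      PowerSeries.mk (fun j => x ^ ((j + 1) / 2) * p (j / 2)) * pairSeries q G := by
  ext n
  rw [PowerSeries.coeff_C_mul, PowerSeries.coeff_mul, Nat.sum_antidiagonal_eq_sum_range_succ_mk,
    pairSeries, PowerSeries.coeff_mk, mul_sum]
  have e1 : ∀ μ ∈ desc n, P * kern q 0 μ • F (pairSum μ) = ∑ j ∈ range (2 * n + 1),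
      ∑ η ∈ powersetCard j (range (2 * n)), x ^ ((j + 1) / 2) *
        ((kern q 0 μ * dn q μ η) • G (subStrip (pairSum μ) (altFst η))) := by
    intro μ hμ
    have hz : ∀ t ≥ n, μ t = 0 := fun t => eq_zero_of_mem_desc hμ
    rw [mul_smul_comm, hF _ (antitone_pairSum (antitone_of_mem_desc hμ)) n (pairSum_eq_zero hz),
      dnSum]
    have h := sum_smul_eq_of_forall (range (2 * n)).powerset (range n).powerset (dn q μ)
      (dn q (pairSum μ)) altFst id
      (fun g => sum_dn_altFst hq μ (hz _ (by omega)) (hz _ (by omega)) g)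
      fun ε => x ^ #ε * G (subStrip (pairSum μ) ε)
    simp only [id, mul_smul_comm] at h ⊢
    rw [← h, sum_powerset, card_range, smul_sum]
    refine sum_congr rfl fun j _ => ?_
    rw [smul_sum]
    refine sum_congr rfl fun η hη => ?_
    rw [card_altFst, (mem_powersetCard.1 hη).2, smul_smul]
  rw [sum_congr rfl e1, sum_comm]
  have e2 : ∀ j ∈ range (2 * n + 1), ∑ μ ∈ desc n, ∑ η ∈ powersetCard j (range (2 * n)),
      x ^ ((j + 1) / 2) * ((kern q 0 μ * dn q μ η) • G (subStrip (pairSum μ) (altFst η))) =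
      if j ≤ n then x ^ ((j + 1) / 2) * p (j / 2) * PowerSeries.coeff (n - j) (pairSeries q G)
        else 0 := by
    intro j _
    simp only [← mul_sum]
    rw [sum_desc_strip (fun ε h => (mem_powersetCard.1 h).2) _
      (fun r η => (kern q 0 r * up q r η) • G (addStrip (pairSum r) (altSnd η)))]
    · split_ifs with hj
      · rw [mul_assoc, pairSeries, PowerSeries.coeff_mk, mul_sum _ _ (p (j / 2))]
        refine congrArg (_ * ·) (sum_congr rfl fun r hr => ?_)
        have hz : ∀ t ≥ n - j, r t = 0 := fun t => eq_zero_of_mem_desc hr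
        simp only [mul_smul]
        rw [← smul_sum, sum_up_altSnd hq hz (by omega), mul_smul_comm,
          hG _ (antitone_pairSum (antitone_of_mem_desc hr)) (n - j) _ _ (pairSum_eq_zero hz)
            (by omega)]
      · simp
    · intro r hr ε _ h
      exact of_dn_ne_zero (antitone_of_mem_desc hr)
        (right_ne_zero_of_mul (left_ne_zero_of_smul h))
    · intro r hr ε _ h
      exact of_up_ne_zero (antitone_of_mem_desc hr)
        (right_ne_zero_of_mul (left_ne_zero_of_smul h))
    · intro r hr ε _ ha
      rw [kern_addStrip_right hq hq1 (fun t => eq_zero_of_mem_desc hr) (antitone_of_mem_desc hr)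
        ha, subStrip_pairSum_addStrip]
      simp
  rw [sum_congr rfl e2, ← sum_filter]
  rw [show (range (2 * n + 1)).filter (· ≤ n) = range (n + 1) by
    ext; simp; omega]
  exact sum_congr rfl fun j _ => by simp only [PowerSeries.coeff_mk]

end PairSeries

section Eval

variable {k : Type*} [Field k]

theorem eq_of_forall_X_pow_dvd {σ : Type*} (j : σ) {f g : MvPowerSeries σ k}
    (h : ∀ N, MvPowerSeries.X j ^ N ∣ f - g) : f = g := by
  ext d
  have := MvPowerSeries.X_pow_dvd_iff.1 (h (d j + 1)) d (Nat.lt_succ_self _)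
  rwa [map_sub, sub_eq_zero] at this

/-- The sum of the first `N` terms of a power series evaluated at the variable `X j`. -/
noncomputable def evTrunc (j N : ℕ) (f : PowerSeries (MvPowerSeries ℕ k)) : MvPowerSeries ℕ k :=
  ∑ i ∈ range N, PowerSeries.coeff i f * MvPowerSeries.X j ^ i

theorem evTrunc_congr_dvd (j : ℕ) (f : PowerSeries (MvPowerSeries ℕ k)) {M N : ℕ} (h : M ≤ N) :
    MvPowerSeries.X j ^ M ∣ evTrunc j N f - evTrunc j M f := by
  rw [evTrunc, evTrunc, ← sum_range_add_sum_Ico _ h, add_sub_cancel_left]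
  exact dvd_sum fun i hi => dvd_mul_of_dvd_right (pow_dvd_pow _ (mem_Ico.1 hi).1) _

/-- Evaluation of a power series at the variable `X j`. -/
noncomputable def ev (j : ℕ) (f : PowerSeries (MvPowerSeries ℕ k)) : MvPowerSeries ℕ k :=
  fun d => MvPowerSeries.coeff d (evTrunc j (d j + 1) f)

theorem coeff_ev (j : ℕ) (f : PowerSeries (MvPowerSeries ℕ k)) (d : ℕ →₀ ℕ) :
    MvPowerSeries.coeff d (ev j f) = MvPowerSeries.coeff d (evTrunc j (d j + 1) f) := rfl

theorem X_pow_dvd_ev_sub (j N : ℕ) (f : PowerSeries (MvPowerSeries ℕ k)) :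
    MvPowerSeries.X j ^ N ∣ ev j f - evTrunc j N f := by
  refine MvPowerSeries.X_pow_dvd_iff.2 fun d hd => ?_
  have := MvPowerSeries.X_pow_dvd_iff.1 (evTrunc_congr_dvd j f (Nat.succ_le_of_lt hd)) d
    (Nat.lt_succ_self _)
  rw [map_sub, sub_eq_zero] at this
  rw [map_sub, coeff_ev, this, sub_self]

theorem eq_ev {j : ℕ} {f : PowerSeries (MvPowerSeries ℕ k)} {g : MvPowerSeries ℕ k}
    (h : ∀ N, MvPowerSeries.X j ^ N ∣ g - evTrunc j N f) : g = ev j f :=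
  eq_of_forall_X_pow_dvd j fun N => by
    simpa using dvd_sub (h N) (X_pow_dvd_ev_sub j N f)

theorem ev_add (j : ℕ) (f g : PowerSeries (MvPowerSeries ℕ k)) :
    ev j (f + g) = ev j f + ev j g := by
  refine (eq_ev fun N => ?_).symm
  have := dvd_add (X_pow_dvd_ev_sub j N f) (X_pow_dvd_ev_sub j N g)
  convert this using 1
  simp only [evTrunc, map_add, add_mul, sum_add_distrib]
  ring

theorem ev_C_mul (j : ℕ) (a : MvPowerSeries ℕ k) (f : PowerSeries (MvPowerSeries ℕ k)) :
    ev j (PowerSeries.C a * f) = a * ev j f := by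
  refine (eq_ev fun N => ?_).symm
  have := dvd_mul_of_dvd_right (X_pow_dvd_ev_sub j N f) a
  convert this using 1
  simp only [evTrunc, PowerSeries.coeff_C_mul, mul_sub, mul_sum, mul_assoc]

theorem ev_X_mul (j : ℕ) (f : PowerSeries (MvPowerSeries ℕ k)) :
    ev j (PowerSeries.X * f) = MvPowerSeries.X j * ev j f := by
  refine (eq_ev fun N => ?_).symm
  cases N with
  | zero => simp
  | succ N =>
    have := mul_dvd_mul_left (MvPowerSeries.X j) (X_pow_dvd_ev_sub j N f)
    rw [pow_succ']
    convert this using 1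
    rw [mul_sub]
    congr 1
    rw [evTrunc, sum_range_succ', evTrunc, mul_sum]
    simp only [PowerSeries.coeff_succ_X_mul, PowerSeries.coeff_zero_X_mul, zero_mul, add_zero]
    exact sum_congr rfl fun i _ => by ring

theorem ev_one (j : ℕ) : ev j (1 : PowerSeries (MvPowerSeries ℕ k)) = 1 := by
  refine (eq_ev fun N => ?_).symm
  cases N with
  | zero => simp
  | succ N => simp [evTrunc, PowerSeries.coeff_one]

theorem ev_sub (j : ℕ) (f g : PowerSeries (MvPowerSeries ℕ k)) :
    ev j (f - g) = ev j f - ev j g := by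
  have := ev_add j (f - g) g
  rw [sub_add_cancel] at this
  rw [this, add_sub_cancel_right]

theorem ev_zero (j : ℕ) : ev j (0 : PowerSeries (MvPowerSeries ℕ k)) = 0 := by
  simpa using ev_C_mul j 0 (0 : PowerSeries (MvPowerSeries ℕ k))

theorem ev_sum {ι : Type*} (j : ℕ) (S : Finset ι) (f : ι → PowerSeries (MvPowerSeries ℕ k)) :
    ev j (∑ i ∈ S, f i) = ∑ i ∈ S, ev j (f i) := by
  classical
  induction S using Finset.induction_on with
  | empty => simp [ev_zero]
  | insert a S ha ih => rw [sum_insert ha, sum_insert ha, ev_add, ih]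

theorem ev_X_pow_mul (j n : ℕ) (f : PowerSeries (MvPowerSeries ℕ k)) :
    ev j (PowerSeries.X ^ n * f) = MvPowerSeries.X j ^ n * ev j f := by
  induction n with
  | zero => simp
  | succ n ih => rw [pow_succ', mul_assoc, ev_X_mul, ih, pow_succ', mul_assoc]

theorem rescale_X {σ R : Type*} [CommRing R] (a : σ → R) (j : σ) :
    MvPowerSeries.rescale a (MvPowerSeries.X j) = MvPowerSeries.C (a j) * MvPowerSeries.X j := by
  classical
  ext d
  rw [MvPowerSeries.coeff_rescale, MvPowerSeries.coeff_C_mul, MvPowerSeries.coeff_X]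
  split_ifs with h <;> simp [h]

theorem rescale_C {σ R : Type*} [CommRing R] (a : σ → R) (c : R) :
    MvPowerSeries.rescale a (MvPowerSeries.C c) = MvPowerSeries.C c := by
  classical
  ext d
  rw [MvPowerSeries.coeff_rescale, MvPowerSeries.coeff_C]
  split_ifs with h <;> simp [h]

theorem rescale_ev (a : ℕ → k) (j : ℕ) (f : PowerSeries (MvPowerSeries ℕ k)) :
    MvPowerSeries.rescale a (ev j f) = ev j (PowerSeries.mk fun n =>
      MvPowerSeries.C (a j) ^ n * MvPowerSeries.rescale a (PowerSeries.coeff n f)) := by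
  refine eq_ev fun N => ?_
  have := map_dvd (MvPowerSeries.rescale a) (X_pow_dvd_ev_sub j N f)
  rw [map_pow, rescale_X, mul_pow] at this
  refine (dvd_of_mul_left_dvd this).trans (dvd_of_eq ?_)
  simp only [map_sub, evTrunc, map_sum, map_mul, map_pow, rescale_X, PowerSeries.coeff_mk]
  congr 1
  exact sum_congr rfl fun i _ => by ring

end Eval

section Chain

variable {k : Type*} [Field k] {q : k} (hq : q ≠ 0) (hq1 : ∀ n, q ^ (n + 1) ≠ 1)

/-- The size of an eventually vanishing sequence. -/
noncomputable def sz (r : ℕ → ℕ) : ℕ := ∑ᶠ t, r t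

theorem sz_eq_sum {r : ℕ → ℕ} {N : ℕ} (hN : ∀ t ≥ N, r t = 0) : sz r = ∑ t ∈ range N, r t :=
  finsum_eq_sum_of_support_subset _ fun t ht => by
    by_contra h
    exact ht (hN t (by simpa using h))

theorem sz_of_mem_desc {n : ℕ} {r : ℕ → ℕ} (h : r ∈ desc n) : sz r = n := by
  have hz : ∀ t ≥ n, r t = 0 := fun t => eq_zero_of_mem_desc h
  rw [sz_eq_sum hz, sum_of_mem_desc h hz]

theorem sz_addStrip {r : ℕ → ℕ} {N : ℕ} (hN : ∀ t ≥ N, r t = 0) (ε : Finset ℕ) :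
    sz (addStrip r ε) = sz r + #ε := by
  obtain ⟨N, -, hN, hε⟩ := exists_bound hN ε
  rw [sz_eq_sum (addStrip_eq_zero hN hε), sz_eq_sum hN, sum_addStrip hε]

theorem sz_subStrip {r : ℕ → ℕ} {N : ℕ} (hN : ∀ t ≥ N, r t = 0) {ε : Finset ℕ}
    (h : ∀ t ∈ ε, 1 ≤ r t) : sz r = sz (subStrip r ε) + #ε := by
  rw [← sz_addStrip (subStrip_eq_zero hN), addStrip_subStrip h]

theorem sz_pairSum {r : ℕ → ℕ} {N : ℕ} (hN : ∀ t ≥ N, r t = 0) : sz (pairSum r) = sz r := by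
  rw [sz_eq_sum (pairSum_eq_zero hN), sz_eq_sum (N := 2 * N) fun t ht => hN t (by omega)]
  clear hN
  induction N with
  | zero => simp
  | succ N ih =>
    rw [sum_range_succ, ih, show 2 * (N + 1) = 2 * N + 1 + 1 by ring, sum_range_succ,
      sum_range_succ, pairSum, add_assoc]

/-- `F` and `G` are related by the operator removing strips. -/
def DnRel {A : Type*} [CommRing A] [Algebra k A] (q : k) (P x : A) (F G : (ℕ → ℕ) → A) : Prop :=
  ∀ r, Antitone r → ∀ N, (∀ t ≥ N, r t = 0) → P * F r = dnSum q N x G r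

include hq in
theorem dnRel_one {A : Type*} [CommRing A] [Algebra k A] :
    DnRel q 1 (algebraMap k A q) (fun _ => 1) fun r => algebraMap k A (q ^ sz r) := by
  intro r hr N hN
  have h1 : ∑ ε ∈ (range N).powerset, dn q r ε = ∏ t ∈ range N, q ^ (-(r t : ℤ)) := by
    refine sum_dnWeight_eq_prod (z := fun t => q ^ (-(r t : ℤ)))
      (ς := fun t => q ^ ((r t : ℤ) - r (t + 1))) (fun t => ?_) ?_
    · rw [← zpow_add₀ hq]
      congr 1
      ring
    · simp [hN N le_rfl]
  have h2 : q ^ sz r * ∏ t ∈ range N, q ^ (-(r t : ℤ)) = 1 := by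
    rw [sz_eq_sum hN, ← prod_pow_eq_pow_sum, ← prod_mul_distrib]
    exact prod_eq_one fun t _ => by rw [zpow_neg, zpow_natCast, mul_inv_cancel₀ (pow_ne_zero _ hq)]
  rw [dnSum]
  have h3 : ∀ ε ∈ (range N).powerset,
      algebraMap k A q ^ #ε * (dn q r ε • algebraMap k A (q ^ sz (subStrip r ε))) =
        algebraMap k A (q ^ sz r * dn q r ε) := by
    intro ε _
    by_cases hd : dn q r ε = 0
    · simp [hd]
    · rw [sz_subStrip hN (of_dn_ne_zero hr hd).1, Algebra.smul_def, ← map_pow, ← map_mul,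
        ← map_mul]
      congr 1
      ring
  rw [sum_congr rfl h3, ← map_sum, ← mul_sum, h1, h2]
  simp

include hq in
theorem upEigen_pow {A : Type*} [CommRing A] [Algebra k A] :
    UpEigen q (fun j => algebraMap k A q ^ j) fun r => algebraMap k A (q ^ sz r) := by
  intro r _ L j N hL hN
  rw [upSum]
  have h : ∀ ε ∈ powersetCard j (range N), up q r ε • algebraMap k A (q ^ sz (addStrip r ε)) =
      algebraMap k A (q ^ (sz r + j) * up q r ε) := by
    intro ε hε
    rw [sz_addStrip hL, (mem_powersetCard.1 hε).2, Algebra.smul_def, ← map_mul, mul_comm]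
  rw [sum_congr rfl h, ← map_sum, ← mul_sum, sum_up_eq_one hq hL j N hN, mul_one, pow_add,
    map_mul, map_pow, mul_comm]
  simp only [map_pow]

/-- Iterated kernel sums, in the variables with indices `m, …, m + i - 1`. -/
noncomputable def chain (q : k) (f : (ℕ → ℕ) → MvPowerSeries ℕ k) (m : ℕ) :
    ℕ → (ℕ → ℕ) → MvPowerSeries ℕ k
  | 0 => f
  | i + 1 => fun s => ev (m + i) (kernSeries q (chain q f m i) s)

include hq hq1 in
theorem DnRel.ev {P x : MvPowerSeries ℕ k} {F G : (ℕ → ℕ) → MvPowerSeries ℕ k}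
    (h : DnRel q P x F G) (j : ℕ) :
    DnRel q (P * (1 - x * MvPowerSeries.X j)) (x * MvPowerSeries.X j)
      (fun s => ev j (kernSeries q F s)) fun s => ev j (kernSeries q G s) := by
  intro s hs M hM
  have h1 := congrArg (_root_.ev j) (kernSeries_dn hq hq1 h hs hM)
  rw [sub_mul, one_mul, ev_sub, mul_assoc (PowerSeries.C x), ev_C_mul, ev_C_mul, ev_X_mul,
    ev_C_mul, ev_sum] at h1
  rw [dnSum]
  refine Eq.trans ?_ (h1.trans ?_)
  · ring
  · refine sum_congr rfl fun ε _ => ?_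
    rw [mul_pow, ← map_pow, mul_assoc, ev_C_mul, ev_X_pow_mul, ev_C_mul, Algebra.smul_def]
    ring

include hq hq1 in
theorem UpEigen.ev {p : ℕ → MvPowerSeries ℕ k} {G : (ℕ → ℕ) → MvPowerSeries ℕ k} (hp : p 0 = 1)
    (h : UpEigen q p G) (j : ℕ) :
    UpEigen q (fun n => ∑ i ∈ range (n + 1), p i * MvPowerSeries.X j ^ i)
      fun s => ev j (kernSeries q G s) := by
  intro s _ L n N hL hN
  have h1 := congrArg (_root_.ev j) (kernSeries_up hq hq1 hp h hL n N hN)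
  rw [ev_sum, sum_mul, ev_sum] at h1
  rw [upSum, sum_mul]
  refine Eq.trans (sum_congr rfl fun ε _ => ?_) (h1.trans (sum_congr rfl fun i _ => ?_))
  · rw [ev_C_mul, Algebra.smul_def]
  · rw [mul_assoc, ev_C_mul, ev_X_pow_mul, mul_assoc]

/-- The product of the variables with indices in `[a, b)`. -/
noncomputable def yProd (k : Type*) [Field k] (a b : ℕ) : MvPowerSeries ℕ k :=
  ∏ t ∈ Ico a b, MvPowerSeries.X t

theorem yProd_succ {a b : ℕ} (h : a ≤ b) :
    yProd k a (b + 1) = yProd k a b * MvPowerSeries.X b := prod_Ico_succ_top h _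

theorem yProd_self (a : ℕ) : yProd k a a = 1 := by simp [yProd]

/-- The weight `q y_m ⋯ y_{b-1}`. -/
noncomputable def qyProd (q : k) (m b : ℕ) : MvPowerSeries ℕ k := MvPowerSeries.C q * yProd k m b

theorem qyProd_succ {a b : ℕ} (h : a ≤ b) :
    qyProd q a (b + 1) = qyProd q a b * MvPowerSeries.X b := by
  rw [qyProd, qyProd, yProd_succ h, mul_assoc]

include hq hq1 in
theorem dnRel_chain (m i : ℕ) :
    DnRel q (∏ a ∈ range i, (1 - qyProd q m (m + a + 1))) (qyProd q m (m + i))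
      (chain q (fun _ => 1) m i) (chain q (fun r => MvPowerSeries.C (q ^ sz r)) m i) := by
  induction i with
  | zero =>
    have := dnRel_one (A := MvPowerSeries ℕ k) hq
    rw [range_zero, prod_empty, add_zero, qyProd, yProd_self, mul_one]
    exact this
  | succ i ih =>
    have := ih.ev hq hq1 (m + i)
    rwa [← qyProd_succ (Nat.le_add_right m i), ← prod_range_succ
      (fun a => 1 - qyProd q m (m + a + 1))] at this

include hq hq1 in
theorem upEigen_chain (m i : ℕ) : ∃ p : ℕ → MvPowerSeries ℕ k, p 0 = 1 ∧
    UpEigen q p (chain q (fun r => MvPowerSeries.C (q ^ sz r)) m i) ∧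
    (∏ b ∈ range i, (1 - PowerSeries.C (yProd k (m + b + 1) (m + i)) * PowerSeries.X)) *
      ((1 - PowerSeries.C (qyProd q m (m + i)) * PowerSeries.X) * PowerSeries.mk p) = 1 := by
  induction i with
  | zero =>
    refine ⟨fun j => MvPowerSeries.C q ^ j, pow_zero _, ?_, ?_⟩
    · have := upEigen_pow (A := MvPowerSeries ℕ k) hq
      exact this
    · simp only [range_zero, prod_empty, one_mul, qyProd, add_zero, yProd_self, mul_one]
      ext n : 1
      rw [sub_mul, one_mul, map_sub, mul_assoc, PowerSeries.coeff_C_mul]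
      cases n with
      | zero => simp
      | succ n => simp [PowerSeries.coeff_succ_X_mul, PowerSeries.coeff_one, pow_succ']
  | succ i ih =>
    obtain ⟨p, h0, hp, h1⟩ := ih
    refine ⟨_, ?_, hp.ev hq hq1 h0 (m + i), ?_⟩
    · simp [h0]
    · have h2 := congrArg (PowerSeries.rescale (MvPowerSeries.X (R := k) (m + i))) h1
      have h3 : ∀ c : MvPowerSeries ℕ k, PowerSeries.rescale (MvPowerSeries.X (m + i))
          (1 - PowerSeries.C c * PowerSeries.X) =
          1 - PowerSeries.C (c * MvPowerSeries.X (m + i)) * PowerSeries.X := by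
        intro c
        rw [map_sub, map_one, map_mul, PowerSeries.rescale_X]
        simp only [map_mul, mul_assoc]
        congr 2
        ext n : 1
        rw [PowerSeries.coeff_rescale, PowerSeries.coeff_C]
        split_ifs with h <;> simp [h]
      rw [map_mul, map_mul, map_prod, map_one, h3, ← qyProd_succ (Nat.le_add_right m i)] at h2
      simp only [h3] at h2
      rw [prod_range_succ, ← add_assoc m i 1, yProd_self]
      refine Eq.trans ?_ h2
      have h4 : ∏ b ∈ range i, (1 - PowerSeries.C (yProd k (m + b + 1) (m + i + 1)) *
          PowerSeries.X) = ∏ b ∈ range i, (1 - PowerSeries.C (yProd k (m + b + 1) (m + i) *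
          MvPowerSeries.X (m + i)) * PowerSeries.X) := by
        refine prod_congr rfl fun b hb => ?_
        rw [yProd_succ (by have := mem_range.1 hb; omega)]
      have h5 : (1 - PowerSeries.C 1 * PowerSeries.X) * (PowerSeries.mk fun n =>
          ∑ i' ∈ range (n + 1), p i' * MvPowerSeries.X (m + i) ^ i') =
          PowerSeries.rescale (MvPowerSeries.X (m + i)) (PowerSeries.mk p) := by
        ext n : 1
        rw [map_one, one_mul, sub_mul, one_mul, map_sub, PowerSeries.coeff_rescale,
          PowerSeries.coeff_mk]
        cases n with
        | zero => simp
        | succ n =>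
          rw [PowerSeries.coeff_succ_X_mul, PowerSeries.coeff_mk, sum_range_succ,
            PowerSeries.coeff_mk]
          ring
      rw [h4, ← h5]
      ring

end Chain

section Doubling

variable {A : Type*} [CommRing A]

/-- The series `(1 + x T) p (x T ^ 2)`. -/
noncomputable def dbl (x : A) (p : PowerSeries A) : PowerSeries A :=
  PowerSeries.mk fun j => x ^ ((j + 1) / 2) * PowerSeries.coeff (j / 2) p

theorem dbl_one (x : A) : dbl x 1 = 1 + PowerSeries.C x * PowerSeries.X := by
  ext n
  rw [dbl, PowerSeries.coeff_mk, map_add, PowerSeries.coeff_C_mul, PowerSeries.coeff_one,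
    PowerSeries.coeff_one, PowerSeries.coeff_X]
  match n with
  | 0 => simp
  | 1 => simp
  | n + 2 => simp

theorem dbl_linear_mul (x c : A) (p : PowerSeries A) :
    dbl x ((1 - PowerSeries.C c * PowerSeries.X) * p) =
      (1 - PowerSeries.C (c * x) * PowerSeries.X ^ 2) * dbl x p := by
  ext n
  rw [sub_mul, one_mul, sub_mul, one_mul, map_sub, mul_assoc, mul_assoc, PowerSeries.coeff_C_mul,
    PowerSeries.coeff_X_pow_mul', dbl, PowerSeries.coeff_mk, map_sub, PowerSeries.coeff_C_mul,
    dbl, PowerSeries.coeff_mk]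
  match n with
  | 0 => simp
  | 1 => simp
  | n + 2 =>
    rw [if_pos (by omega), PowerSeries.coeff_mk, show (n + 2) / 2 = n / 2 + 1 by omega,
      PowerSeries.coeff_succ_X_mul, show (n + 2 + 1) / 2 = (n + 1) / 2 + 1 by omega,
      show n + 2 - 2 = n by omega]
    ring

theorem dbl_prod_linear_mul {ι : Type*} (x : A) (S : Finset ι) (c : ι → A) (p : PowerSeries A) :
    dbl x ((∏ b ∈ S, (1 - PowerSeries.C (c b) * PowerSeries.X)) * p) =
      (∏ b ∈ S, (1 - PowerSeries.C (c b * x) * PowerSeries.X ^ 2)) * dbl x p := by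
  classical
  induction S using Finset.induction_on with
  | empty => simp
  | insert a S ha ih =>
    rw [prod_insert ha, prod_insert ha, mul_assoc, dbl_linear_mul, ih, mul_assoc]

end Doubling

section Difference

variable {k : Type*} [Field k] {q : k} (hq : q ≠ 0) (hq1 : ∀ n, q ^ (n + 1) ≠ 1)

/-- The full iterated sum over the variables with indices `m, …, l`. -/
noncomputable def bSum (q : k) (f : (ℕ → ℕ) → MvPowerSeries ℕ k) (m l : ℕ) : MvPowerSeries ℕ k :=
  ev l (pairSeries q (chain q f m (l - m)))

theorem ev_linear_mul (j : ℕ) (c : MvPowerSeries ℕ k) (n : ℕ)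
    (f : PowerSeries (MvPowerSeries ℕ k)) :
    ev j ((1 - PowerSeries.C c * PowerSeries.X ^ n) * f) =
      (1 - c * MvPowerSeries.X j ^ n) * ev j f := by
  rw [sub_mul, one_mul, ev_sub, mul_assoc, ev_C_mul, ev_X_pow_mul]
  ring

theorem ev_prod_linear_mul {ι : Type*} (j : ℕ) (S : Finset ι) (c : ι → MvPowerSeries ℕ k) (n : ℕ)
    (f : PowerSeries (MvPowerSeries ℕ k)) :
    ev j ((∏ b ∈ S, (1 - PowerSeries.C (c b) * PowerSeries.X ^ n)) * f) =
      (∏ b ∈ S, (1 - c b * MvPowerSeries.X j ^ n)) * ev j f := by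
  classical
  induction S using Finset.induction_on with
  | empty => simp
  | insert a S ha ih =>
    rw [prod_insert ha, prod_insert ha, mul_assoc, ev_linear_mul, ih, mul_assoc]

/-- The product of the linear factors of the `q`-difference equation of `bSum`. -/
noncomputable def diffFactor (q : k) (m l : ℕ) : MvPowerSeries ℕ k :=
  (∏ b ∈ range (l - m),
      (1 - yProd k (m + b + 1) l * qyProd q m l * MvPowerSeries.X l ^ 2)) *
    ((1 - qyProd q m l * MvPowerSeries.X l) *
      ∏ a ∈ range (l - m), (1 - qyProd q m (m + a + 1)))

include hq hq1 in
theorem diffFactor_mul_bSum {m l : ℕ} (hm : m ≤ l) :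
    diffFactor q m l * bSum q (fun _ => 1) m l =
      bSum q (fun r => MvPowerSeries.C (q ^ sz r)) m l := by
  obtain ⟨p, -, hp, h1⟩ := upEigen_chain hq hq1 m (l - m)
  have h2 := pairSeries_dn hq hq1 (dnRel_chain hq hq1 m (l - m)) hp
  rw [show m + (l - m) = l by omega] at h1 h2
  set x := qyProd q m l with hx
  set P := ∏ a ∈ range (l - m), (1 - qyProd q m (m + a + 1)) with hP
  have h3 : (PowerSeries.mk fun j => x ^ ((j + 1) / 2) * p (j / 2)) =
      dbl x (PowerSeries.mk p) := by
    simp only [dbl, PowerSeries.coeff_mk]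
  rw [h3] at h2
  have h4 := congrArg (dbl x) h1
  rw [dbl_prod_linear_mul, dbl_linear_mul, dbl_one] at h4
  set D := ∏ b ∈ range (l - m),
    (1 - PowerSeries.C (yProd k (m + b + 1) l * x) * PowerSeries.X ^ 2) with hD
  have h5 : (1 + PowerSeries.C x * PowerSeries.X : PowerSeries (MvPowerSeries ℕ k)) ≠ 0 := by
    intro h
    have := congrArg (PowerSeries.coeff 0) h
    simp at this
  have h6 : D * ((1 - PowerSeries.C x * PowerSeries.X ^ 1) * dbl x (PowerSeries.mk p)) = 1 := by
    refine mul_left_cancel₀ h5 ?_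
    rw [map_mul] at h4
    linear_combination h4
  have h7 : D * ((1 - PowerSeries.C x * PowerSeries.X ^ 1) *
      (PowerSeries.C P * pairSeries q (chain q (fun _ => 1) m (l - m)))) =
      pairSeries q (chain q (fun r => MvPowerSeries.C (q ^ sz r)) m (l - m)) := by
    rw [h2]
    linear_combination
      pairSeries q (chain q (fun r => MvPowerSeries.C (q ^ sz r)) m (l - m)) * h6
  have h8 := congrArg (ev l) h7
  rw [hD, ev_prod_linear_mul, ev_linear_mul, ev_C_mul, pow_one] at h8
  rw [bSum, bSum, ← h8, diffFactor]
  ring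

end Difference

section Rescaling

variable {k : Type*} [CommRing k]

/-- Rescaling of the single variable `X m`. -/
noncomputable def resc (m : ℕ) (c : k) : MvPowerSeries ℕ k →+* MvPowerSeries ℕ k :=
  MvPowerSeries.rescale (Function.update 1 m c)

theorem coeff_resc (m : ℕ) (c : k) (f : MvPowerSeries ℕ k) (d : ℕ →₀ ℕ) :
    MvPowerSeries.coeff d (resc m c f) = c ^ d m * MvPowerSeries.coeff d f := by
  rw [resc, MvPowerSeries.coeff_rescale]
  congr 1
  rw [Finsupp.prod, prod_eq_single m]
  · simp
  · intro b _ hb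
    simp [Function.update_of_ne hb]
  · intro h
    simp [Finsupp.notMem_support_iff.1 h]

theorem resc_C (m : ℕ) (c a : k) :
    resc m c (MvPowerSeries.C a) = MvPowerSeries.C a := rescale_C _ _

theorem resc_X_self (m : ℕ) (c : k) :
    resc m c (MvPowerSeries.X m) = MvPowerSeries.C c * MvPowerSeries.X m := by
  simp [resc, rescale_X]

theorem resc_X_of_ne {m j : ℕ} (c : k) (h : j ≠ m) :
    resc m c (MvPowerSeries.X j) = MvPowerSeries.X j := by
  simp [resc, rescale_X, Function.update_of_ne h]

theorem resc_smul (m : ℕ) (c a : k) (f : MvPowerSeries ℕ k) :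
    resc m c (a • f) = a • resc m c f := by
  ext d
  simp [coeff_resc, mul_left_comm]

theorem resc_zero_resc (m : ℕ) (c : k) (f : MvPowerSeries ℕ k) :
    resc m 0 (resc m c f) = resc m 0 f := by
  ext d
  simp only [coeff_resc]
  by_cases h : d m = 0 <;> simp [h]

end Rescaling

section Rescaling

variable {k : Type*} [Field k] {q : k}

theorem resc_ev_kernSeries (m j : ℕ) (c : k) (F : (ℕ → ℕ) → MvPowerSeries ℕ k) (s : ℕ → ℕ) :
    resc m c (ev j (kernSeries q F s)) = ev j (kernSeries q (fun r =>
      MvPowerSeries.C ((Function.update (1 : ℕ → k) m c j) ^ sz r) * resc m c (F r)) s) := by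
  rw [resc, rescale_ev]
  congr 1
  ext n : 1
  rw [kernSeries, PowerSeries.coeff_mk, PowerSeries.coeff_mk, kernSeries, PowerSeries.coeff_mk,
    map_sum, mul_sum]
  refine sum_congr rfl fun r hr => ?_
  have := resc_smul m c (kern q s r) (F r)
  rw [resc] at this
  rw [this, sz_of_mem_desc hr, mul_smul_comm, map_pow]

theorem resc_ev_pairSeries (m j : ℕ) (c : k) (F : (ℕ → ℕ) → MvPowerSeries ℕ k) :
    resc m c (ev j (pairSeries q F)) = ev j (pairSeries q (fun r =>
      MvPowerSeries.C ((Function.update (1 : ℕ → k) m c j) ^ sz r) * resc m c (F r))) := by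
  rw [resc, rescale_ev]
  congr 1
  ext n : 1
  rw [pairSeries, PowerSeries.coeff_mk, PowerSeries.coeff_mk, pairSeries, PowerSeries.coeff_mk,
    map_sum, mul_sum]
  refine sum_congr rfl fun r hr => ?_
  have := resc_smul m c (kern q 0 r) (F (pairSum r))
  rw [resc] at this
  rw [this, sz_pairSum (fun t => eq_zero_of_mem_desc hr), sz_of_mem_desc hr, mul_smul_comm,
    map_pow]

theorem resc_chain_succ (m i : ℕ) (c : k) (s : ℕ → ℕ) :
    resc m c (chain q (fun _ => 1) m (i + 1) s) =
      chain q (fun r => MvPowerSeries.C (c ^ sz r)) m (i + 1) s := by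
  induction i generalizing s with
  | zero => simp only [chain, resc_ev_kernSeries, add_zero, Function.update_self, map_one, mul_one]
  | succ i ih =>
    rw [chain, resc_ev_kernSeries, Function.update_of_ne (by omega)]
    simp only [Pi.one_apply, one_pow, map_one, one_mul, ih]
    rfl

theorem resc_chain_of_lt {m m' : ℕ} (h : m < m') (i : ℕ) (c : k) (s : ℕ → ℕ) :
    resc m c (chain q (fun _ => 1) m' i s) = chain q (fun _ => 1) m' i s := by
  induction i generalizing s with
  | zero => simp [chain]
  | succ i ih =>
    rw [chain, resc_ev_kernSeries, Function.update_of_ne (by omega)]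
    simp only [Pi.one_apply, one_pow, map_one, one_mul, ih]

theorem resc_bSum {m l : ℕ} (hm : m ≤ l) (c : k) :
    resc m c (bSum q (fun _ => 1) m l) = bSum q (fun r => MvPowerSeries.C (c ^ sz r)) m l := by
  rw [bSum, resc_ev_pairSeries, bSum]
  rcases hm.eq_or_lt with rfl | h
  · simp [chain]
  · obtain ⟨i, hi⟩ : ∃ i, l - m = i + 1 := ⟨l - m - 1, by omega⟩
    rw [hi, Function.update_of_ne (by omega)]
    simp only [Pi.one_apply, one_pow, map_one, one_mul, resc_chain_succ]

theorem resc_bSum_of_lt {m m' l : ℕ} (h : m < m') (hl : m' ≤ l) (c : k) :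
    resc m c (bSum q (fun _ => 1) m' l) = bSum q (fun _ => 1) m' l := by
  rw [bSum, resc_ev_pairSeries, Function.update_of_ne (by omega)]
  simp only [Pi.one_apply, one_pow, map_one, one_mul, resc_chain_of_lt h]

theorem kernSeries_zero_pow (s : ℕ → ℕ) :
    kernSeries q (fun r => MvPowerSeries.C (σ := ℕ) ((0 : k) ^ sz r)) s = 1 := by
  ext n : 1
  rw [kernSeries, PowerSeries.coeff_mk, PowerSeries.coeff_one]
  split_ifs with h
  · subst h
    simp [desc_zero, kern_zero_right, sz]
  · exact sum_eq_zero fun r hr => by rw [sz_of_mem_desc hr, zero_pow h, map_zero, smul_zero]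

theorem pairSeries_zero_pow :
    pairSeries q (fun r => MvPowerSeries.C (σ := ℕ) ((0 : k) ^ sz r)) = 1 := by
  have h0 : pairSum 0 = 0 := rfl
  ext n : 1
  rw [pairSeries, PowerSeries.coeff_mk, PowerSeries.coeff_one]
  split_ifs with h
  · subst h
    simp [desc_zero, kern_zero_right, h0, sz]
  · exact sum_eq_zero fun r hr => by
      rw [sz_pairSum (fun t => eq_zero_of_mem_desc hr), sz_of_mem_desc hr, zero_pow h, map_zero,
        smul_zero]

theorem chain_zero_pow (m i : ℕ) :
    chain q (fun r => MvPowerSeries.C ((0 : k) ^ sz r)) m (i + 1) =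
      chain q (fun _ => 1) (m + 1) i := by
  induction i with
  | zero =>
    ext1 s
    change ev (m + 0) (kernSeries q (fun r => MvPowerSeries.C ((0 : k) ^ sz r)) s) = 1
    rw [kernSeries_zero_pow, ev_one]
  | succ i ih =>
    ext1 s
    rw [chain, ih, chain, show m + 1 + i = m + (i + 1) by ring]

theorem resc_zero_bSum_of_lt {m l : ℕ} (h : m < l) :
    resc m 0 (bSum q (fun _ => 1) m l) = bSum q (fun _ => 1) (m + 1) l := by
  rw [resc_bSum h.le, bSum, show l - m = (l - (m + 1)) + 1 by omega, chain_zero_pow, bSum]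

theorem resc_zero_bSum_self (l : ℕ) : resc l 0 (bSum q (fun _ => 1) l l) = 1 := by
  rw [resc_bSum le_rfl, bSum, Nat.sub_self, chain, pairSeries_zero_pow, ev_one]

theorem X_dvd_of_resc_zero {m : ℕ} {f : MvPowerSeries ℕ k} (h : resc m 0 f = 0) :
    MvPowerSeries.X m ∣ f := by
  rw [MvPowerSeries.X_dvd_iff]
  intro d hd
  have := coeff_resc m 0 f d
  rw [h, hd] at this
  simpa using this.symm

/-- Uniqueness for `q`-difference equations in the variable `X m`. -/
theorem eq_zero_of_resc {q : k} (hq1 : ∀ n, q ^ (n + 1) ≠ 1) {m : ℕ} {h D : MvPowerSeries ℕ k}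
    (hD : resc m 0 D = 1) (h0 : resc m 0 h = 0) (hh : D * h = resc m q h) : h = 0 := by
  refine eq_of_forall_X_pow_dvd m fun N => ?_
  rw [sub_zero]
  induction N with
  | zero => simp
  | succ N ih =>
    cases N with
    | zero => simpa using X_dvd_of_resc_zero h0
    | succ N =>
      obtain ⟨g, rfl⟩ := ih
      rw [map_mul, map_pow, resc_X_self, mul_pow] at hh
      have hX : (MvPowerSeries.X m : MvPowerSeries ℕ k) ^ (N + 1) ≠ 0 :=
        pow_ne_zero _ fun h => by
          simpa [MvPowerSeries.coeff_X] using
            congrArg (MvPowerSeries.coeff (Finsupp.single m 1)) h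
      have h1 : D * g = MvPowerSeries.C q ^ (N + 1) * resc m q g := by
        refine mul_left_cancel₀ hX ?_
        linear_combination hh
      have h2 := congrArg (resc m 0) h1
      rw [map_mul, map_mul, hD, one_mul, resc_zero_resc, ← map_pow, resc_C] at h2
      have h3 : resc m 0 g = 0 := by
        ext d
        have := congrArg (MvPowerSeries.coeff d) h2
        rw [MvPowerSeries.coeff_C_mul] at this
        have h4 : (q ^ (N + 1) - 1) * MvPowerSeries.coeff d (resc m 0 g) = 0 := by
          linear_combination -this
        simpa using (mul_eq_zero.1 h4).resolve_left (sub_ne_zero.2 (hq1 N))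
      obtain ⟨g', rfl⟩ := X_dvd_of_resc_zero h3
      exact ⟨g', by ring⟩

end Rescaling

section Roots

/-- The root `α_i + ⋯ + α_j`. -/
def seg (i j : ℕ) : ℕ → ℕ := fun s => if i ≤ s ∧ s ≤ j then 1 else 0

/-- The root `α_i + ⋯ + α_{j-1} + 2 (α_j + ⋯ + α_l)`. -/
def dblRoot (l i j : ℕ) : ℕ → ℕ :=
  fun s => (if i ≤ s ∧ s ≤ j - 1 then 1 else 0) + (if j ≤ s ∧ s ≤ l then 2 else 0)

theorem dblRoot_eq_add {l i j : ℕ} (h : i < j) (hj : j ≤ l) :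
    dblRoot l i j = seg i l + seg j l := by
  ext s
  simp only [dblRoot, seg, Pi.add_apply]
  split_ifs <;> omega

open Classical in
/-- The positive roots of type `B_l` whose first nonzero coordinate is the `m`-th one. -/
noncomputable def rootRow (l m : ℕ) : Finset (ℕ → ℕ) :=
  ((range (l - m)).image fun b => dblRoot l m (m + b + 1)) ∪
    ({seg m l} ∪ (range (l - m)).image fun a => seg m (m + a))

theorem prod_rootRow {M : Type*} [CommMonoid M] {l m : ℕ} (hm : m ≤ l) (G : (ℕ → ℕ) → M) :
    ∏ c ∈ rootRow l m, G c = (∏ b ∈ range (l - m), G (dblRoot l m (m + b + 1))) *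
      (G (seg m l) * ∏ a ∈ range (l - m), G (seg m (m + a))) := by
  have hseg : seg m l l = 1 := by simp [seg, hm]
  have hlt : ∀ a ∈ range (l - m), seg m (m + a) l = 0 := fun a ha => by
    rw [mem_range] at ha
    simp only [seg]
    split_ifs <;> omega
  have hdbl : ∀ b ∈ range (l - m), dblRoot l m (m + b + 1) l = 2 := fun b hb => by
    rw [mem_range] at hb
    simp only [dblRoot]
    split_ifs <;> omega
  classical
  rw [rootRow, prod_union, prod_union, prod_image, prod_image, prod_singleton]
  · intro a ha a' ha' h
    have h1 := congrFun h (m + a)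
    have h2 := congrFun h (m + a')
    simp only [seg] at h1 h2
    split_ifs at h1 h2 <;> omega
  · intro b hb b' hb' h
    have hb1 := mem_range.1 hb
    have hb2 := mem_range.1 hb'
    have h1 := congrFun h (m + b + 1)
    have h2 := congrFun h (m + b' + 1)
    simp only [dblRoot] at h1 h2
    split_ifs at h1 h2 <;> omega
  · rw [disjoint_singleton_left, mem_image]
    rintro ⟨a, ha, h⟩
    have := hlt a ha
    rw [h, hseg] at this
    omega
  · rw [disjoint_left]
    intro c hc hc'
    obtain ⟨b, hb, rfl⟩ := mem_image.1 hc
    have h1 := hdbl b hb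
    rcases mem_union.1 hc' with h | h
    · rw [mem_singleton.1 h, hseg] at h1
      omega
    · obtain ⟨a, ha, h⟩ := mem_image.1 h
      rw [← h, hlt a ha] at h1
      omega

theorem apply_of_mem_rootRow {l m : ℕ} (hm : m ≤ l) {c : ℕ → ℕ} (hc : c ∈ rootRow l m) :
    c m = 1 ∧ ∀ s < m, c s = 0 := by
  simp only [rootRow, mem_union, mem_image, mem_singleton, mem_range] at hc
  rcases hc with ⟨b, hb, rfl⟩ | rfl | ⟨a, ha, rfl⟩
  · simp only [dblRoot]
    exact ⟨by split_ifs <;> omega, fun s hs => by split_ifs <;> omega⟩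
  · simp only [seg]
    exact ⟨by split_ifs <;> omega, fun s hs => by split_ifs <;> omega⟩
  · simp only [seg]
    exact ⟨by split_ifs <;> omega, fun s hs => by split_ifs <;> omega⟩

open Classical in
/-- The positive roots of type `B_l`. -/
noncomputable def posRoots (l : ℕ) : Finset (ℕ → ℕ) := (Icc 1 l).biUnion (rootRow l)

theorem prod_posRoots {M : Type*} [CommMonoid M] (l : ℕ) (G : (ℕ → ℕ) → M) :
    ∏ c ∈ posRoots l, G c = ∏ m ∈ Icc 1 l, ∏ c ∈ rootRow l m, G c := by
  classical
  refine prod_biUnion fun m hm m' hm' hne => disjoint_left.2 fun c hc hc' => ?_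
  have h1 := apply_of_mem_rootRow (mem_Icc.1 hm).2 hc
  have h2 := apply_of_mem_rootRow (mem_Icc.1 hm').2 hc'
  rcases lt_or_gt_of_ne hne with h | h
  · have := h2.2 m h
    omega
  · have := h1.2 m' h
    omega

theorem mem_posRoots {l : ℕ} (hl : 1 ≤ l) (c : ℕ → ℕ) :
    c ∈ posRoots l ↔
      ((∃ i j, 1 ≤ i ∧ i ≤ j ∧ j ≤ l - 1 ∧ c = seg i j) ∨ (∃ i, 1 ≤ i ∧ i ≤ l ∧ c = seg i l) ∨
        ∃ i j, 1 ≤ i ∧ i < j ∧ j ≤ l ∧ c = dblRoot l i j) := by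
  simp only [posRoots, rootRow, mem_biUnion, mem_union, mem_image, mem_singleton, mem_range,
    mem_Icc]
  constructor
  · rintro ⟨m, ⟨hm, hml⟩, ⟨b, hb, rfl⟩ | rfl | ⟨a, ha, rfl⟩⟩
    · exact Or.inr (Or.inr ⟨m, m + b + 1, hm, by omega, by omega, rfl⟩)
    · exact Or.inr (Or.inl ⟨m, hm, hml, rfl⟩)
    · exact Or.inl ⟨m, m + a, hm, by omega, by omega, rfl⟩
  · rintro (⟨i, j, hi, hij, hj, rfl⟩ | ⟨i, hi, hil, rfl⟩ | ⟨i, j, hi, hij, hj, rfl⟩)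
    · exact ⟨i, by omega, Or.inr (Or.inr ⟨j - i, by omega, by rw [Nat.add_sub_cancel' hij]⟩)⟩
    · exact ⟨i, by omega, Or.inr (Or.inl rfl)⟩
    · exact ⟨i, by omega, Or.inl ⟨j - i - 1, by omega, by congr 1; omega⟩⟩

end Roots

section Monomial

variable {k : Type*} [CommRing k]

/-- The monomial `y^c`. -/
noncomputable def yMon (k : Type*) [CommRing k] (l : ℕ) (c : ℕ → ℕ) : MvPowerSeries ℕ k :=
  ∏ s ∈ Icc 1 l, MvPowerSeries.X s ^ c s

theorem yMon_add (l : ℕ) (c d : ℕ → ℕ) : yMon k l (c + d) = yMon k l c * yMon k l d := by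
  simp only [yMon, Pi.add_apply, pow_add, prod_mul_distrib]

theorem resc_yMon {l m : ℕ} (hm : m ∈ Icc 1 l) (a : k) (c : ℕ → ℕ) :
    resc m a (yMon k l c) = MvPowerSeries.C (a ^ c m) * yMon k l c := by
  rw [yMon, map_prod, ← mul_prod_erase _ _ hm, ← mul_prod_erase _ _ hm, map_pow, resc_X_self,
    mul_pow, map_pow, mul_assoc]
  congr 2
  refine prod_congr rfl fun s hs => ?_
  rw [map_pow, resc_X_of_ne _ (mem_erase.1 hs).1]

end Monomial

section Product

variable {k : Type*} [Field k] {q : k}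

theorem yMon_seg {l i j : ℕ} (hi : 1 ≤ i) (hj : j ≤ l) :
    yMon k l (seg i j) = yProd k i (j + 1) := by
  simp only [yMon, seg, pow_ite, pow_one, pow_zero]
  rw [← prod_filter, yProd]
  refine prod_congr ?_ fun _ _ => rfl
  ext s
  simp only [mem_filter, mem_Icc, mem_Ico]
  omega

theorem diffFactor_eq_prod {l m : ℕ} (hm : 1 ≤ m) (hml : m ≤ l) :
    diffFactor q m l = ∏ c ∈ rootRow l m, (1 - MvPowerSeries.C q * yMon k l c) := by
  rw [prod_rootRow hml, diffFactor]
  congr 1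
  · refine prod_congr rfl fun b hb => ?_
    rw [mem_range] at hb
    rw [dblRoot_eq_add (by omega) (by omega), yMon_add, yMon_seg hm le_rfl,
      yMon_seg (by omega) le_rfl, yProd_succ hml, yProd_succ (by omega), qyProd]
    ring
  congr 1
  · rw [yMon_seg hm le_rfl, yProd_succ hml, qyProd, mul_assoc]
  · refine prod_congr rfl fun a ha => ?_
    rw [mem_range] at ha
    rw [yMon_seg hm (by omega), qyProd]

/-- The summation side equals the product side, for any family `F` of series solving the
`q`-difference equations of the factors `∏ (1 - q^n y^c)⁻¹`. -/
theorem bSum_eq_prod (hq : q ≠ 0) (hq1 : ∀ n, q ^ (n + 1) ≠ 1) {l : ℕ} (hl : 1 ≤ l)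
    {F : (ℕ → ℕ) → MvPowerSeries ℕ k}
    (hF : ∀ m ∈ Icc 1 l, ∀ c : ℕ → ℕ, c m = 1 →
      (1 - MvPowerSeries.C q * yMon k l c) * F c = resc m q (F c))
    (hF0 : ∀ m ∈ Icc 1 l, ∀ c : ℕ → ℕ, c m = 1 → resc m 0 (F c) = 1) :
    bSum q (fun _ => 1) 1 l = ∏ c ∈ posRoots l, F c := by
  have hstep : ∀ m ∈ Icc 1 l, ∀ B : MvPowerSeries ℕ k, (∀ a, resc m a B = B) →
      resc m 0 (bSum q (fun _ => 1) m l) = B →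
      bSum q (fun _ => 1) m l = (∏ c ∈ rootRow l m, F c) * B := by
    intro m hm B hB hB0
    have hml := (mem_Icc.1 hm).2
    have hc := fun c (h : c ∈ rootRow l m) => (apply_of_mem_rootRow hml h).1
    rw [← sub_eq_zero]
    refine eq_zero_of_resc hq1 (D := diffFactor q m l) (m := m) ?_ ?_ ?_
    · rw [diffFactor_eq_prod (mem_Icc.1 hm).1 hml, map_prod]
      refine prod_eq_one fun c h => ?_
      rw [map_sub, map_one, map_mul, resc_yMon hm, hc c h]
      simp
    · rw [map_sub, hB0, map_mul, hB, map_prod, prod_congr rfl fun c h => hF0 m hm c (hc c h)]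
      simp
    · rw [mul_sub, map_sub, diffFactor_mul_bSum hq hq1 hml, resc_bSum hml, map_mul, hB, map_prod,
        diffFactor_eq_prod (mem_Icc.1 hm).1 hml, ← mul_assoc, ← prod_mul_distrib,
        prod_congr rfl fun c h => hF m hm c (hc c h)]
  have hall : ∀ n < l, bSum q (fun _ => 1) (l - n) l =
      ∏ m ∈ Icc (l - n) l, ∏ c ∈ rootRow l m, F c := by
    intro n hn
    induction n with
    | zero =>
      rw [Nat.sub_zero, Icc_self, prod_singleton,
        hstep l (mem_Icc.2 ⟨hl, le_rfl⟩) 1 (fun a => map_one _) (resc_zero_bSum_self l), mul_one]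
    | succ n ih =>
      have h1 : l - n = l - (n + 1) + 1 := by omega
      rw [h1] at ih
      rw [hstep (l - (n + 1)) (mem_Icc.2 ⟨by omega, by omega⟩) _
        (fun a => resc_bSum_of_lt (Nat.lt_succ_self _) (by omega) a)
        (resc_zero_bSum_of_lt (by omega)), ih (by omega),
        ← mul_prod_Ioc_eq_prod_Icc (show l - (n + 1) ≤ l by omega), ← Icc_add_one_left_eq_Ioc]
  have := hall (l - 1) (by omega)
  rwa [Nat.sub_sub_self hl, ← prod_posRoots] at this

end Product

section Tuples

open Classical in
/-- Tuples of descending sequences `ρ m, …, ρ (m + i - 1)` of sizes `e m, …, e (m + i - 1)`. -/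
noncomputable def tuples (e : ℕ → ℕ) (m : ℕ) : ℕ → Finset (ℕ → ℕ → ℕ)
  | 0 => {0}
  | i + 1 => (desc (e (m + i)) ×ˢ tuples e m i).image fun p => Function.update p.2 (m + i) p.1

theorem mem_tuples {e : ℕ → ℕ} {m i : ℕ} {ρ : ℕ → ℕ → ℕ} :
    ρ ∈ tuples e m i ↔
      (∀ j ∈ Ico m (m + i), ρ j ∈ desc (e j)) ∧ ∀ j, j ∉ Ico m (m + i) → ρ j = 0 := by
  classical
  induction i generalizing ρ with
  | zero => simp [tuples, funext_iff]
  | succ i ih =>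
    simp only [tuples, mem_image, mem_product, Prod.exists]
    constructor
    · rintro ⟨r, ρ, ⟨hr, hρ⟩, rfl⟩
      obtain ⟨h1, h2⟩ := ih.1 hρ
      refine ⟨fun j hj => ?_, fun j hj => ?_⟩
      · rcases eq_or_ne j (m + i) with rfl | hne
        · simpa using hr
        · rw [Function.update_of_ne hne]
          rw [mem_Ico] at hj
          exact h1 j (mem_Ico.2 (by omega))
      · rw [mem_Ico] at hj
        rw [Function.update_of_ne (by omega)]
        exact h2 j (by rw [mem_Ico]; omega)
    · rintro ⟨h1, h2⟩
      refine ⟨ρ (m + i), Function.update ρ (m + i) 0,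
        ⟨h1 _ (mem_Ico.2 (by omega)), ih.2 ⟨fun j hj => ?_, fun j hj => ?_⟩⟩, by simp⟩
      · rw [mem_Ico] at hj
        rw [Function.update_of_ne (by omega)]
        exact h1 j (mem_Ico.2 (by omega))
      · rcases eq_or_ne j (m + i) with rfl | hne
        · simp
        · rw [mem_Ico] at hj
          rw [Function.update_of_ne hne]
          exact h2 j (by rw [mem_Ico]; omega)

theorem sum_tuples_succ {M : Type*} [AddCommMonoid M] (e : ℕ → ℕ) (m i : ℕ)
    (G : (ℕ → ℕ → ℕ) → M) :
    ∑ ρ ∈ tuples e m (i + 1), G ρ =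
      ∑ r ∈ desc (e (m + i)), ∑ ρ ∈ tuples e m i, G (Function.update ρ (m + i) r) := by
  classical
  rw [tuples, sum_image, sum_product]
  rintro ⟨r, ρ⟩ hp ⟨r', ρ'⟩ hp' h
  have hρ := (mem_tuples.1 (mem_product.1 hp).2).2 (m + i) (by simp)
  have hρ' := (mem_tuples.1 (mem_product.1 hp').2).2 (m + i) (by simp)
  dsimp only at h hρ hρ'
  refine Prod.ext (by simpa using congrFun h (m + i)) (funext fun j => ?_)
  rcases eq_or_ne j (m + i) with rfl | hne
  · exact hρ.trans hρ'.symm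
  · simpa [Function.update_of_ne hne] using congrFun h j

end Tuples

section Coefficients

variable {k : Type*} [Field k] {q : k}

theorem coeff_ev_of_free {j : ℕ} {f : PowerSeries (MvPowerSeries ℕ k)}
    (hf : ∀ n, ∀ d : ℕ →₀ ℕ, d j ≠ 0 → MvPowerSeries.coeff d (PowerSeries.coeff n f) = 0)
    (d : ℕ →₀ ℕ) :
    MvPowerSeries.coeff d (ev j f) =
      MvPowerSeries.coeff (d.erase j) (PowerSeries.coeff (d j) f) := by
  classical
  rw [coeff_ev, evTrunc, map_sum, sum_eq_single (d j)]
  · have h := MvPowerSeries.coeff_add_mul_monomial (d.erase j) (Finsupp.single j (d j))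
      (PowerSeries.coeff (d j) f) (1 : k)
    rwa [Finsupp.erase_add_single, mul_one, ← MvPowerSeries.X_pow_eq] at h
  · intro n hn hne
    rw [MvPowerSeries.X_pow_eq, MvPowerSeries.coeff_mul_monomial]
    split_ifs with h
    · rw [mul_one]
      refine hf n _ ?_
      have := mem_range.1 hn
      simp only [Finsupp.coe_tsub, Pi.sub_apply, Finsupp.single_eq_same]
      omega
    · rfl
  · simp

theorem coeff_chain_eq_zero {m i : ℕ} (s : ℕ → ℕ) {d : ℕ →₀ ℕ} {j : ℕ} (hj : j ∉ Ico m (m + i))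
    (hd : d j ≠ 0) : MvPowerSeries.coeff d (chain q (fun _ => 1) m i s) = 0 := by
  induction i generalizing s d j with
  | zero =>
    classical
    rw [chain, MvPowerSeries.coeff_one, if_neg]
    rintro rfl
    exact hd rfl
  | succ i ih =>
    have hj' : j ∉ Ico m (m + i) := by
      rw [mem_Ico] at hj ⊢
      omega
    have hjm : j ≠ m + i := by
      rw [mem_Ico] at hj
      omega
    rw [chain, coeff_ev_of_free, kernSeries, PowerSeries.coeff_mk, map_sum]
    · refine sum_eq_zero fun r _ => ?_
      rw [map_smul, ih r hj' (by rwa [Finsupp.erase_ne hjm]), smul_zero]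
    · intro n d hd
      rw [kernSeries, PowerSeries.coeff_mk, map_sum]
      refine sum_eq_zero fun r _ => ?_
      rw [map_smul, ih r (by simp) hd, smul_zero]

/-- The product of the kernels linking consecutive sequences of a tuple. -/
noncomputable def chainWeight (q : k) (m : ℕ) (ρ : ℕ → ℕ → ℕ) : ℕ → (ℕ → ℕ) → k
  | 0, _ => 1
  | i + 1, s => kern q s (ρ (m + i)) * chainWeight q m ρ i (ρ (m + i))

theorem chainWeight_congr {m i : ℕ} {ρ ρ' : ℕ → ℕ → ℕ} (h : ∀ j ∈ Ico m (m + i), ρ j = ρ' j)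
    (s : ℕ → ℕ) : chainWeight q m ρ i s = chainWeight q m ρ' i s := by
  induction i generalizing s with
  | zero => rfl
  | succ i ih =>
    rw [chainWeight, chainWeight, h _ (mem_Ico.2 (by omega)),
      ih fun j hj => h j (by rw [mem_Ico] at hj ⊢; omega)]

theorem coeff_chain {m i : ℕ} (s e : ℕ → ℕ) {d : ℕ →₀ ℕ} (h1 : ∀ j ∈ Ico m (m + i), d j = e j)
    (h2 : ∀ j, j ∉ Ico m (m + i) → d j = 0) :
    MvPowerSeries.coeff d (chain q (fun _ => 1) m i s) =
      ∑ ρ ∈ tuples e m i, chainWeight q m ρ i s := by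
  induction i generalizing s d with
  | zero =>
    have : d = 0 := Finsupp.ext fun j => h2 j (by simp)
    simp [this, chain, tuples, chainWeight]
  | succ i ih =>
    rw [chain, coeff_ev_of_free, kernSeries, PowerSeries.coeff_mk, map_sum, sum_tuples_succ,
      h1 _ (mem_Ico.2 (by omega))]
    · refine sum_congr rfl fun r _ => ?_
      rw [map_smul, ih, smul_eq_mul, mul_sum]
      · refine sum_congr rfl fun ρ _ => ?_
        rw [chainWeight, Function.update_self]
        congr 1
        refine chainWeight_congr (fun j hj => ?_) r
        rw [mem_Ico] at hj
        rw [Function.update_of_ne (by omega)]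
      · intro j hj
        rw [mem_Ico] at hj
        rw [Finsupp.erase_ne (by omega), h1 j (mem_Ico.2 (by omega))]
      · intro j hj
        rcases eq_or_ne j (m + i) with rfl | hne
        · simp
        · rw [mem_Ico] at hj
          rw [Finsupp.erase_ne hne, h2 j (by rw [mem_Ico]; omega)]
    · intro n d hd
      rw [kernSeries, PowerSeries.coeff_mk, map_sum]
      refine sum_eq_zero fun r _ => ?_
      rw [map_smul, coeff_chain_eq_zero r (by simp) hd, smul_zero]

/-- The weight of a tuple of descending sequences in type `B`. -/
noncomputable def tupleWeight (q : k) (l : ℕ) (ρ : ℕ → ℕ → ℕ) : k :=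
  kern q 0 (ρ l) * chainWeight q 1 ρ (l - 1) (pairSum (ρ l))

theorem coeff_bSum {l : ℕ} (hl : 1 ≤ l) {d : ℕ →₀ ℕ} (hd : ∀ j, j ∉ Icc 1 l → d j = 0) :
    MvPowerSeries.coeff d (bSum q (fun _ => 1) 1 l) =
      ∑ ρ ∈ tuples d 1 l, tupleWeight q l ρ := by
  obtain ⟨n, rfl⟩ : ∃ n, l = n + 1 := ⟨l - 1, by omega⟩
  rw [bSum, coeff_ev_of_free, pairSeries, PowerSeries.coeff_mk, map_sum, sum_tuples_succ,
    add_comm 1 n, Nat.add_sub_cancel]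
  · refine sum_congr rfl fun r _ => ?_
    rw [map_smul, coeff_chain _ d, smul_eq_mul, mul_sum]
    · refine sum_congr rfl fun ρ _ => ?_
      rw [tupleWeight, Function.update_self, Nat.add_sub_cancel]
      congr 1
      refine chainWeight_congr (fun j hj => ?_) _
      rw [mem_Ico] at hj
      rw [Function.update_of_ne (by omega)]
    · intro j hj
      rw [mem_Ico] at hj
      rw [Finsupp.erase_ne (by omega)]
    · intro j hj
      rcases eq_or_ne j (n + 1) with rfl | hne
      · simp
      · rw [mem_Ico] at hj
        rw [Finsupp.erase_ne hne, hd j (by rw [mem_Icc]; omega)]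
  · intro i d hd
    rw [pairSeries, PowerSeries.coeff_mk, map_sum]
    refine sum_eq_zero fun r _ => ?_
    rw [map_smul, coeff_chain_eq_zero _ (by simp; omega) hd, smul_zero]

end Coefficients

section Exponent

/-- The truncated inner product of two sequences. -/
def innerN (N : ℕ) (a b : ℕ → ℕ) : ℤ := ∑ t ∈ range N, (a t : ℤ) * b t

/-- The quadratic form of type `B_l`. -/
def bForm (N l : ℕ) (ρ : ℕ → ℕ → ℕ) : ℤ :=
  ∑ i ∈ Icc 1 l, innerN N (ρ i) (ρ i) - ∑ i ∈ Icc 2 (l - 1), innerN N (ρ (i - 1)) (ρ i) -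
    innerN N (ρ (l - 1)) (pairSum (ρ l))

theorem sq_le_two_mul_aForm (x : ℕ → ℤ) (n : ℕ) :
    x (n + 1) ^ 2 ≤
      2 * (∑ i ∈ Icc 1 (n + 1), x i ^ 2 - ∑ i ∈ Icc 2 (n + 1), x (i - 1) * x i) := by
  induction n with
  | zero =>
    simp
    nlinarith [sq_nonneg (x 1)]
  | succ n ih =>
    rw [← insert_Icc_right_eq_Icc_add_one (by omega), sum_insert (by simp),
      ← insert_Icc_right_eq_Icc_add_one (a := 2) (by omega), sum_insert (by simp)]
    rw [Nat.add_sub_cancel]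
    nlinarith [sq_nonneg (x (n + 1) - x (n + 1 + 1))]

theorem bForm_nonneg {N l : ℕ} (hl : 2 ≤ l) {ρ : ℕ → ℕ → ℕ} (hN : ∀ t ≥ N, ρ l t = 0) :
    0 ≤ bForm N l ρ := by
  obtain ⟨n, rfl⟩ : ∃ n, l = n + 1 + 1 := ⟨l - 2, by omega⟩
  have hlast : innerN N (ρ (n + 1 + 1)) (ρ (n + 1 + 1)) =
      ∑ t ∈ range N, ((ρ (n + 1 + 1) (2 * t) : ℤ) ^ 2 + (ρ (n + 1 + 1) (2 * t + 1) : ℤ) ^ 2) := by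
    have h1 : innerN N (ρ (n + 1 + 1)) (ρ (n + 1 + 1)) =
        innerN (2 * N) (ρ (n + 1 + 1)) (ρ (n + 1 + 1)) := by
      refine sum_subset (range_subset_range.2 (by omega)) fun t _ ht => ?_
      rw [hN t (by simpa using ht)]
      simp
    rw [h1]
    clear hN h1
    induction N with
    | zero => simp [innerN]
    | succ N ih =>
      rw [innerN] at ih ⊢
      rw [show 2 * (N + 1) = 2 * N + 1 + 1 by ring, sum_range_succ, sum_range_succ, ih,
        sum_range_succ]
      ring
  rw [bForm, ← insert_Icc_right_eq_Icc_add_one (by omega), sum_insert (by simp), hlast]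
  simp only [innerN, pairSum]
  rw [sum_comm, sum_comm (s := Icc 2 _), ← sum_add_distrib, ← sum_sub_distrib, ← sum_sub_distrib]
  refine sum_nonneg fun t _ => ?_
  have h := sq_le_two_mul_aForm (fun i => (ρ i t : ℤ)) n
  simp only [sq (ρ _ t : ℤ)] at h
  simp only [show n + 1 + 1 - 1 = n + 1 from rfl]
  push_cast
  nlinarith [sq_nonneg ((ρ (n + 1) t : ℤ) - ρ (n + 1 + 1) (2 * t) - ρ (n + 1 + 1) (2 * t + 1)),
    sq_nonneg ((ρ (n + 1 + 1) (2 * t) : ℤ) - ρ (n + 1 + 1) (2 * t + 1))]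

variable {k : Type*} [Field k] {q : k}

/-- The product of the inverse Pochhammer symbols attached to a sequence. -/
def invPoch (q : k) (N : ℕ) (r : ℕ → ℕ) : k := ∏ t ∈ range N, (poch q (r t - r (t + 1)))⁻¹

theorem zpow_sum {ι : Type*} (hq : q ≠ 0) (S : Finset ι) (f : ι → ℤ) :
    q ^ ∑ i ∈ S, f i = ∏ i ∈ S, q ^ f i := by
  classical
  induction S using Finset.induction_on with
  | empty => simp
  | insert a S ha ih => rw [sum_insert ha, prod_insert ha, zpow_add₀ hq, ih]

theorem kern_eq_zpow (hq : q ≠ 0) {s r : ℕ → ℕ} {N : ℕ} (hN : ∀ t ≥ N, r t = 0) :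
    kern q s r = q ^ (innerN N r r - innerN N r s) * invPoch q N r := by
  rw [kern_eq_prod hN, innerN, innerN, ← sum_sub_distrib, zpow_sum hq, invPoch, ← prod_mul_distrib]
  refine prod_congr rfl fun t _ => ?_
  rw [kernFactor, div_eq_mul_inv, mul_sub]

theorem chainWeight_eq_zpow (hq : q ≠ 0) {ρ : ℕ → ℕ → ℕ} {N : ℕ} (hN : ∀ i, ∀ t ≥ N, ρ i t = 0)
    (n : ℕ) (s : ℕ → ℕ) :
    chainWeight q 1 ρ (n + 1) s =
      q ^ (∑ i ∈ Icc 1 (n + 1), innerN N (ρ i) (ρ i) -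
        ∑ i ∈ Icc 2 (n + 1), innerN N (ρ (i - 1)) (ρ i) - innerN N (ρ (n + 1)) s) *
          ∏ i ∈ Icc 1 (n + 1), invPoch q N (ρ i) := by
  induction n generalizing s with
  | zero => simp [chainWeight, kern_eq_zpow hq (hN _)]
  | succ n ih =>
    rw [chainWeight, show 1 + (n + 1) = n + 1 + 1 by ring, ih, kern_eq_zpow hq (hN _),
      ← insert_Icc_right_eq_Icc_add_one (b := n + 1) (by omega), sum_insert (by simp),
      prod_insert (by simp),
      ← insert_Icc_right_eq_Icc_add_one (a := 2) (b := n + 1) (by omega), sum_insert (by simp),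
      mul_mul_mul_comm, ← zpow_add₀ hq, Nat.add_sub_cancel]
    congr 2
    ring

theorem tupleWeight_eq_zpow (hq : q ≠ 0) {l : ℕ} (hl : 2 ≤ l) {ρ : ℕ → ℕ → ℕ} {N : ℕ}
    (hN : ∀ i, ∀ t ≥ N, ρ i t = 0) :
    tupleWeight q l ρ = q ^ bForm N l ρ * ∏ i ∈ Icc 1 l, invPoch q N (ρ i) := by
  obtain ⟨n, rfl⟩ : ∃ n, l = n + 1 + 1 := ⟨l - 2, by omega⟩
  have h0 : innerN N (ρ (n + 1 + 1)) 0 = 0 := by simp [innerN]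
  have h1 : n + 1 + 1 - 1 = n + 1 := rfl
  rw [tupleWeight, h1, chainWeight_eq_zpow hq hN,
    kern_eq_zpow hq (hN _), h0, bForm, h1,
    ← insert_Icc_right_eq_Icc_add_one (b := n + 1) (by omega),
    sum_insert (by simp), prod_insert (by simp), mul_mul_mul_comm, ← zpow_add₀ hq]
  congr 2
  ring

end Exponent

section Swap

variable {σ R : Type*} [CommRing R]

/-- The coefficientwise description of `swapHom`. -/
noncomputable def swapFun (f : PowerSeries (MvPowerSeries σ R)) : MvPowerSeries σ (PowerSeries R) :=
  fun d => PowerSeries.mk fun n => MvPowerSeries.coeff d (PowerSeries.coeff n f)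

theorem coeff_coeff_swapFun (f : PowerSeries (MvPowerSeries σ R)) (d : σ →₀ ℕ) (n : ℕ) :
    PowerSeries.coeff n (MvPowerSeries.coeff d (swapFun f)) =
      MvPowerSeries.coeff d (PowerSeries.coeff n f) := by
  have h : MvPowerSeries.coeff d (swapFun f) =
      PowerSeries.mk fun n => MvPowerSeries.coeff d (PowerSeries.coeff n f) := rfl
  rw [h, PowerSeries.coeff_mk]

/-- Exchanging the roles of one variable and of a family of variables in power series. -/
noncomputable def swapHom :
    PowerSeries (MvPowerSeries σ R) →+* MvPowerSeries σ (PowerSeries R) where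
  toFun := swapFun
  map_zero' := by
    ext d n
    simp [coeff_coeff_swapFun]
  map_one' := by
    classical
    ext d n
    rw [coeff_coeff_swapFun, PowerSeries.coeff_one, MvPowerSeries.coeff_one]
    split_ifs with h1 h2 h2 <;> simp [PowerSeries.coeff_one, MvPowerSeries.coeff_one, h1, h2]
  map_add' f g := by
    ext d n
    simp [coeff_coeff_swapFun]
  map_mul' f g := by
    classical
    ext d n
    rw [coeff_coeff_swapFun, PowerSeries.coeff_mul, map_sum, MvPowerSeries.coeff_mul, map_sum]
    simp only [MvPowerSeries.coeff_mul, PowerSeries.coeff_mul, coeff_coeff_swapFun]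
    rw [sum_comm]

theorem coeff_coeff_swapHom (f : PowerSeries (MvPowerSeries σ R)) (d : σ →₀ ℕ) (n : ℕ) :
    PowerSeries.coeff n (MvPowerSeries.coeff d (swapHom f)) =
      MvPowerSeries.coeff d (PowerSeries.coeff n f) := coeff_coeff_swapFun f d n

theorem swapHom_X : swapHom (PowerSeries.X : PowerSeries (MvPowerSeries σ R)) =
    MvPowerSeries.C PowerSeries.X := by
  classical
  ext d n
  rw [coeff_coeff_swapHom, PowerSeries.coeff_X, MvPowerSeries.coeff_C]
  split_ifs with h1 h2 h2 <;> simp [PowerSeries.coeff_X, MvPowerSeries.coeff_one, h1, h2]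

theorem swapHom_C_X (i : σ) : swapHom (PowerSeries.C (MvPowerSeries.X i : MvPowerSeries σ R)) =
    MvPowerSeries.X i := by
  classical
  ext d n
  rw [coeff_coeff_swapHom, PowerSeries.coeff_C, MvPowerSeries.coeff_X]
  split_ifs with h1 h2 h2 <;> simp [PowerSeries.coeff_one, MvPowerSeries.coeff_X, h1, h2]

end Swap

section Embedding

/-- The variable `0` becomes the distinguished one, the other variables keep their names. -/
def varEmb (l : ℕ) : Fin (l + 1) ↪ Option ℕ where
  toFun i := if (i : ℕ) = 0 then none else some i
  inj' i j h := by
    dsimp only at h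
    split_ifs at h with h1 h2 h2
    · exact Fin.ext (h1.trans h2.symm)
    · exact Fin.ext (Option.some.inj h)

/-- Power series in `q, y_1, …, y_l` as power series in the `y_i` over `ℤ⟦q⟧`. -/
noncomputable def toIter (l : ℕ) :
    MvPowerSeries (Fin (l + 1)) ℤ →+* MvPowerSeries ℕ (PowerSeries ℤ) :=
  swapHom.comp ((MvPowerSeries.optionEquivLeft ℕ ℤ).toRingEquiv.toRingHom.comp
    (MvPowerSeries.rename (varEmb l)).toRingHom)

theorem coeff_coeff_toIter (l : ℕ) (f : MvPowerSeries (Fin (l + 1)) ℤ) (d : ℕ →₀ ℕ) (n : ℕ) :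
    PowerSeries.coeff n (MvPowerSeries.coeff d (toIter l f)) =
      MvPowerSeries.coeff (d.optionElim n) (MvPowerSeries.rename (varEmb l) f) := by
  rw [toIter, RingHom.comp_apply, coeff_coeff_swapHom]
  exact MvPowerSeries.coeff_coeff_optionEquivLeft _ _ _

theorem exists_coeff_eq_coeff_toIter {l : ℕ} (x : Fin (l + 1) →₀ ℕ) :
    ∃ (d : ℕ →₀ ℕ) (n : ℕ), (∀ j, j ∉ Icc 1 l → d j = 0) ∧
      ∀ f : MvPowerSeries (Fin (l + 1)) ℤ, MvPowerSeries.coeff x f =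
        PowerSeries.coeff n (MvPowerSeries.coeff d (toIter l f)) := by
  refine ⟨(Finsupp.embDomain (varEmb l) x).some, Finsupp.embDomain (varEmb l) x none, ?_, ?_⟩
  · intro j hj
    rw [Finsupp.some_apply, Finsupp.embDomain_of_notMem_range]
    rintro ⟨i, hi⟩
    have h : (if (i : ℕ) = 0 then none else some (i : ℕ)) = some j := hi
    split_ifs at h with h1
    have := Option.some.inj h
    exact hj (mem_Icc.2 (by have := i.2; omega))
  · intro f
    rw [coeff_coeff_toIter, ← MvPowerSeries.coeff_embDomain_rename (varEmb l) f x]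
    congr 2
    ext a
    cases a <;> simp

end Embedding

section Convergence

variable {σ : Type*}

theorem tendsto_of_eventually_coeff_eq {ι : Type*} {F : Filter ι} {u : ι → MvPowerSeries σ ℤ}
    {f : MvPowerSeries σ ℤ}
    (h : ∀ d, ∀ᶠ i in F, MvPowerSeries.coeff d (u i) = MvPowerSeries.coeff d f) :
    Filter.Tendsto u F (nhds f) :=
  (tendsto_pi_nhds (A := fun _ : σ →₀ ℕ => ℤ) (f := u) (g := f)).2 fun d =>
    tendsto_nhds_of_eventually_eq (h d)

theorem t2Space_mvPowerSeries_int : T2Space (MvPowerSeries σ ℤ) :=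
  inferInstanceAs (T2Space ((σ →₀ ℕ) → ℤ))

theorem coeff_eq_of_X_pow_dvd_sub {R : Type*} [CommRing R] {j : σ} {N : ℕ}
    {f g : MvPowerSeries σ R} (h : MvPowerSeries.X j ^ N ∣ f - g) {d : σ →₀ ℕ} (hd : d j < N) :
    MvPowerSeries.coeff d f = MvPowerSeries.coeff d g := by
  rw [← sub_eq_zero, ← map_sub]
  exact MvPowerSeries.X_pow_dvd_iff.1 h d hd

theorem X_pow_dvd_prod_sub_prod {j : σ} {u : ℕ → MvPowerSeries σ ℤ}
    (hu : ∀ n, MvPowerSeries.X j ^ (n + 1) ∣ u n - 1) {N : ℕ} {s : Finset ℕ} (hs : range N ⊆ s) :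
    MvPowerSeries.X j ^ N ∣ ∏ n ∈ s, u n - ∏ n ∈ range N, u n := by
  have h : MvPowerSeries.X j ^ N ∣ ∏ n ∈ s \ range N, u n - 1 := by
    refine prod_induction _ (fun x => MvPowerSeries.X j ^ N ∣ x - 1) (fun a b ha hb => ?_)
      (by simp) fun n hn => ?_
    · rw [show a * b - 1 = (a - 1) * b + (b - 1) by ring]
      exact dvd_add (ha.mul_right _) hb
    · have : N ≤ n := by simpa using (mem_sdiff.1 hn).2
      exact (pow_dvd_pow _ (by omega)).trans (hu n)
  rw [← prod_sdiff hs, ← sub_one_mul]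
  exact h.mul_right _

/-- An infinite product whose factors tend to `1` in the `X j`-adic topology converges. -/
theorem exists_hasProd_of_X_pow_dvd {j : σ} {u : ℕ → MvPowerSeries σ ℤ}
    (hu : ∀ n, MvPowerSeries.X j ^ (n + 1) ∣ u n - 1) :
    ∃ f, HasProd u f ∧ ∀ N, MvPowerSeries.X j ^ N ∣ f - ∏ n ∈ range N, u n := by
  let f : MvPowerSeries σ ℤ := fun d => MvPowerSeries.coeff d (∏ n ∈ range (d j + 1), u n)
  have hf : ∀ d, MvPowerSeries.coeff d f =
    MvPowerSeries.coeff d (∏ n ∈ range (d j + 1), u n) := fun d => rfl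
  refine ⟨f, ?_, fun N => ?_⟩
  · refine tendsto_of_eventually_coeff_eq fun d => ?_
    rw [SummationFilter.unconditional_filter]
    filter_upwards [Filter.eventually_ge_atTop (range (d j + 1))] with s hs
    rw [hf]
    exact coeff_eq_of_X_pow_dvd_sub (X_pow_dvd_prod_sub_prod hu hs) (Nat.lt_succ_self _)
  · refine MvPowerSeries.X_pow_dvd_iff.2 fun d hd => ?_
    rw [map_sub, hf, sub_eq_zero]
    exact (coeff_eq_of_X_pow_dvd_sub
      (X_pow_dvd_prod_sub_prod hu (range_subset_range.2 hd)) (Nat.lt_succ_self _)).symm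

end Convergence

section Variables

theorem toIter_Q (l : ℕ) : toIter l (Q l) = MvPowerSeries.C PowerSeries.X := by
  rw [← swapHom_X, toIter, Q, RingHom.comp_apply, RingHom.comp_apply]
  congr 1
  change MvPowerSeries.optionEquivLeft ℕ ℤ (MvPowerSeries.rename (varEmb l) (MvPowerSeries.X 0)) = _
  rw [MvPowerSeries.rename_X]
  exact MvPowerSeries.optionEquivLeft_X_none ..

theorem toIter_Y {l i : ℕ} (hi : i ∈ Icc 1 l) : toIter l (Y l i) = MvPowerSeries.X i := by
  obtain ⟨h1, h2⟩ := mem_Icc.1 hi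
  rw [← swapHom_C_X, toIter, Y, dif_pos (by omega), RingHom.comp_apply, RingHom.comp_apply]
  congr 1
  change MvPowerSeries.optionEquivLeft ℕ ℤ (MvPowerSeries.rename (varEmb l) (MvPowerSeries.X _)) = _
  rw [MvPowerSeries.rename_X, show varEmb l ⟨i, by omega⟩ = some i from if_neg (by simp; omega)]
  exact MvPowerSeries.optionEquivLeft_X_some ..

theorem toIter_prod_Y (l : ℕ) (c : ℕ → ℕ) :
    toIter l (∏ s ∈ Icc 1 l, Y l s ^ c s) = yMon (PowerSeries ℤ) l c := by
  rw [map_prod, yMon]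
  exact prod_congr rfl fun s hs => by rw [map_pow, toIter_Y hs]

theorem isUnit_one_sub_Q_mul (l n : ℕ) (a : MvPowerSeries (Fin (l + 1)) ℤ) :
    IsUnit (1 - Q l ^ (n + 1) * a) := by
  rw [MvPowerSeries.isUnit_iff_constantCoeff]
  simp [Q]

theorem X_pow_dvd_inverse_sub_one (l n : ℕ) (a : MvPowerSeries (Fin (l + 1)) ℤ) :
    MvPowerSeries.X 0 ^ (n + 1) ∣ Ring.inverse (1 - Q l ^ (n + 1) * a) - 1 := by
  have h := Ring.inverse_mul_cancel _ (isUnit_one_sub_Q_mul l n a)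
  refine ⟨Ring.inverse (1 - Q l ^ (n + 1) * a) * a, ?_⟩
  rw [show (MvPowerSeries.X 0 : MvPowerSeries (Fin (l + 1)) ℤ) = Q l from rfl]
  linear_combination h

theorem eq_zero_of_forall_C_X_pow_dvd {τ : Type*} {f : MvPowerSeries τ (PowerSeries ℤ)}
    (h : ∀ N, MvPowerSeries.C (PowerSeries.X ^ N) ∣ f) : f = 0 := by
  ext d n
  obtain ⟨g, hg⟩ := h (n + 1)
  rw [hg, MvPowerSeries.coeff_C_mul, map_zero, map_zero]
  exact PowerSeries.X_pow_dvd_iff.1 (dvd_mul_right _ _) n (Nat.lt_succ_self n)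

end Variables

section RootFactor

variable {l : ℕ}

/-- The partial products of the factor attached to `c`. -/
noncomputable def partialFactor (l : ℕ) (c : ℕ → ℕ) (N : ℕ) : MvPowerSeries (Fin (l + 1)) ℤ :=
  ∏ n ∈ range N, Ring.inverse (1 - Q l ^ (n + 1) * ∏ s ∈ Icc 1 l, Y l s ^ c s)

/-- The denominators of the partial products, over `ℤ⟦q⟧`. -/
noncomputable def denom (l : ℕ) (c : ℕ → ℕ) (N : ℕ) : MvPowerSeries ℕ (PowerSeries ℤ) :=
  ∏ n ∈ range N, (1 - MvPowerSeries.C (PowerSeries.X ^ (n + 1)) * yMon (PowerSeries ℤ) l c)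

theorem denom_mul_toIter_partialFactor (c : ℕ → ℕ) (N : ℕ) :
    denom l c N * toIter l (partialFactor l c N) = 1 := by
  rw [denom, partialFactor, map_prod, ← prod_mul_distrib]
  refine prod_eq_one fun n _ => ?_
  have h := congrArg (toIter l)
    (Ring.mul_inverse_cancel _ (isUnit_one_sub_Q_mul l n (∏ s ∈ Icc 1 l, Y l s ^ c s)))
  rwa [map_mul, map_sub, map_mul, map_pow, toIter_Q, toIter_prod_Y, map_one, ← map_pow] at h

theorem resc_denom {m : ℕ} (hm : m ∈ Icc 1 l) {c : ℕ → ℕ} (hc : c m = 1) (N : ℕ) :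
    denom l c (N + 1) = (1 - MvPowerSeries.C PowerSeries.X * yMon (PowerSeries ℤ) l c) *
      resc m PowerSeries.X (denom l c N) := by
  rw [denom, prod_range_succ', denom, map_prod, mul_comm]
  congr 1
  · simp
  · refine prod_congr rfl fun n _ => ?_
    rw [map_sub, map_one, map_mul, resc_C, resc_yMon hm, hc, pow_one, ← mul_assoc, ← map_mul,
      ← pow_succ]

theorem resc_zero_denom {m : ℕ} (hm : m ∈ Icc 1 l) {c : ℕ → ℕ} (hc : c m = 1) (N : ℕ) :
    resc m 0 (denom l c N) = 1 := by
  rw [denom, map_prod]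
  refine prod_eq_one fun n _ => ?_
  rw [map_sub, map_one, map_mul, resc_yMon hm, hc]
  simp

theorem mul_toIter_partialFactor {m : ℕ} (hm : m ∈ Icc 1 l) {c : ℕ → ℕ} (hc : c m = 1) (N : ℕ) :
    (1 - MvPowerSeries.C PowerSeries.X * yMon (PowerSeries ℤ) l c) *
        toIter l (partialFactor l c (N + 1)) =
      resc m PowerSeries.X (toIter l (partialFactor l c N)) := by
  have h1 := denom_mul_toIter_partialFactor (l := l) c (N + 1)
  have h2 := congrArg (resc m PowerSeries.X) (denom_mul_toIter_partialFactor (l := l) c N)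
  rw [resc_denom hm hc] at h1
  rw [map_mul, map_one] at h2
  linear_combination resc m PowerSeries.X (toIter l (partialFactor l c N)) * h1 -
    (1 - MvPowerSeries.C PowerSeries.X * yMon (PowerSeries ℤ) l c) *
        toIter l (partialFactor l c (N + 1)) * h2

theorem resc_zero_toIter_partialFactor {m : ℕ} (hm : m ∈ Icc 1 l) {c : ℕ → ℕ} (hc : c m = 1)
    (N : ℕ) : resc m 0 (toIter l (partialFactor l c N)) = 1 := by
  have h2 := congrArg (resc m 0) (denom_mul_toIter_partialFactor (l := l) c N)
  rwa [map_mul, map_one, resc_zero_denom hm hc, one_mul] at h2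

/-- The factor attached to `c` converges, and it satisfies a `q`-difference equation in every
variable that occurs in it linearly. -/
theorem exists_hasProd_factor (l : ℕ) (c : ℕ → ℕ) :
    ∃ f, HasProd (fun n : ℕ => Ring.inverse (1 - Q l ^ (n + 1) * ∏ s ∈ Icc 1 l, Y l s ^ c s)) f ∧
      ∀ m ∈ Icc 1 l, c m = 1 →
        (1 - MvPowerSeries.C PowerSeries.X * yMon (PowerSeries ℤ) l c) * toIter l f =
          resc m PowerSeries.X (toIter l f) ∧ resc m 0 (toIter l f) = 1 := by
  obtain ⟨f, hf, hd⟩ := exists_hasProd_of_X_pow_dvd (fun n =>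
    X_pow_dvd_inverse_sub_one l n (∏ s ∈ Icc 1 l, Y l s ^ c s))
  refine ⟨f, hf, fun m hm hc => ?_⟩
  have hd' : ∀ N, MvPowerSeries.C (PowerSeries.X ^ N) ∣
      toIter l f - toIter l (partialFactor l c N) := fun N => by
    have := map_dvd (toIter l) (hd N)
    rwa [map_sub, map_pow, show (MvPowerSeries.X 0 : MvPowerSeries (Fin (l + 1)) ℤ) = Q l from rfl,
      toIter_Q, ← map_pow] at this
  have hr : ∀ (a : PowerSeries ℤ) N, MvPowerSeries.C (PowerSeries.X ^ N) ∣
      resc m a (toIter l f) - resc m a (toIter l (partialFactor l c N)) := fun a N => by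
    have := map_dvd (resc m a) (hd' N)
    rwa [map_sub, resc_C] at this
  constructor
  · refine sub_eq_zero.1 (eq_zero_of_forall_C_X_pow_dvd fun N => ?_)
    have h1 : MvPowerSeries.C (PowerSeries.X ^ N) ∣
        toIter l f - toIter l (partialFactor l c (N + 1)) :=
      (map_dvd _ (pow_dvd_pow _ (Nat.le_succ N))).trans (hd' (N + 1))
    have h := dvd_sub (h1.mul_left
      (1 - MvPowerSeries.C PowerSeries.X * yMon (PowerSeries ℤ) l c)) (hr PowerSeries.X N)
    rwa [mul_sub, mul_toIter_partialFactor hm hc, sub_sub_sub_cancel_right] at h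
  · refine sub_eq_zero.1 (eq_zero_of_forall_C_X_pow_dvd fun N => ?_)
    have h := hr 0 N
    rwa [resc_zero_toIter_partialFactor hm hc] at h

end RootFactor

section Field

/-- The variable `q` as an element of the fraction field of `ℤ⟦q⟧`. -/
noncomputable def qFrac : FractionRing (PowerSeries ℤ) :=
  algebraMap (PowerSeries ℤ) (FractionRing (PowerSeries ℤ)) PowerSeries.X

theorem algebraMap_fractionRing_injective :
    Function.Injective (algebraMap (PowerSeries ℤ) (FractionRing (PowerSeries ℤ))) :=
  IsFractionRing.injective _ _

theorem qFrac_ne_zero : qFrac ≠ 0 := by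
  rw [qFrac, Ne, map_eq_zero_iff _ algebraMap_fractionRing_injective]
  exact PowerSeries.X_ne_zero

theorem qFrac_pow_ne_one (n : ℕ) : qFrac ^ (n + 1) ≠ 1 := by
  intro h
  rw [qFrac, ← map_pow, map_eq_one_iff _ algebraMap_fractionRing_injective] at h
  simpa using congrArg PowerSeries.constantCoeff h

/-- Power series in `q, y_1, …, y_l` as power series in the `y_i` over the fraction field
of `ℤ⟦q⟧`. -/
noncomputable def toField (l : ℕ) :
    MvPowerSeries (Fin (l + 1)) ℤ →+* MvPowerSeries ℕ (FractionRing (PowerSeries ℤ)) :=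
  (MvPowerSeries.map (algebraMap (PowerSeries ℤ) (FractionRing (PowerSeries ℤ)))).comp (toIter l)

theorem toField_apply (l : ℕ) (f : MvPowerSeries (Fin (l + 1)) ℤ) :
    toField l f =
      MvPowerSeries.map (algebraMap (PowerSeries ℤ) (FractionRing (PowerSeries ℤ))) (toIter l f) :=
  rfl

theorem toField_Q (l : ℕ) : toField l (Q l) = MvPowerSeries.C qFrac := by
  rw [toField_apply, toIter_Q, MvPowerSeries.map_C, qFrac]

theorem toField_Y {l i : ℕ} (hi : i ∈ Icc 1 l) : toField l (Y l i) = MvPowerSeries.X i := by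
  rw [toField_apply, toIter_Y hi, MvPowerSeries.map_X]

theorem toField_prod_Y (l : ℕ) (c : ℕ → ℕ) : toField l (∏ s ∈ Icc 1 l, Y l s ^ c s) =
    yMon (FractionRing (PowerSeries ℤ)) l c := by
  rw [map_prod, yMon]
  exact prod_congr rfl fun s hs => by rw [map_pow, toField_Y hs]

theorem exists_coeff_eq_of_coeff_toField_eq {l : ℕ} (x : Fin (l + 1) →₀ ℕ) :
    ∃ d : ℕ →₀ ℕ, (∀ j, j ∉ Icc 1 l → d j = 0) ∧
      ∀ f g : MvPowerSeries (Fin (l + 1)) ℤ, MvPowerSeries.coeff d (toField l f) =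
        MvPowerSeries.coeff d (toField l g) →
          MvPowerSeries.coeff x f = MvPowerSeries.coeff x g := by
  obtain ⟨d, n, hd, h⟩ := exists_coeff_eq_coeff_toIter x
  refine ⟨d, hd, fun f g hfg => ?_⟩
  rw [toField_apply, toField_apply, MvPowerSeries.coeff_map, MvPowerSeries.coeff_map] at hfg
  rw [h, h, algebraMap_fractionRing_injective hfg]

theorem map_resc {R S : Type*} [CommRing R] [CommRing S] (φ : R →+* S) (m : ℕ) (a : R)
    (f : MvPowerSeries ℕ R) :
    MvPowerSeries.map φ (resc m a f) = resc m (φ a) (MvPowerSeries.map φ f) := by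
  ext d
  simp [coeff_resc]

theorem map_yMon {R S : Type*} [CommRing R] [CommRing S] (φ : R →+* S) (l : ℕ) (c : ℕ → ℕ) :
    MvPowerSeries.map φ (yMon R l c) = yMon S l c := by
  simp [yMon, map_prod]

/-- The factors of the product side converge, and the product is the type `B_l` sum. -/
theorem exists_hasProd_bSum_eq {l : ℕ} (hl : 1 ≤ l) :
    ∃ f : (ℕ → ℕ) → MvPowerSeries (Fin (l + 1)) ℤ,
      (∀ c, HasProd (fun n : ℕ =>
        Ring.inverse (1 - Q l ^ (n + 1) * ∏ s ∈ Icc 1 l, Y l s ^ c s)) (f c)) ∧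
      bSum qFrac (fun _ => 1) 1 l = toField l (∏ c ∈ posRoots l, f c) := by
  choose f hf h using exists_hasProd_factor l
  refine ⟨f, hf, ?_⟩
  rw [map_prod]
  refine bSum_eq_prod qFrac_ne_zero qFrac_pow_ne_one hl (fun m hm c hc => ?_) fun m hm c hc => ?_
  · have := congrArg (MvPowerSeries.map
      (algebraMap (PowerSeries ℤ) (FractionRing (PowerSeries ℤ)))) (h c m hm hc).1
    rwa [map_resc, map_mul, map_sub, map_one, map_mul, MvPowerSeries.map_C, map_yMon] at this
  · have := congrArg (MvPowerSeries.map
      (algebraMap (PowerSeries ℤ) (FractionRing (PowerSeries ℤ)))) (h c m hm hc).2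
    rwa [map_resc, map_zero, map_one] at this

theorem toField_inverse_qPoch (l m : ℕ) :
    toField l (Ring.inverse (qPoch l m)) = MvPowerSeries.C (poch qFrac m)⁻¹ := by
  have hu : IsUnit (qPoch l m) := by
    rw [MvPowerSeries.isUnit_iff_constantCoeff]
    simp [qPoch, Q, map_prod]
  have h1 : toField l (qPoch l m) = MvPowerSeries.C (poch qFrac m) := by
    simp [qPoch, poch, map_prod, toField_Q]
  have h2 := congrArg (toField l) (Ring.mul_inverse_cancel _ hu)
  rw [map_mul, map_one, h1] at h2
  have h3 : MvPowerSeries.C (σ := ℕ) (poch qFrac m)⁻¹ * MvPowerSeries.C (poch qFrac m) = 1 := by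
    rw [← map_mul, inv_mul_cancel₀ (poch_ne_zero qFrac_pow_ne_one m), map_one]
  linear_combination MvPowerSeries.C (poch qFrac m)⁻¹ * h2 -
    toField l (Ring.inverse (qPoch l m)) * h3

theorem toField_finprod_inverse_qPoch (l : ℕ) {r : ℕ → ℕ} {N : ℕ} (hN : ∀ t ≥ N, r t = 0) :
    toField l (∏ᶠ j : ℕ, Ring.inverse (qPoch l (r j - r (j + 1)))) =
      MvPowerSeries.C (invPoch qFrac N r) := by
  rw [finprod_eq_prod_of_mulSupport_subset (s := range N), map_prod, invPoch, map_prod]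
  · exact prod_congr rfl fun t _ => toField_inverse_qPoch l _
  · intro t ht
    by_contra h
    refine ht ?_
    dsimp only
    rw [hN t (by simpa using h), Nat.zero_sub]
    simp [qPoch]

theorem coeff_yMon {k : Type*} [CommRing k] {l : ℕ} (c : ℕ → ℕ) {d : ℕ →₀ ℕ}
    (hd : ∀ j, j ∉ Icc 1 l → d j = 0) [Decidable (∀ i ∈ Icc 1 l, c i = d i)] :
    MvPowerSeries.coeff d (yMon k l c) = if ∀ i ∈ Icc 1 l, c i = d i then 1 else 0 := by
  classical
  have h : yMon k l c = MvPowerSeries.monomial (∑ s ∈ Icc 1 l, Finsupp.single s (c s)) 1 := by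
    rw [yMon]
    induction Icc 1 l using Finset.induction_on with
    | empty => simp
    | insert a s ha ih =>
      rw [prod_insert ha, sum_insert ha, ih, MvPowerSeries.X_pow_eq,
        MvPowerSeries.monomial_mul_monomial, one_mul]
  rw [h, MvPowerSeries.coeff_monomial]
  refine if_congr ?_ rfl rfl
  rw [DFunLike.ext_iff]
  have hs : ∀ i, (∑ s ∈ Icc 1 l, Finsupp.single s (c s)) i = if i ∈ Icc 1 l then c i else 0 := by
    intro i
    rw [Finsupp.finsetSum_apply]
    simp [Finsupp.single_apply]
  simp only [hs]
  constructor
  · intro h i hi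
    rw [h i, if_pos hi]
  · intro h i
    split_ifs with hi
    · exact (h i hi).symm
    · exact hd i hi

end Field

section Sum

theorem finsum_eq_innerN {a b : ℕ → ℕ} {N : ℕ} (ha : ∀ t ≥ N, a t = 0) :
    ∑ᶠ t : ℕ, (a t : ℤ) * (b t : ℤ) = innerN N a b :=
  finsum_eq_sum_of_support_subset _ fun t ht => by
    by_contra h
    exact ht (by simp [ha t (by simpa using h)])

theorem exists_uniform_bound {l : ℕ} {r : ℕ → ℕ → ℕ} (h : ∀ i, IsDescending (r i))
    (h0 : ∀ i, i ∉ Icc 1 l → r i = 0) : ∃ N, ∀ i, ∀ t ≥ N, r i t = 0 := by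
  choose N hN using fun i => (h i).2
  refine ⟨(Icc 1 l).sup N, fun i t ht => ?_⟩
  by_cases hi : i ∈ Icc 1 l
  · exact hN i t ((le_sup hi).trans ht)
  · rw [h0 i hi, Pi.zero_apply]

theorem mem_tuples_iff_sz {l : ℕ} {r : ℕ → ℕ → ℕ} {d : ℕ →₀ ℕ} :
    r ∈ tuples d 1 l ↔ ((∀ i, IsDescending (r i)) ∧ ∀ i, i ∉ Icc 1 l → r i = 0) ∧
      ∀ i ∈ Icc 1 l, sz (r i) = d i := by
  have hI : ∀ i, i ∈ Ico 1 (1 + l) ↔ i ∈ Icc 1 l := fun i => by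
    rw [mem_Ico, mem_Icc]; omega
  rw [mem_tuples]
  simp only [hI, mem_desc]
  constructor
  · rintro ⟨h1, h2⟩
    refine ⟨⟨fun i => ?_, h2⟩, fun i hi => sz_of_mem_desc (mem_desc.2 (h1 i hi))⟩
    by_cases hi : i ∈ Icc 1 l
    · obtain ⟨ha, N, hN, -⟩ := h1 i hi
      exact ⟨ha, N, hN⟩
    · rw [h2 i hi]
      exact ⟨fun _ _ _ => le_rfl, 0, fun _ _ => rfl⟩
  · rintro ⟨⟨h1, h2⟩, h3⟩
    refine ⟨fun i hi => ?_, h2⟩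
    obtain ⟨ha, N, hN⟩ := h1 i
    exact ⟨ha, N, hN, by rw [← sz_eq_sum hN, h3 i hi]⟩

end Sum

section Main

theorem E_eq_bForm {l N : ℕ} {E : (ℕ → ℕ → ℕ) → ℤ}
    (hE : ∀ r : ℕ → ℕ → ℕ, E r =
      (∑ i ∈ Icc 1 l, ∑ᶠ t : ℕ, (r i t : ℤ) ^ 2)
        - (∑ i ∈ Icc 2 (l - 1), ∑ᶠ t : ℕ, (r (i - 1) t : ℤ) * (r i t : ℤ))
        - ∑ᶠ t : ℕ, (r (l - 1) t : ℤ) * ((r l (2 * t) : ℤ) + (r l (2 * t + 1) : ℤ)))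
    {r : ℕ → ℕ → ℕ} (hN : ∀ i, ∀ t ≥ N, r i t = 0) : E r = bForm N l r := by
  rw [hE, bForm]
  simp only [sq, ← Nat.cast_add (R := ℤ)]
  rw [← finsum_eq_innerN (b := pairSum (r l)) (hN (l - 1))]
  simp only [finsum_eq_innerN (hN _)]
  rfl

theorem coeff_toField_summand {l : ℕ} (hl : 2 ≤ l) {r : ℕ → ℕ → ℕ} {N : ℕ}
    (hN : ∀ i, ∀ t ≥ N, r i t = 0) {d : ℕ →₀ ℕ} (hd : ∀ j, j ∉ Icc 1 l → d j = 0)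
    [Decidable (∀ i ∈ Icc 1 l, sz (r i) = d i)] :
    MvPowerSeries.coeff d (toField l (Q l ^ (bForm N l r).toNat
        * (∏ i ∈ Icc 1 l, Y l i ^ (∑ᶠ t : ℕ, r i t))
        * ∏ i ∈ Icc 1 l, ∏ᶠ j : ℕ, Ring.inverse (qPoch l (r i j - r i (j + 1))))) =
      if ∀ i ∈ Icc 1 l, sz (r i) = d i then tupleWeight qFrac l r else 0 := by
  have hz : qFrac ^ (bForm N l r).toNat = qFrac ^ bForm N l r := by
    rw [← zpow_natCast, Int.toNat_of_nonneg (bForm_nonneg hl (hN l))]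
  have hY : toField l (∏ i ∈ Icc 1 l, Y l i ^ ∑ᶠ t : ℕ, r i t) =
    yMon (FractionRing (PowerSeries ℤ)) l fun i => sz (r i) := toField_prod_Y l fun i => sz (r i)
  rw [map_mul (toField l), map_mul (toField l), map_pow, toField_Q, hY, map_prod,
    prod_congr rfl fun i _ => toField_finprod_inverse_qPoch l (hN i), ← map_pow, ← map_prod,
    mul_right_comm, ← map_mul, MvPowerSeries.coeff_C_mul, coeff_yMon _ hd, hz,
    ← tupleWeight_eq_zpow qFrac_ne_zero hl hN, mul_ite, mul_one, mul_zero]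

end Main

/-- The identity of Theorem 7.3 in type `B_l` (`l ≥ 2`).
Positive roots (in simple-root coordinates, vectors `c : ℕ → ℕ` supported on `1 ≤ s ≤ l`,
with `α_l` the short simple root): `αᵢ + ⋯ + α_j` for `1 ≤ i ≤ j ≤ l-1`;
`αᵢ + ⋯ + α_l` for `1 ≤ i ≤ l`; and
`αᵢ + ⋯ + α_{j-1} + 2(α_j + ⋯ + α_l)` for `1 ≤ i < j ≤ l`.  Then in `ℤ[[q, y₁, …, y_l]]`:
`∏_{c ∈ Φ⁺} ∏_{n ≥ 1} (1 - qⁿ y^c)⁻¹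
  = ∑_{(r₁,…,r_l) descending} q^{E r} (∏ᵢ yᵢ^{|rᵢ|}) ∏ᵢ ∏_{j ≥ 1} (q;q)_{rᵢ^{(j)}-rᵢ^{(j+1)}}⁻¹`,
with `E r = ∑_{i=1}^{l} ∑_{t≥1} (rᵢ^{(t)})² - ∑_{i=2}^{l-1} ∑_{t≥1} r_{i-1}^{(t)} rᵢ^{(t)}
 - ∑_{t≥1} r_{l-1}^{(t)} (r_l^{(2t-1)} + r_l^{(2t)})`, a nonnegative integer. -/
theorem stmt_6 (l : ℕ) (hl : 2 ≤ l)
    (Φ : Finset (ℕ → ℕ))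
    (hΦ : ∀ c : ℕ → ℕ, c ∈ Φ ↔
      ((∃ i j, 1 ≤ i ∧ i ≤ j ∧ j ≤ l - 1 ∧
          c = fun s => if i ≤ s ∧ s ≤ j then 1 else 0)
        ∨ (∃ i, 1 ≤ i ∧ i ≤ l ∧
          c = fun s => if i ≤ s ∧ s ≤ l then 1 else 0)
        ∨ (∃ i j, 1 ≤ i ∧ i < j ∧ j ≤ l ∧
          c = fun s => (if i ≤ s ∧ s ≤ j - 1 then 1 else 0)
            + (if j ≤ s ∧ s ≤ l then 2 else 0))))
    (E : (ℕ → ℕ → ℕ) → ℤ)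
    (hE : ∀ r : ℕ → ℕ → ℕ, E r =
      (∑ i ∈ Finset.Icc 1 l, ∑ᶠ t : ℕ, (r i t : ℤ) ^ 2)
        - (∑ i ∈ Finset.Icc 2 (l - 1), ∑ᶠ t : ℕ, (r (i - 1) t : ℤ) * (r i t : ℤ))
        - ∑ᶠ t : ℕ, (r (l - 1) t : ℤ) * ((r l (2 * t) : ℤ) + (r l (2 * t + 1) : ℤ))) :
    (∀ r : ℕ → ℕ → ℕ,
        (∀ i, IsDescending (r i)) → (∀ i, i ∉ Finset.Icc 1 l → r i = 0) → 0 ≤ E r)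
    ∧ (∏ c ∈ Φ, ∏' n : ℕ,
          Ring.inverse (1 - Q l ^ (n + 1) * ∏ s ∈ Finset.Icc 1 l, Y l s ^ c s))
      = ∑' r : {r : ℕ → ℕ → ℕ //
            (∀ i, IsDescending (r i)) ∧ ∀ i, i ∉ Finset.Icc 1 l → r i = 0},
          Q l ^ (E r.1).toNat
            * (∏ i ∈ Finset.Icc 1 l, Y l i ^ (∑ᶠ t : ℕ, r.1 i t))
            * ∏ i ∈ Finset.Icc 1 l, ∏ᶠ j : ℕ,
                Ring.inverse (qPoch l (r.1 i j - r.1 i (j + 1))) := by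
  refine ⟨fun r h h0 => ?_, ?_⟩
  · obtain ⟨N, hN⟩ := exists_uniform_bound h h0
    rw [E_eq_bForm hE hN]
    exact bForm_nonneg hl (hN l)
  obtain ⟨f, hf, hb⟩ := exists_hasProd_bSum_eq (l := l) (by omega)
  have : T2Space (MvPowerSeries (Fin (l + 1)) ℤ) := t2Space_mvPowerSeries_int
  have hroots : Φ = posRoots l := by
    ext c
    rw [hΦ, mem_posRoots (by omega)]
    rfl
  rw [hroots, prod_congr rfl fun c _ => (hf c).tprod_eq]
  refine (HasSum.tsum_eq (tendsto_of_eventually_coeff_eq fun x => ?_)).symm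
  obtain ⟨d, hd, hx⟩ := exists_coeff_eq_of_coeff_toField_eq x
  rw [SummationFilter.unconditional_filter]
  have : DecidablePred fun r : ℕ → ℕ → ℕ =>
    (∀ i, IsDescending (r i)) ∧ ∀ i, i ∉ Icc 1 l → r i = 0 := Classical.decPred _
  have : ∀ r : ℕ → ℕ → ℕ, Decidable (∀ i ∈ Icc 1 l, sz (r i) = d i) := fun _ => Classical.dec _
  filter_upwards [Filter.eventually_ge_atTop ((tuples d 1 l).subtype
    fun r => (∀ i, IsDescending (r i)) ∧ ∀ i, i ∉ Icc 1 l → r i = 0)] with s hs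
  refine hx _ _ ?_
  rw [← hb, coeff_bSum (by omega) hd, map_sum, map_sum]
  have hterm : ∀ r : {r : ℕ → ℕ → ℕ // (∀ i, IsDescending (r i)) ∧ ∀ i, i ∉ Icc 1 l → r i = 0},
      MvPowerSeries.coeff d (toField l (Q l ^ (E r.1).toNat
        * (∏ i ∈ Icc 1 l, Y l i ^ (∑ᶠ t : ℕ, r.1 i t))
        * ∏ i ∈ Icc 1 l, ∏ᶠ j : ℕ, Ring.inverse (qPoch l (r.1 i j - r.1 i (j + 1))))) =
      if ∀ i ∈ Icc 1 l, sz (r.1 i) = d i then tupleWeight qFrac l r.1 else 0 := fun r => by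
    obtain ⟨N, hN⟩ := exists_uniform_bound r.2.1 r.2.2
    rw [E_eq_bForm hE hN, coeff_toField_summand hl hN hd]
  rw [sum_congr rfl fun r _ => hterm r, ← sum_filter]
  refine sum_bij (fun r _ => r.1) (fun r hr => ?_) (fun _ _ _ _ h => Subtype.ext h)
    (fun r hr => ?_) fun _ _ => rfl
  · exact mem_tuples_iff_sz.2 ⟨r.2, (mem_filter.1 hr).2⟩
  · have h := mem_tuples_iff_sz.1 hr
    exact ⟨⟨r, h.1⟩, mem_filter.2 ⟨hs (mem_subtype.2 hr), h.2⟩, rfl⟩
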